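/- Vanishing identity for weight-3/2 Kloosterman sums at odd moduli: For all integers m, n ≥ 1, the series Σ_{odd c̃>0} (S(m,n,c̃,ν_Θ³)/√c̃)·sin(2π√(mn)/c̃) converges (as the limit of partial sums over odd c̃ ≤ x as x → ∞), and its value equals 0. -/

import Mathlib

open Complex Real Filter Topology BigOperators MeasureTheory

noncomputable section

/-- `ee x = exp(2πix)`. -/
def ee (x : ℂ) : ℂ := Complex.exp (2 * (π : ℂ) * Complex.I * x)

/-- `ε_d`: equals 1 if `d ≡ 1 (mod 4)` and `i` if `d ≡ 3 (mod 4)`. -/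
def epsFactor (d : ℕ) : ℂ := if d % 4 = 1 then 1 else Complex.I

/-- Weight-`w/2` Kloosterman sum with theta multiplier, even modulus `c`:
`S(m,n,c,ν_Θ^w) = Σ_d ε_d^w (2c/d)^w e((m a_d + n d)/(2c))`, the sum over `0 < d < 2c`
with `gcd(d,2c)=1` and `a_d` the inverse of `d` modulo `2c` in `(0,2c)`. -/
def SKe (m n : ℤ) (c : ℕ) (w : ℕ) : ℂ :=
  ∑ d ∈ Finset.Ico 1 (2 * c), ∑ a ∈ Finset.Ico 1 (2 * c),
    if (a * d) % (2 * c) = 1 then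
      epsFactor d ^ w * ((jacobiSym (2 * (c : ℤ)) d : ℤ) : ℂ) ^ w *
        ee (((m * a + n * d : ℤ) : ℂ) / (2 * (c : ℕ)))
    else 0

/-- Weight-`w/2` Kloosterman sum with theta multiplier, odd modulus `c`:
`S(m,n,c,ν_Θ^w) = e(w/8) ε_c^{-w} Σ_d (2d/c)^w e((m a_d + n d)/(2c))`, the sum over even
`0 ≤ d < 2c` with `gcd(d,c)=1` and `a_d` the unique even inverse of `d` mod `c` in `[0,2c)`. -/
def SKo (m n : ℤ) (c : ℕ) (w : ℕ) : ℂ :=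
  ee ((w : ℂ) / 8) * (epsFactor c)⁻¹ ^ w *
    ∑ d ∈ Finset.range (2 * c), ∑ a ∈ Finset.range (2 * c),
      if d % 2 = 0 ∧ a % 2 = 0 ∧ (a * d) % c = 1 % c then
        ((jacobiSym (2 * (d : ℤ)) c : ℤ) : ℂ) ^ w *
          ee (((m * a + n * d : ℤ) : ℂ) / (2 * (c : ℕ)))
      else 0

/-- The number of elements of `ZMod c` annihilated by `a`. -/
def annCard (c : ℕ) [NeZero c] (a : ZMod c) : ℕ :=
  (Finset.univ.filter fun z : ZMod c => a * z = 0).card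

lemma annCard_natCast_le (c : ℕ) [NeZero c] (j : ℕ) (hj : 0 < j) : annCard c (j : ZMod c) ≤ j := by
  have h := IsAddCyclic.card_nsmul_eq_zero_le (α := ZMod c) hj
  simpa [annCard, nsmul_eq_mul] using h

lemma card_mul_eq_le_annCard (c : ℕ) [NeZero c] (a t : ZMod c) :
    (Finset.univ.filter fun z : ZMod c => a * z = t).card ≤ annCard c a := by
  by_cases h : ∃ z₀ : ZMod c, a * z₀ = t
  · obtain ⟨z₀, hz⟩ := h
    refine Finset.card_le_card_of_injOn (fun z => z - z₀) ?_ ?_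
    · intro z hz'
      simp only [Finset.coe_filter, Finset.mem_univ, true_and, Set.mem_ofPred_eq] at hz' ⊢
      rw [mul_sub, hz', hz, sub_self]
    · intro x _ y _ h
      simpa using h
  · have : (Finset.univ.filter fun z : ZMod c => a * z = t) = ∅ := by
      ext z
      simp only [Finset.mem_filter, Finset.mem_univ, true_and, Finset.notMem_empty, iff_false]
      exact fun hz => h ⟨z, hz⟩
    rw [this]
    simp

lemma annCard_mul_le (c : ℕ) [NeZero c] (a b : ZMod c) :
    annCard c (a * b) ≤ annCard c a * annCard c b := by
  rw [mul_comm (annCard c a)]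
  unfold annCard
  refine Finset.card_le_mul_card_image_of_maps_to (f := fun z => a * z)
    (t := Finset.univ.filter fun z : ZMod c => b * z = 0) ?_ _ ?_ |>.trans_eq (mul_comm _ _)
  · intro z hz
    simp only [Finset.mem_filter, Finset.mem_univ, true_and] at hz ⊢
    rw [← hz]; ring
  · intro t _
    refine le_trans (Finset.card_le_card ?_) (card_mul_eq_le_annCard c a t)
    intro z hz
    simp only [Finset.mem_filter, Finset.mem_univ, true_and] at hz ⊢
    exact hz.2

lemma annCard_le_gcd (c : ℕ) [NeZero c] (a : ZMod c) : annCard c a ≤ Nat.gcd a.val c := by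
  have hg : 0 < Nat.gcd a.val c := Nat.gcd_pos_of_pos_right _ (NeZero.pos c)
  refine le_trans (Finset.card_le_card ?_) (annCard_natCast_le c _ hg)
  intro z hz
  simp only [Finset.mem_filter, Finset.mem_univ, true_and] at hz ⊢
  have h := Nat.gcd_eq_gcd_ab a.val c
  have h' : ((Nat.gcd a.val c : ℕ) : ZMod c) = a * (Nat.gcdA a.val c : ZMod c) := by
    have := congrArg (fun x : ℤ => (x : ZMod c)) h
    simpa using this
  rw [h', mul_right_comm, hz, zero_mul]

lemma sum_annCard_le (c : ℕ) [NeZero c] :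
    ∑ a : ZMod c, annCard c a ≤ c * c.divisors.card := by
  have hc : 0 < c := NeZero.pos c
  have h1 : ∑ a : ZMod c, annCard c a ≤ ∑ a ∈ Finset.range c, Nat.gcd a c := by
    calc ∑ a : ZMod c, annCard c a ≤ ∑ a : ZMod c, Nat.gcd a.val c :=
          Finset.sum_le_sum fun a _ => annCard_le_gcd c a
      _ = ∑ a ∈ Finset.univ.image (ZMod.val : ZMod c → ℕ), Nat.gcd a c :=
          (Finset.sum_image (f := fun a => Nat.gcd a c)
            fun x _ y _ h => ZMod.val_injective c h).symm
      _ ≤ _ := by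
          refine Finset.sum_le_sum_of_subset ?_
          intro x hx
          obtain ⟨a, -, rfl⟩ := Finset.mem_image.1 hx
          exact Finset.mem_range.2 (ZMod.val_lt a)
  refine h1.trans ?_
  calc ∑ a ∈ Finset.range c, Nat.gcd a c
      ≤ ∑ a ∈ Finset.range c, ∑ g ∈ c.divisors, if g ∣ a then g else 0 := by
        refine Finset.sum_le_sum fun a _ => ?_
        have hm : Nat.gcd a c ∈ c.divisors :=
          Nat.mem_divisors.2 ⟨Nat.gcd_dvd_right _ _, hc.ne'⟩
        refine le_trans ?_ (Finset.single_le_sum (f := fun g => if g ∣ a then g else 0)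
          (fun _ _ => Nat.zero_le _) hm)
        simp [Nat.gcd_dvd_left]
    _ = ∑ g ∈ c.divisors, ∑ a ∈ Finset.range c, if g ∣ a then g else 0 := Finset.sum_comm
    _ ≤ ∑ g ∈ c.divisors, c := by
        refine Finset.sum_le_sum fun g hg => ?_
        obtain ⟨k, rfl⟩ := Nat.dvd_of_mem_divisors hg
        have hg0 : 0 < g := Nat.pos_of_ne_zero (by rintro rfl; simp at hc)
        rw [← Finset.sum_filter, Finset.sum_const, smul_eq_mul, mul_comm g k]
        refine Nat.mul_le_mul_right _ ?_
        calc ((Finset.range (k * g)).filter fun a => g ∣ a).card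
            ≤ ((Finset.range k).image fun i => g * i).card := by
              refine Finset.card_le_card fun a ha => ?_
              obtain ⟨ha1, i, rfl⟩ := Finset.mem_filter.1 ha
              refine Finset.mem_image.2 ⟨i, Finset.mem_range.2 ?_, rfl⟩
              rw [Finset.mem_range, mul_comm k g] at ha1
              exact lt_of_mul_lt_mul_left ha1 (Nat.zero_le _)
          _ ≤ k := Finset.card_image_le.trans (by simp)
    _ = c * c.divisors.card := by rw [Finset.sum_const, smul_eq_mul, mul_comm]

/-- The classical Kloosterman sum. -/
def kloos (c : ℕ) [NeZero c] (m n : ZMod c) : ℂ :=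
  ∑ u : (ZMod c)ˣ, ZMod.stdAddChar (m * ((u⁻¹ : (ZMod c)ˣ) : ZMod c) + n * (u : ZMod c))

lemma kloos_unit_smul (c : ℕ) [NeZero c] (m n : ZMod c) (v : (ZMod c)ˣ) :
    kloos c (m * (v : ZMod c)) (n * ((v⁻¹ : (ZMod c)ˣ) : ZMod c)) = kloos c m n := by
  unfold kloos
  refine (Fintype.sum_equiv (Equiv.mulLeft v) _ _ ?_).symm
  intro u
  congr 1
  simp only [Equiv.coe_mulLeft, mul_inv_rev, Units.val_mul]
  have h : (v : ZMod c) * (v⁻¹ : (ZMod c)ˣ) = 1 := v.mul_inv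
  linear_combination (-(m * ((u⁻¹ : (ZMod c)ˣ) : ZMod c)) - n * (u : ZMod c)) * h

lemma sum_stdAddChar_mul (c : ℕ) [NeZero c] (b : ZMod c) :
    ∑ x : ZMod c, (ZMod.stdAddChar (x * b) : ℂ) = if b = 0 then (c : ℂ) else 0 := by
  have := AddChar.sum_mulShift (R := ZMod c) (R' := ℂ) (ψ := ZMod.stdAddChar) b
    (ZMod.isPrimitive_stdAddChar c)
  simpa [ZMod.card] using this

lemma kloos_mul_conj (c : ℕ) [NeZero c] (m n : ZMod c) :
    kloos c m n * kloos c m n * (starRingEnd ℂ (kloos c m n) * starRingEnd ℂ (kloos c m n)) =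
      ∑ p : ((ZMod c)ˣ × (ZMod c)ˣ) × ((ZMod c)ˣ × (ZMod c)ˣ),
        (ZMod.stdAddChar (m * ((p.1.1⁻¹ : (ZMod c)ˣ) + (p.1.2⁻¹ : (ZMod c)ˣ)
          - (p.2.1⁻¹ : (ZMod c)ˣ) - (p.2.2⁻¹ : (ZMod c)ˣ)) : ZMod c) : ℂ) *
        ZMod.stdAddChar (n * ((p.1.1 : ZMod c) + (p.1.2 : ZMod c) - (p.2.1 : ZMod c) - (p.2.2 : ZMod c))) := by
  have hc : starRingEnd ℂ (kloos c m n) =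
      ∑ u : (ZMod c)ˣ, ZMod.stdAddChar (-(m * ((u⁻¹ : (ZMod c)ˣ) : ZMod c) + n * (u : ZMod c))) := by
    unfold kloos
    rw [map_sum]
    refine Finset.sum_congr rfl fun u _ => ?_
    rw [AddChar.map_neg_eq_conj]
  rw [hc]
  unfold kloos
  rw [Fintype.sum_mul_sum, Fintype.sum_mul_sum, Fintype.sum_prod_type]
  simp_rw [← Fintype.sum_prod_type']
  rw [Fintype.sum_mul_sum, ← Fintype.sum_prod_type']
  refine Finset.sum_congr rfl fun p _ => ?_
  simp only [← AddChar.map_add_eq_mul]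
  congr 1
  ring

lemma card_kloos_quad_le (c : ℕ) [NeZero c] :
    (Finset.univ.filter fun p : ((ZMod c)ˣ × (ZMod c)ˣ) × ((ZMod c)ˣ × (ZMod c)ˣ) =>
      (((p.1.1⁻¹ : (ZMod c)ˣ) + (p.1.2⁻¹ : (ZMod c)ˣ)
          - (p.2.1⁻¹ : (ZMod c)ˣ) - (p.2.2⁻¹ : (ZMod c)ˣ) : ZMod c) = 0) ∧
      ((p.1.1 : ZMod c) + (p.1.2 : ZMod c) - (p.2.1 : ZMod c) - (p.2.2 : ZMod c)) = 0).card ≤ 2 * (c * c.divisors.card) ^ 2 := by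
  classical
  have h1 : (Finset.univ.filter fun p : ((ZMod c)ˣ × (ZMod c)ˣ) × ((ZMod c)ˣ × (ZMod c)ˣ) =>
      (((p.1.1⁻¹ : (ZMod c)ˣ) + (p.1.2⁻¹ : (ZMod c)ˣ)
          - (p.2.1⁻¹ : (ZMod c)ˣ) - (p.2.2⁻¹ : (ZMod c)ˣ) : ZMod c) = 0) ∧
      ((p.1.1 : ZMod c) + (p.1.2 : ZMod c) - (p.2.1 : ZMod c) - (p.2.2 : ZMod c)) = 0).card ≤
      (Finset.univ.filter fun t : (ZMod c × ZMod c) × ZMod c =>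
        (2 * (t.1.1 * t.1.2)) * t.2 = t.1.1 * t.1.2 * (t.1.1 + t.1.2)).card := by
    refine Finset.card_le_card_of_injOn
      (fun p => (((p.1.1 : ZMod c) - p.2.1, (p.1.1 : ZMod c) - p.2.2), (p.1.1 : ZMod c))) ?_ ?_
    · rintro ⟨⟨a, b⟩, ⟨d, e⟩⟩ hp
      simp only [Finset.coe_filter, Finset.mem_univ, true_and, Set.mem_ofPred_eq] at hp ⊢
      obtain ⟨h1, h2⟩ := hp
      have ha : (a : ZMod c) * (a⁻¹ : (ZMod c)ˣ) = 1 := a.mul_inv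
      have hb : (b : ZMod c) * (b⁻¹ : (ZMod c)ˣ) = 1 := b.mul_inv
      have hd : (d : ZMod c) * (d⁻¹ : (ZMod c)ˣ) = 1 := d.mul_inv
      have he : (e : ZMod c) * (e⁻¹ : (ZMod c)ˣ) = 1 := e.mul_inv
      have key : (b : ZMod c) * d * e + a * d * e - a * b * e - a * b * d = 0 := by
        have h1' : (a : ZMod c) * b * d * e * (((a⁻¹ : (ZMod c)ˣ) : ZMod c) + (b⁻¹ : (ZMod c)ˣ)
          - (d⁻¹ : (ZMod c)ˣ) - (e⁻¹ : (ZMod c)ˣ)) = 0 := by rw [h1, mul_zero]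
        linear_combination h1' - (b : ZMod c) * d * e * ha - (a : ZMod c) * d * e * hb +
          (a : ZMod c) * b * e * hd + (a : ZMod c) * b * d * he
      have hbe : (b : ZMod c) = d + e - a := by linear_combination h2
      rw [hbe] at key
      linear_combination key
    · rintro ⟨⟨a, b⟩, ⟨d, e⟩⟩ hp ⟨⟨a', b'⟩, ⟨d', e'⟩⟩ hp' heq
      simp only [Finset.coe_filter, Finset.mem_univ, true_and, Set.mem_ofPred_eq] at hp hp'
      simp only [Prod.mk.injEq] at heq
      obtain ⟨⟨h1, h2⟩, h3⟩ := heq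
      have ha : a = a' := Units.ext h3
      have hd : d = d' := Units.ext (by rw [h3] at h1; linear_combination -h1)
      have he : e = e' := Units.ext (by rw [h3] at h2; linear_combination -h2)
      have hb : b = b' := Units.ext (by
        have := hp.2
        have := hp'.2
        subst ha hd he
        linear_combination hp.2 - hp'.2)
      rw [ha, hb, hd, he]
  refine h1.trans ?_
  have h2 : (Finset.univ.filter fun t : (ZMod c × ZMod c) × ZMod c =>
        (2 * (t.1.1 * t.1.2)) * t.2 = t.1.1 * t.1.2 * (t.1.1 + t.1.2)).card =
      ∑ ab : ZMod c × ZMod c, (Finset.univ.filter fun z : ZMod c =>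
        (2 * (ab.1 * ab.2)) * z = ab.1 * ab.2 * (ab.1 + ab.2)).card := by
    simp_rw [Finset.card_filter]
    rw [Fintype.sum_prod_type]
  rw [h2]
  calc _ ≤ ∑ ab : ZMod c × ZMod c, 2 * (annCard c ab.1 * annCard c ab.2) := by
        refine Finset.sum_le_sum fun ab _ => ?_
        refine (card_mul_eq_le_annCard c _ _).trans ((annCard_mul_le c _ _).trans ?_)
        exact Nat.mul_le_mul (by exact_mod_cast annCard_natCast_le c 2 (by norm_num))
          (annCard_mul_le c _ _)
    _ = 2 * (∑ a : ZMod c, annCard c a) ^ 2 := by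
        rw [← Finset.mul_sum, Fintype.sum_prod_type, sq, Fintype.sum_mul_sum]
    _ ≤ _ := by
        gcongr
        exact sum_annCard_le c

lemma sum_norm_kloos_pow_le (c : ℕ) [NeZero c] :
    ∑ m : ZMod c, ∑ n : ZMod c, ‖kloos c m n‖ ^ 4 ≤
      2 * (c : ℝ) ^ 4 * (c.divisors.card : ℝ) ^ 2 := by
  classical
  have key : ((∑ m : ZMod c, ∑ n : ZMod c, ‖kloos c m n‖ ^ 4 : ℝ) : ℂ) =
      (c : ℂ) ^ 2 * ((Finset.univ.filter
        fun p : ((ZMod c)ˣ × (ZMod c)ˣ) × ((ZMod c)ˣ × (ZMod c)ˣ) =>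
      (((p.1.1⁻¹ : (ZMod c)ˣ) + (p.1.2⁻¹ : (ZMod c)ˣ)
          - (p.2.1⁻¹ : (ZMod c)ˣ) - (p.2.2⁻¹ : (ZMod c)ˣ) : ZMod c) = 0) ∧
      ((p.1.1 : ZMod c) + (p.1.2 : ZMod c) - (p.2.1 : ZMod c) - (p.2.2 : ZMod c)) = 0).card : ℂ) := by
    have h1 : ∀ m n : ZMod c, ((‖kloos c m n‖ ^ 4 : ℝ) : ℂ) =
        kloos c m n * kloos c m n *
          (starRingEnd ℂ (kloos c m n) * starRingEnd ℂ (kloos c m n)) := by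
      intro m n
      have := Complex.mul_conj' (kloos c m n)
      push_cast
      linear_combination (-(‖kloos c m n‖ : ℂ) ^ 2 -
        kloos c m n * starRingEnd ℂ (kloos c m n)) * this
    push_cast
    simp only [Complex.ofReal_pow] at h1
    simp_rw [h1, kloos_mul_conj]
    have : ∀ m : ZMod c, ∑ n : ZMod c, ∑ p : ((ZMod c)ˣ × (ZMod c)ˣ) × ((ZMod c)ˣ × (ZMod c)ˣ),
        (ZMod.stdAddChar (m * ((p.1.1⁻¹ : (ZMod c)ˣ) + (p.1.2⁻¹ : (ZMod c)ˣ)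
          - (p.2.1⁻¹ : (ZMod c)ˣ) - (p.2.2⁻¹ : (ZMod c)ˣ)) : ZMod c) : ℂ) *
        ZMod.stdAddChar (n * ((p.1.1 : ZMod c) + (p.1.2 : ZMod c) - (p.2.1 : ZMod c) - (p.2.2 : ZMod c))) =
        ∑ p : ((ZMod c)ˣ × (ZMod c)ˣ) × ((ZMod c)ˣ × (ZMod c)ˣ),
        (ZMod.stdAddChar (m * ((p.1.1⁻¹ : (ZMod c)ˣ) + (p.1.2⁻¹ : (ZMod c)ˣ)
          - (p.2.1⁻¹ : (ZMod c)ˣ) - (p.2.2⁻¹ : (ZMod c)ˣ)) : ZMod c) : ℂ) *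
        if ((p.1.1 : ZMod c) + (p.1.2 : ZMod c) - (p.2.1 : ZMod c) - (p.2.2 : ZMod c)) = 0 then (c : ℂ) else 0 := by
      intro m
      rw [Finset.sum_comm]
      simp_rw [← Finset.mul_sum, sum_stdAddChar_mul]
    simp_rw [this]
    rw [Finset.sum_comm]
    simp_rw [← Finset.sum_mul, sum_stdAddChar_mul]
    rw [Finset.card_filter]
    push_cast
    rw [Finset.mul_sum]
    refine Finset.sum_congr rfl fun p _ => ?_
    split_ifs <;> simp_all <;> ring
  have key' : (∑ m : ZMod c, ∑ n : ZMod c, ‖kloos c m n‖ ^ 4 : ℝ) =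
      (c : ℝ) ^ 2 * ((Finset.univ.filter
        fun p : ((ZMod c)ˣ × (ZMod c)ˣ) × ((ZMod c)ˣ × (ZMod c)ˣ) =>
      (((p.1.1⁻¹ : (ZMod c)ˣ) + (p.1.2⁻¹ : (ZMod c)ˣ)
          - (p.2.1⁻¹ : (ZMod c)ˣ) - (p.2.2⁻¹ : (ZMod c)ˣ) : ZMod c) = 0) ∧
      ((p.1.1 : ZMod c) + (p.1.2 : ZMod c) - (p.2.1 : ZMod c) - (p.2.2 : ZMod c)) = 0).card : ℝ) := by
    exact_mod_cast key
  rw [key']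
  have := card_kloos_quad_le c
  have h : ((Finset.univ.filter
        fun p : ((ZMod c)ˣ × (ZMod c)ˣ) × ((ZMod c)ˣ × (ZMod c)ˣ) =>
      (((p.1.1⁻¹ : (ZMod c)ˣ) + (p.1.2⁻¹ : (ZMod c)ˣ)
          - (p.2.1⁻¹ : (ZMod c)ˣ) - (p.2.2⁻¹ : (ZMod c)ˣ) : ZMod c) = 0) ∧
      ((p.1.1 : ZMod c) + (p.1.2 : ZMod c) - (p.2.1 : ZMod c) - (p.2.2 : ZMod c)) = 0).card : ℝ) ≤
      2 * ((c : ℝ) * c.divisors.card) ^ 2 := by exact_mod_cast this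
  calc _ ≤ (c : ℝ) ^ 2 * (2 * ((c : ℝ) * c.divisors.card) ^ 2) := by gcongr
    _ = _ := by ring

lemma le_totient_mul_card_divisors (c : ℕ) (hc : 0 < c) :
    c ≤ Nat.totient c * c.divisors.card := by
  calc c = ∑ d ∈ c.divisors, Nat.totient d := (Nat.sum_totient c).symm
    _ ≤ ∑ d ∈ c.divisors, Nat.totient c := Finset.sum_le_sum fun d hd =>
        Nat.le_of_dvd (Nat.totient_pos.2 hc) (Nat.totient_dvd_of_dvd (Nat.dvd_of_mem_divisors hd))
    _ = _ := by rw [Finset.sum_const, smul_eq_mul, mul_comm]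

lemma norm_kloos_pow_four_le (c : ℕ) [NeZero c] (m n : ZMod c) :
    ‖kloos c m n‖ ^ 4 ≤ 2 * annCard c m * (c : ℝ) ^ 3 * (c.divisors.card : ℝ) ^ 3 := by
  classical
  have hc : (0 : ℝ) < c := by exact_mod_cast NeZero.pos c
  set O : Finset (ZMod c × ZMod c) :=
    Finset.univ.image fun v : (ZMod c)ˣ => (m * (v : ZMod c), n * ((v⁻¹ : (ZMod c)ˣ) : ZMod c)) with hO
  have hcard : Nat.totient c ≤ annCard c m * O.card := by
    rw [← ZMod.card_units_eq_totient, ← Finset.card_univ]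
    refine Finset.card_le_mul_card_image_of_maps_to
      (fun v hv => Finset.mem_image_of_mem _ hv) _ ?_
    rintro ⟨a, b⟩ _
    refine le_trans ?_ (card_mul_eq_le_annCard c m a)
    refine Finset.card_le_card_of_injOn (fun v => (v : ZMod c)) ?_ ?_
    · intro v hv
      simp only [Finset.coe_filter, Finset.mem_univ, true_and, Set.mem_ofPred_eq,
        Prod.mk.injEq] at hv ⊢
      exact hv.1
    · intro x _ y _ h
      exact Units.ext h
  have hsum : (O.card : ℝ) * ‖kloos c m n‖ ^ 4 ≤ 2 * (c : ℝ) ^ 4 * (c.divisors.card : ℝ) ^ 2 := by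
    refine le_trans ?_ (sum_norm_kloos_pow_le c)
    rw [← Fintype.sum_prod_type' (f := fun m n => ‖kloos c m n‖ ^ 4)]
    calc (O.card : ℝ) * ‖kloos c m n‖ ^ 4 = ∑ p ∈ O, ‖kloos c p.1 p.2‖ ^ 4 := by
          rw [Finset.sum_congr rfl (g := fun _ => ‖kloos c m n‖ ^ 4), Finset.sum_const,
            nsmul_eq_mul]
          intro p hp
          obtain ⟨v, -, rfl⟩ := Finset.mem_image.1 hp
          rw [kloos_unit_smul]
      _ ≤ _ := Finset.sum_le_sum_of_subset_of_nonneg (Finset.subset_univ _)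
          fun _ _ _ => by positivity
  have htot : (c : ℝ) ≤ annCard c m * O.card * c.divisors.card := by
    have := (le_totient_mul_card_divisors c (NeZero.pos c)).trans
      (Nat.mul_le_mul_right _ hcard)
    exact_mod_cast this
  have h3 : (c : ℝ) * ‖kloos c m n‖ ^ 4 ≤
      c * (2 * annCard c m * (c : ℝ) ^ 3 * (c.divisors.card : ℝ) ^ 3) := by
    calc (c : ℝ) * ‖kloos c m n‖ ^ 4
        ≤ annCard c m * O.card * c.divisors.card * ‖kloos c m n‖ ^ 4 := by gcongr
      _ = annCard c m * c.divisors.card * (O.card * ‖kloos c m n‖ ^ 4) := by ring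
      _ ≤ annCard c m * c.divisors.card * (2 * (c : ℝ) ^ 4 * (c.divisors.card : ℝ) ^ 2) := by
          gcongr
      _ = _ := by ring
  exact le_of_mul_le_mul_left h3 hc

lemma norm_kloos_le (c : ℕ) [NeZero c] (j : ℕ) (hj : 1 ≤ j) (m n : ZMod c)
    (hm : annCard c m ≤ j) :
    ‖kloos c m n‖ ≤ 2 * j * (c : ℝ) ^ (3 / 4 : ℝ) * c.divisors.card := by
  have hc : (1 : ℝ) ≤ c := by exact_mod_cast NeZero.one_le
  have hτ : (1 : ℝ) ≤ c.divisors.card := by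
    exact_mod_cast Finset.card_pos.2 ⟨1, Nat.one_mem_divisors.2 (NeZero.ne c)⟩
  have hj' : (1 : ℝ) ≤ j := by exact_mod_cast hj
  have h := norm_kloos_pow_four_le c m n
  have h34 : ((c : ℝ) ^ (3 / 4 : ℝ)) ^ 4 = (c : ℝ) ^ 3 := by
    rw [← Real.rpow_natCast, ← Real.rpow_mul (by positivity)]
    norm_num
  refine le_of_pow_le_pow_left₀ (n := 4) (by norm_num) (by positivity) (h.trans ?_)
  rw [mul_pow, mul_pow, mul_pow, h34]
  have hm' : (annCard c m : ℝ) ≤ j := by exact_mod_cast hm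
  calc 2 * (annCard c m : ℝ) * (c : ℝ) ^ 3 * (c.divisors.card : ℝ) ^ 3
      ≤ 2 * (j : ℝ) * (c : ℝ) ^ 3 * (c.divisors.card : ℝ) ^ 3 := by gcongr
    _ ≤ 2 ^ 4 * (j : ℝ) ^ 4 * (c : ℝ) ^ 3 * (c.divisors.card : ℝ) ^ 4 := by
        have h1 : (j : ℝ) ≤ (j : ℝ) ^ 4 := le_self_pow₀ hj' (by norm_num)
        gcongr
        · norm_num
        · norm_num

lemma norm_geom_sum_Ico_le (ζ : ℂ) (h1 : ‖ζ‖ = 1) (hζ : ζ ≠ 1) (a b : ℕ) :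
    ‖∑ d ∈ Finset.Ico a b, ζ ^ d‖ ≤ 2 / ‖ζ - 1‖ := by
  rcases le_or_gt a b with hab | hab
  · rw [geom_sum_Ico hζ hab, norm_div]
    gcongr
    refine (norm_sub_le _ _).trans ?_
    rw [norm_pow, norm_pow, h1]
    norm_num
  · rw [Finset.Ico_eq_empty (by omega), Finset.sum_empty, norm_zero]
    positivity

lemma stdAddChar_mul_natCast (c : ℕ) [NeZero c] (h : ZMod c) (d : ℕ) :
    (ZMod.stdAddChar (h * (d : ZMod c)) : ℂ) = (ZMod.stdAddChar h : ℂ) ^ d := by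
  rw [mul_comm, ← nsmul_eq_mul, AddChar.map_nsmul_eq_pow]

lemma norm_stdAddChar_sub_one (c : ℕ) [NeZero c] (t : ℕ) :
    ‖(ZMod.stdAddChar (t : ZMod c) : ℂ) - 1‖ = |2 * Real.sin (π * t / c)| := by
  have := ZMod.stdAddChar_coe (N := c) (t : ℤ)
  simp only [Int.cast_natCast] at this
  rw [this]
  have h := Complex.norm_exp_I_mul_ofReal_sub_one (2 * π * t / c)
  rw [show (2 * π * t / c / 2 : ℝ) = π * t / c by ring] at h
  rw [Real.norm_eq_abs] at h
  rw [← h]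
  congr 3
  push_cast
  ring

lemma two_div_abs_sin_le (c t : ℕ) (h0 : 0 < t) (hc : t < c) :
    2 / |2 * Real.sin (π * t / c)| ≤ c / (2 * t) + c / (2 * (c - t : ℕ)) := by
  have ht' : (0 : ℝ) < t := by exact_mod_cast h0
  have hct : (0 : ℝ) < ((c - t : ℕ) : ℝ) := by exact_mod_cast Nat.sub_pos_of_lt hc
  have hsub : ((c - t : ℕ) : ℝ) = c - t := by rw [Nat.cast_sub hc.le]
  have hc0 : (0 : ℝ) < c := by exact_mod_cast (h0.trans hc)
  have key : ∀ s : ℝ, 0 < s → 2 * s ≤ c → 2 / |2 * Real.sin (π * s / c)| ≤ c / (2 * s) := by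
    intro s hs hsc
    have h1 : 2 / π * (π * s / c) ≤ Real.sin (π * s / c) := by
      refine Real.mul_le_sin (by positivity) ?_
      rw [div_le_div_iff₀ hc0 (by norm_num)]
      nlinarith [Real.pi_pos]
    have h2 : 2 / π * (π * s / c) = 2 * s / c := by field_simp
    rw [h2] at h1
    have h3 : 0 < 2 * s / c := by positivity
    rw [abs_of_pos (by linarith)]
    calc 2 / (2 * Real.sin (π * s / c)) ≤ 2 / (2 * (2 * s / c)) := by gcongr
      _ = c / (2 * s) := by field_simp
  rcases le_or_gt (2 * t) c with h | h
  · have := key t ht' (by exact_mod_cast h)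
    have h2 : (0 : ℝ) ≤ c / (2 * (c - t : ℕ)) := by positivity
    linarith
  · have h' : (c : ℝ) < 2 * t := by exact_mod_cast h
    have := key ((c - t : ℕ) : ℝ) hct (by rw [hsub]; linarith)
    have h2 : (0 : ℝ) ≤ c / (2 * t) := by positivity
    have h3 : Real.sin (π * ((c - t : ℕ) : ℝ) / c) = Real.sin (π * t / c) := by
      rw [hsub, ← Real.sin_pi_sub]
      congr 1
      field_simp
      ring
    rw [h3] at this
    linarith

/-- The function `z ↦ χ(m z⁻¹)` on units, extended by zero. -/
def invChar (c : ℕ) [NeZero c] (m z : ZMod c) : ℂ :=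
  if IsUnit z then ZMod.stdAddChar (m * z⁻¹) else 0

lemma invChar_eq_sum (c : ℕ) [NeZero c] (m z : ZMod c) :
    (c : ℂ) * invChar c m z = ∑ h : ZMod c, kloos c m h * ZMod.stdAddChar (-h * z) := by
  classical
  have h1 : ∀ h : ZMod c, kloos c m h * ZMod.stdAddChar (-h * z) =
      ∑ u : (ZMod c)ˣ, (ZMod.stdAddChar (m * ((u⁻¹ : (ZMod c)ˣ) : ZMod c)) : ℂ) *
        ZMod.stdAddChar (h * ((u : ZMod c) - z)) := by
    intro h
    rw [kloos, Finset.sum_mul]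
    refine Finset.sum_congr rfl fun u _ => ?_
    rw [← AddChar.map_add_eq_mul, ← AddChar.map_add_eq_mul]
    congr 1
    ring
  simp_rw [h1]
  rw [Finset.sum_comm]
  simp_rw [← Finset.mul_sum, sum_stdAddChar_mul, sub_eq_zero]
  unfold invChar
  split_ifs with hz
  · obtain ⟨v, rfl⟩ := hz
    rw [Finset.sum_eq_single v]
    · simp [mul_comm]
    · intro u _ huv
      rw [if_neg (fun h => huv (Units.ext h)), mul_zero]
    · simp
  · rw [mul_zero, eq_comm]
    refine Finset.sum_eq_zero fun u _ => ?_
    rw [if_neg, mul_zero]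
    rintro rfl
    exact hz u.isUnit

lemma invChar_mul_units_inv (c : ℕ) [NeZero c] (m z : ZMod c) (v : (ZMod c)ˣ) :
    invChar c (m * ((v⁻¹ : (ZMod c)ˣ) : ZMod c)) z = invChar c m (v * z) := by
  unfold invChar
  simp only [Units.isUnit_units_mul]
  split_ifs with hu
  · obtain ⟨w, rfl⟩ := hu
    rw [← Units.val_mul, ZMod.inv_coe_unit, ZMod.inv_coe_unit]
    congr 1
    rw [mul_inv, Units.val_mul]
    ring
  · rfl

lemma sum_norm_interval_le (c : ℕ) [NeZero c] (a b : ℕ) (hab : b ≤ a + c) :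
    ∑ h : ZMod c, ‖∑ d ∈ Finset.Ico a b, (ZMod.stdAddChar (-h * (d : ZMod c)) : ℂ)‖ ≤
      c * (2 + Real.log c) := by
  have hc0 : (0 : ℝ) < c := by exact_mod_cast NeZero.pos c
  have h1 : ∑ h : ZMod c, ‖∑ d ∈ Finset.Ico a b, (ZMod.stdAddChar (-h * (d : ZMod c)) : ℂ)‖ =
      ∑ h : ZMod c, ‖∑ d ∈ Finset.Ico a b, (ZMod.stdAddChar h : ℂ) ^ d‖ := by
    refine Fintype.sum_equiv (Equiv.neg (ZMod c)) _ _ fun h => ?_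
    simp only [Equiv.neg_apply]
    simp_rw [← stdAddChar_mul_natCast]
  rw [h1]
  have h2 : ∑ h : ZMod c, ‖∑ d ∈ Finset.Ico a b, (ZMod.stdAddChar h : ℂ) ^ d‖ =
      ∑ t ∈ Finset.range c, ‖∑ d ∈ Finset.Ico a b, (ZMod.stdAddChar (t : ZMod c) : ℂ) ^ d‖ := by
    symm
    refine Finset.sum_bij (fun t _ => (t : ZMod c)) (fun _ _ => Finset.mem_univ _) ?_ ?_ ?_
    · intro x hx y hy hxy
      rw [Finset.mem_range] at hx hy
      have := congrArg ZMod.val hxy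
      rwa [ZMod.val_cast_of_lt hx, ZMod.val_cast_of_lt hy] at this
    · intro z _
      exact ⟨z.val, Finset.mem_range.2 (ZMod.val_lt z), by simp⟩
    · intro _ _
      rfl
  rw [h2]
  obtain ⟨k, hk⟩ : ∃ k, c = k + 1 := ⟨c - 1, by have := NeZero.pos c; omega⟩
  have h3 : ∑ t ∈ Finset.range c,
      ‖∑ d ∈ Finset.Ico a b, (ZMod.stdAddChar (t : ZMod c) : ℂ) ^ d‖ =
      ∑ t ∈ Finset.range k,
      ‖∑ d ∈ Finset.Ico a b, (ZMod.stdAddChar ((t + 1 : ℕ) : ZMod c) : ℂ) ^ d‖ +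
      ‖∑ d ∈ Finset.Ico a b, (ZMod.stdAddChar ((0 : ℕ) : ZMod c) : ℂ) ^ d‖ := by
    have := Finset.sum_range_succ' (fun t : ℕ =>
      ‖∑ d ∈ Finset.Ico a b, (ZMod.stdAddChar (t : ZMod c) : ℂ) ^ d‖) k
    rwa [← hk] at this
  rw [h3]
  have h4 : ‖∑ d ∈ Finset.Ico a b, (ZMod.stdAddChar ((0 : ℕ) : ZMod c) : ℂ) ^ d‖ ≤ c := by
    simp only [Nat.cast_zero, AddChar.map_zero_eq_one, one_pow, Finset.sum_const, Nat.card_Ico,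
      nsmul_eq_mul, mul_one, Complex.norm_natCast]
    exact_mod_cast (by omega : b - a ≤ c)
  have h5 : ∑ t ∈ Finset.range k,
      ‖∑ d ∈ Finset.Ico a b, (ZMod.stdAddChar ((t + 1 : ℕ) : ZMod c) : ℂ) ^ d‖ ≤
      ∑ t ∈ Finset.range k, (c / (2 * (t + 1 : ℕ)) + c / (2 * (c - (t + 1) : ℕ)) : ℝ) := by
    refine Finset.sum_le_sum fun t ht => ?_
    rw [Finset.mem_range] at ht
    have htc : t + 1 < c := by omega
    have hs := two_div_abs_sin_le c (t + 1) (Nat.succ_pos t) htc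
    refine le_trans (norm_geom_sum_Ico_le _ (AddChar.norm_apply _ _) ?_ a b) ?_
    · intro h
      have h0 := ZMod.injective_stdAddChar (N := c) (h.trans (AddChar.map_zero_eq_one _).symm)
      rw [ZMod.natCast_eq_zero_iff] at h0
      exact absurd (Nat.le_of_dvd (Nat.succ_pos t) h0) (by omega)
    · rw [norm_stdAddChar_sub_one]
      exact hs
  have h6 : ∑ t ∈ Finset.range k, (c / (2 * (t + 1 : ℕ)) + c / (2 * (c - (t + 1) : ℕ)) : ℝ) =
      c * (harmonic k : ℝ) := by
    rw [Finset.sum_add_distrib]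
    have hr : ∑ t ∈ Finset.range k, (c / (2 * (c - (t + 1) : ℕ)) : ℝ) =
        ∑ t ∈ Finset.range k, (c / (2 * (t + 1 : ℕ)) : ℝ) := by
      rw [← Finset.sum_range_reflect]
      refine Finset.sum_congr rfl fun t ht => ?_
      rw [Finset.mem_range] at ht
      congr 3
      omega
    rw [hr, ← Finset.sum_add_distrib, harmonic]
    push_cast
    rw [Finset.mul_sum]
    refine Finset.sum_congr rfl fun t _ => ?_
    field_simp
    norm_num
  have h7 : (harmonic k : ℝ) ≤ 1 + Real.log c := by
    rcases Nat.eq_zero_or_pos k with rfl | hk0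
    · have : (0 : ℝ) ≤ Real.log c := Real.log_natCast_nonneg c
      simp
      linarith
    · refine (harmonic_le_one_add_log k).trans ?_
      have : Real.log k ≤ Real.log c := by
        apply Real.log_le_log (by exact_mod_cast hk0)
        exact_mod_cast (by omega : k ≤ c)
      linarith
  rw [h6] at h5
  nlinarith [mul_le_mul_of_nonneg_left h7 hc0.le]

lemma norm_sum_invChar_le (c : ℕ) [NeZero c] (j : ℕ) (hj : 1 ≤ j) (m : ZMod c)
    (hm : annCard c m ≤ j) (a b : ℕ) (hab : b ≤ a + c) :
    ‖∑ d ∈ Finset.Ico a b, invChar c m d‖ ≤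
      2 * j * (c : ℝ) ^ (3 / 4 : ℝ) * c.divisors.card * (2 + Real.log c) := by
  have hc0 : (0 : ℝ) < c := by exact_mod_cast NeZero.pos c
  have h1 : (c : ℂ) * ∑ d ∈ Finset.Ico a b, invChar c m d =
      ∑ h : ZMod c, kloos c m h *
        ∑ d ∈ Finset.Ico a b, (ZMod.stdAddChar (-h * (d : ZMod c)) : ℂ) := by
    rw [Finset.mul_sum]
    simp_rw [invChar_eq_sum]
    rw [Finset.sum_comm]
    simp_rw [Finset.mul_sum]
  have h2 : (c : ℝ) * ‖∑ d ∈ Finset.Ico a b, invChar c m d‖ ≤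
      c * (2 * j * (c : ℝ) ^ (3 / 4 : ℝ) * c.divisors.card * (2 + Real.log c)) := by
    calc (c : ℝ) * ‖∑ d ∈ Finset.Ico a b, invChar c m d‖
        = ‖(c : ℂ) * ∑ d ∈ Finset.Ico a b, invChar c m d‖ := by
          rw [norm_mul, Complex.norm_natCast]
      _ ≤ ∑ h : ZMod c, (2 * j * (c : ℝ) ^ (3 / 4 : ℝ) * c.divisors.card) *
            ‖∑ d ∈ Finset.Ico a b, (ZMod.stdAddChar (-h * (d : ZMod c)) : ℂ)‖ := by
          rw [h1]
          refine (norm_sum_le _ _).trans (Finset.sum_le_sum fun h _ => ?_)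
          rw [norm_mul]
          gcongr
          exact norm_kloos_le c j hj m h hm
      _ ≤ (2 * j * (c : ℝ) ^ (3 / 4 : ℝ) * c.divisors.card) * (c * (2 + Real.log c)) := by
          rw [← Finset.mul_sum]
          gcongr
          exact sum_norm_interval_le c a b hab
      _ = _ := by ring
  exact le_of_mul_le_mul_left h2 hc0

/-- The cosine of the modular inverse, restricted to a parity class. -/
def cosInv (j c r d : ℕ) : ℝ :=
  if d.Coprime c ∧ d % 2 = r then Real.cos (2 * π * j * ((d : ZMod c)⁻¹).val / c) else 0

/-- The completed bound for interval sums of `cosInv`. -/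
def kloosBound (j c : ℕ) : ℝ :=
  4 * j * (c : ℝ) ^ (3 / 4 : ℝ) * c.divisors.card * (2 + Real.log c)

lemma invChar_re (c : ℕ) [NeZero c] (j d : ℕ) :
    (invChar c j d).re =
      if d.Coprime c then Real.cos (2 * π * j * ((d : ZMod c)⁻¹).val / c) else 0 := by
  unfold invChar
  simp only [ZMod.isUnit_iff_coprime]
  split_ifs
  · have h := ZMod.stdAddChar_coe (N := c) ((j : ℤ) * (((d : ZMod c)⁻¹).val : ℤ))
    push_cast at h
    rw [ZMod.natCast_zmod_val] at h
    rw [h, show (2 * (π : ℂ) * I * (j * (((d : ZMod c)⁻¹).val : ℂ)) / c) =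
      ((2 * π * j * ((d : ZMod c)⁻¹).val / c : ℝ) : ℂ) * I by push_cast; ring,
      Complex.exp_ofReal_mul_I_re]
  · simp

lemma abs_sum_cosInv_le (j c r : ℕ) (hj : 1 ≤ j) (hc : 1 ≤ c) (a b : ℕ) (hab : b ≤ a + c) :
    |∑ d ∈ Finset.Ico a b, cosInv j c r d| ≤ kloosBound j c := by
  have : NeZero c := ⟨by omega⟩
  set B : ℝ := 2 * j * (c : ℝ) ^ (3 / 4 : ℝ) * c.divisors.card * (2 + Real.log c) with hB
  have hlog : 0 ≤ Real.log c := Real.log_natCast_nonneg c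
  have hB0 : 0 ≤ B := by positivity
  have hKB : kloosBound j c = B + B := by rw [kloosBound, hB]; ring
  have hall : |∑ d ∈ Finset.Ico a b, (invChar c j d).re| ≤ B := by
    rw [← Complex.re_sum]
    exact (Complex.abs_re_le_norm _).trans
      (norm_sum_invChar_le c j hj j (annCard_natCast_le c j hj) a b hab)
  have hodd_even : ∀ a b : ℕ, b ≤ a + c →
      c % 2 = 1 → |∑ d ∈ Finset.Ico a b, cosInv j c 0 d| ≤ B := by
    intro a b hab hodd
    have h2u : IsUnit ((2 : ℕ) : ZMod c) := by
      rw [ZMod.isUnit_iff_coprime]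
      exact (Nat.coprime_two_left.2 (Nat.odd_iff.2 hodd))
    obtain ⟨v, hv⟩ := h2u
    have hann : annCard c ((j : ZMod c) * ((v⁻¹ : (ZMod c)ˣ) : ZMod c)) ≤ j := by
      refine le_trans (le_of_eq ?_) (annCard_natCast_le c j hj)
      unfold annCard
      congr 1
      ext z
      simp only [Finset.mem_filter, Finset.mem_univ, true_and]
      rw [mul_right_comm, Units.mul_left_eq_zero]
    have hsum : ∑ d ∈ Finset.Ico a b, cosInv j c 0 d =
        ∑ d ∈ Finset.Ico ((a + 1) / 2) ((b + 1) / 2),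
          (invChar c ((j : ZMod c) * ((v⁻¹ : (ZMod c)ˣ) : ZMod c)) d).re := by
      symm
      refine Finset.sum_bij_ne_zero (fun d _ _ => 2 * d) ?_ ?_ ?_ ?_
      · intro d hd _
        rw [Finset.mem_Ico] at hd ⊢
        omega
      · intro d _ _ d' _ _ h
        omega
      · intro d hd hne
        have hp : d % 2 = 0 := by
          by_contra h
          exact hne (if_neg fun hh => h hh.2)
        have hcop : d.Coprime c := by
          by_contra h
          exact hne (if_neg fun hh => h hh.1)
        refine ⟨d / 2, ?_, ?_, by omega⟩
        · rw [Finset.mem_Ico] at hd ⊢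
          omega
        · have : (invChar c ((j : ZMod c) * ((v⁻¹ : (ZMod c)ˣ) : ZMod c)) (d / 2 : ℕ)) =
            invChar c j d := by
            have hd2 : ((d : ℕ) : ZMod c) = v * ((d / 2 : ℕ) : ZMod c) := by
              rw [hv, ← Nat.cast_mul]; congr 1; omega
            rw [hd2, invChar_mul_units_inv]
          rw [this, invChar_re]
          unfold cosInv at hne
          rw [if_pos ⟨hcop, hp⟩] at hne
          rwa [if_pos hcop]
      · intro d hd _
        have : (invChar c ((j : ZMod c) * ((v⁻¹ : (ZMod c)ˣ) : ZMod c)) d) =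
            invChar c j (2 * d : ℕ) := by
            have hd2 : ((2 * d : ℕ) : ZMod c) = v * (d : ZMod c) := by
              rw [hv, ← Nat.cast_mul]
            rw [hd2, invChar_mul_units_inv]
        rw [this, invChar_re, cosInv]
        simp
    rw [hsum, ← Complex.re_sum]
    exact (Complex.abs_re_le_norm _).trans
      (norm_sum_invChar_le c j hj _ hann _ _ (by omega))
  have hsplit : ∑ d ∈ Finset.Ico a b, (invChar c j d).re =
      ∑ d ∈ Finset.Ico a b, cosInv j c 0 d + ∑ d ∈ Finset.Ico a b, cosInv j c 1 d := by
    rw [← Finset.sum_add_distrib]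
    refine Finset.sum_congr rfl fun d _ => ?_
    rw [invChar_re]
    unfold cosInv
    rcases Nat.mod_two_eq_zero_or_one d with h | h <;> simp [h]
  have hr : r = 0 ∨ r = 1 ∨ 2 ≤ r := by omega
  have heven : c % 2 = 0 → ∑ d ∈ Finset.Ico a b, cosInv j c 0 d = 0 := by
    intro h
    refine Finset.sum_eq_zero fun d _ => if_neg ?_
    rintro ⟨h1, h2⟩
    have := Nat.dvd_gcd (Nat.dvd_of_mod_eq_zero h2) (Nat.dvd_of_mod_eq_zero h)
    rw [h1] at this
    omega
  have h0 : |∑ d ∈ Finset.Ico a b, cosInv j c 0 d| ≤ B := by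
    rcases Nat.mod_two_eq_zero_or_one c with h | h
    · rw [heven h]; simpa using hB0
    · exact hodd_even a b hab h
  rw [hKB]
  rcases hr with rfl | rfl | hr
  · linarith
  · rw [abs_le] at *
    constructor <;> linarith [h0.1, h0.2, hall.1, hall.2]
  · rw [Finset.sum_eq_zero]
    · simp; linarith
    · intro d _
      refine if_neg fun h => ?_
      omega

lemma summable_card_divisors_rpow (s : ℝ) (hs : 1 < s) :
    Summable fun c : ℕ => (c.divisors.card : ℝ) * (c : ℝ) ^ (-s) := by
  have hz : LSeriesSummable (fun n => ((ArithmeticFunction.zeta : ArithmeticFunction ℂ) n : ℂ)) s :=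
    ArithmeticFunction.LSeriesSummable_zeta_iff.2 (by simpa using hs)
  have h := (ArithmeticFunction.LSeriesSummable_mul hz hz).norm
  refine h.congr fun c => ?_
  rcases Nat.eq_zero_or_pos c with rfl | hc
  · simp
  · rw [LSeries.term_of_ne_zero hc.ne', norm_div, Complex.norm_natCast_cpow_of_pos hc,
      Real.rpow_neg (by positivity), Complex.ofReal_re, div_eq_mul_inv]
    congr 1
    rw [ArithmeticFunction.mul_apply]
    rw [Finset.sum_congr rfl (g := fun _ => (1 : ℂ))]
    · rw [Finset.sum_const, nsmul_eq_mul, mul_one, Complex.norm_natCast,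
        ← Nat.map_div_right_divisors, Finset.card_map]
    · intro x hx
      have := Nat.mem_divisorsAntidiagonal.1 hx
      have h1 : x.1 ≠ 0 := by rintro h; simp [h] at this; omega
      have h2 : x.2 ≠ 0 := by rintro h; simp [h] at this; omega
      simp [ArithmeticFunction.natCoe_apply, h1, h2]

lemma summable_kloosBound (j : ℕ) : Summable fun c : ℕ => kloosBound j c / (c : ℝ) ^ 2 := by
  have h := (summable_card_divisors_rpow (9 / 8) (by norm_num)).mul_left (4 * j * 10 : ℝ)
  refine Summable.of_nonneg_of_le ?_ ?_ h
  · intro c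
    have hlog : 0 ≤ Real.log c := Real.log_natCast_nonneg c
    unfold kloosBound
    positivity
  · intro c
    rcases Nat.eq_zero_or_pos c with rfl | hc
    · simp
    · have hc0 : (0 : ℝ) < c := by exact_mod_cast hc
      have hc1 : (1 : ℝ) ≤ c := by exact_mod_cast hc
      have hlog : Real.log c ≤ (c : ℝ) ^ (1 / 8 : ℝ) / (1 / 8) :=
        Real.log_le_rpow_div hc0.le (by norm_num)
      have h1 : (1 : ℝ) ≤ (c : ℝ) ^ (1 / 8 : ℝ) := Real.one_le_rpow hc1 (by norm_num)
      have h2 : (2 + Real.log c) ≤ 10 * (c : ℝ) ^ (1 / 8 : ℝ) := by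
        have : (c : ℝ) ^ (1 / 8 : ℝ) / (1 / 8) = 8 * (c : ℝ) ^ (1 / 8 : ℝ) := by ring
        linarith
      have h3 : (c : ℝ) ^ (3 / 4 : ℝ) * (c : ℝ) ^ (1 / 8 : ℝ) / (c : ℝ) ^ 2 =
          (c : ℝ) ^ (-(9 / 8) : ℝ) := by
        rw [← Real.rpow_natCast, ← Real.rpow_add hc0, ← Real.rpow_sub hc0]
        norm_num
      unfold kloosBound
      calc 4 * j * (c : ℝ) ^ (3 / 4 : ℝ) * c.divisors.card * (2 + Real.log c) / (c : ℝ) ^ 2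
          ≤ 4 * j * (c : ℝ) ^ (3 / 4 : ℝ) * c.divisors.card *
            (10 * (c : ℝ) ^ (1 / 8 : ℝ)) / (c : ℝ) ^ 2 := by gcongr
        _ = 4 * j * 10 * (c.divisors.card *
            ((c : ℝ) ^ (3 / 4 : ℝ) * (c : ℝ) ^ (1 / 8 : ℝ) / (c : ℝ) ^ 2)) := by ring
        _ = _ := by rw [h3]

/-- `sin (2πj · a/c)` where `a` is an inverse of `d` modulo `c`; zero when `c = 0`. -/
def cuspSin (j : ℕ) (c d : ℤ) : ℝ := Real.sin (2 * π * j * (Int.gcdA d c : ℝ) / c)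

lemma cuspSin_eq (j : ℕ) {a b c d : ℤ} (h : a * d - b * c = 1) :
    cuspSin j c d = Real.sin (2 * π * j * (a : ℝ) / c) := by
  rcases eq_or_ne c 0 with rfl | hc
  · simp [cuspSin]
  have hcop : IsCoprime d c := ⟨a, -b, by linear_combination h⟩
  have hg : d * Int.gcdA d c + c * Int.gcdB d c = 1 := by
    rw [← Int.gcd_eq_gcd_ab, Int.isCoprime_iff_gcd_eq_one.1 hcop]; rfl
  have hdvd : c ∣ (Int.gcdA d c - a) * d := ⟨-Int.gcdB d c - b, by linear_combination hg - h⟩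
  obtain ⟨k, hk⟩ := hcop.symm.dvd_of_dvd_mul_right hdvd
  have hk' : Int.gcdA d c = a + c * k := by linear_combination hk
  have hc' : (c : ℝ) ≠ 0 := by exact_mod_cast hc
  unfold cuspSin
  rw [hk', ← Real.sin_add_int_mul_two_pi (2 * π * j * (a : ℝ) / c) (j * k)]
  congr 1
  push_cast
  field_simp

lemma cuspSin_neg_neg (j : ℕ) {c d : ℤ} (h : IsCoprime c d) :
    cuspSin j (-c) (-d) = cuspSin j c d := by
  obtain ⟨u, v, huv⟩ := h
  rw [cuspSin_eq j (a := v) (b := -u) (c := c) (d := d) (by linear_combination huv),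
    cuspSin_eq j (a := -v) (b := u) (by linear_combination huv)]
  push_cast
  rw [mul_neg, neg_div_neg_eq]

lemma cuspSin_neg_right (j : ℕ) {c d : ℤ} (h : IsCoprime c d) :
    cuspSin j c (-d) = -cuspSin j c d := by
  obtain ⟨u, v, huv⟩ := h
  rw [cuspSin_eq j (a := v) (b := -u) (c := c) (d := d) (by linear_combination huv),
    cuspSin_eq j (a := -v) (b := -u) (by linear_combination huv), ← Real.sin_neg]
  push_cast
  ring_nf

lemma cuspSin_neg_left (j : ℕ) {c d : ℤ} (h : IsCoprime c d) :
    cuspSin j (-c) d = -cuspSin j c d := by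
  have := cuspSin_neg_neg j (c := c) (d := -d) h.neg_right
  rw [neg_neg] at this
  rw [this, cuspSin_neg_right j h]

/-- The difference of the values of `cuspSin` along the edge attached to the row `(c, d)`. -/
def edge (j : ℕ) (c d : ℤ) : ℝ := cuspSin j d (-c) - cuspSin j c d

lemma edge_eq_of_coprime (j : ℕ) {c d : ℤ} (h : IsCoprime c d) :
    edge j c d = -(cuspSin j c d + cuspSin j d c) := by
  rw [edge, cuspSin_neg_right j h.symm]
  ring

lemma edge_swap (j : ℕ) {c d : ℤ} (h : IsCoprime c d) : edge j d c = edge j c d := by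
  rw [edge_eq_of_coprime j h, edge_eq_of_coprime j h.symm, add_comm]

lemma edge_neg_right (j : ℕ) {c d : ℤ} (h : IsCoprime c d) : edge j c (-d) = -edge j c d := by
  rw [edge_eq_of_coprime j h, edge_eq_of_coprime j h.neg_right, cuspSin_neg_right j h,
    cuspSin_neg_left j h.symm]
  ring

lemma edge_neg_left (j : ℕ) {c d : ℤ} (h : IsCoprime c d) : edge j (-c) d = -edge j c d := by
  rw [← edge_swap j (c := -c) h.neg_left, edge_neg_right j h.symm, edge_swap j h]

lemma edge_neg_neg (j : ℕ) {c d : ℤ} (h : IsCoprime c d) : edge j (-c) (-d) = edge j c d := by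
  rw [edge_neg_left j h.neg_right, edge_neg_right j h, neg_neg]

lemma edge_eq_sin (j : ℕ) {a b c d : ℤ} (h : a * d - b * c = 1) (hc : c ≠ 0) (hd : d ≠ 0) :
    edge j c d = Real.sin (2 * π * j * (a : ℝ) / c - 2 * π * j / (c * d)) -
      Real.sin (2 * π * j * (a : ℝ) / c) := by
  have hc' : (c : ℝ) ≠ 0 := by exact_mod_cast hc
  have hd' : (d : ℝ) ≠ 0 := by exact_mod_cast hd
  rw [edge, cuspSin_eq j h, cuspSin_eq j (a := b) (b := -a) (c := d) (d := -c) (by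
    linear_combination h)]
  have h' : (a : ℝ) * d - b * c = 1 := by exact_mod_cast h
  congr 2
  field_simp
  linear_combination (-(j : ℝ)) * h'

lemma abs_edge_le (j : ℕ) {c d : ℤ} (h : IsCoprime c d) (hc : c ≠ 0) (hd : d ≠ 0) :
    |edge j c d| ≤ 2 * π * j / |(c : ℝ) * d| := by
  obtain ⟨u, v, huv⟩ := h
  rw [edge_eq_sin j (a := v) (b := -u) (by linear_combination huv) hc hd]
  refine (Real.abs_sin_sub_sin_le _ _).trans (le_of_eq ?_)
  rw [sub_sub_cancel_left, abs_neg, abs_div, abs_of_nonneg (by positivity)]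

lemma abs_sin_sub_self_le (h : ℝ) : |Real.sin h - h| ≤ 2 * h ^ 2 := by
  have key : ∀ x : ℝ, 0 ≤ x → |Real.sin x - x| ≤ 2 * x ^ 2 := by
    intro x hx
    have h1 := Real.sin_le hx
    rw [abs_of_nonpos (by linarith)]
    rcases eq_or_lt_of_le hx with rfl | hx0
    · simp
    rcases le_or_gt x 1 with h2 | h2
    · have := Real.sin_gt_sub_cube hx0
      nlinarith [sq_nonneg x, mul_nonneg (sq_nonneg x) hx]
    · have := Real.neg_one_le_sin x
      nlinarith
  rcases le_total 0 h with h0 | h0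
  · exact key h h0
  · have := key (-h) (by linarith)
    rw [Real.sin_neg, ← abs_neg] at this
    simpa [sub_eq_add_neg, add_comm] using this

lemma abs_sin_taylor_le (θ h : ℝ) :
    |Real.sin (θ - h) - Real.sin θ + h * Real.cos θ| ≤ 3 * h ^ 2 := by
  have e : Real.sin (θ - h) - Real.sin θ + h * Real.cos θ =
      Real.sin θ * (Real.cos h - 1) - Real.cos θ * (Real.sin h - h) := by
    rw [Real.sin_sub]; ring
  have h1 : |Real.cos h - 1| ≤ h ^ 2 := by
    have := Real.one_sub_sq_div_two_le_cos (x := h)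
    rw [abs_of_nonpos (by linarith [Real.cos_le_one h])]
    nlinarith [sq_nonneg h]
  have h2 := abs_sin_sub_self_le h
  rw [e]
  refine (abs_sub _ _).trans ?_
  rw [abs_mul, abs_mul]
  nlinarith [Real.abs_sin_le_one θ, Real.abs_cos_le_one θ, abs_nonneg (Real.cos h - 1),
    abs_nonneg (Real.sin h - h)]

/-- `edge` on pairs of natural numbers in a residue class modulo two. -/
def edgeCls (j r₁ r₂ c d : ℕ) : ℝ :=
  if d.Coprime c ∧ c % 2 = r₁ ∧ d % 2 = r₂ then edge j c d else 0

lemma abs_edgeCls_le (j r₁ r₂ : ℕ) {c d : ℕ} (hc : 1 ≤ c) (hd : 1 ≤ d) :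
    |edgeCls j r₁ r₂ c d| ≤ 2 * π * j / (c * d) := by
  unfold edgeCls
  split_ifs with h
  · have hcop : IsCoprime (c : ℤ) (d : ℤ) := Nat.isCoprime_iff_coprime.2 h.1.symm
    have := abs_edge_le j hcop (by exact_mod_cast (by omega : c ≠ 0))
      (by exact_mod_cast (by omega : d ≠ 0))
    simpa [abs_of_nonneg] using this
  · simp
    positivity

lemma abs_edgeCls_add_le (j r₁ r₂ : ℕ) {c d : ℕ} (hc : 1 ≤ c) (hd : 1 ≤ d) (hr : c % 2 = r₁) :
    |edgeCls j r₁ r₂ c d + 2 * π * j / (c * d) * cosInv j c r₂ d| ≤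
      3 * (2 * π * j / (c * d)) ^ 2 := by
  unfold edgeCls cosInv
  by_cases h : d.Coprime c ∧ d % 2 = r₂
  · rw [if_pos ⟨h.1, hr, h.2⟩, if_pos h]
    have : NeZero c := ⟨by omega⟩
    obtain ⟨b, hb⟩ : (c : ℤ) ∣ ((d : ZMod c)⁻¹).val * d - 1 := by
      rw [← ZMod.intCast_eq_intCast_iff_dvd_sub]
      push_cast
      rw [ZMod.natCast_zmod_val, mul_comm, ZMod.coe_mul_inv_eq_one _ h.1]
    rw [edge_eq_sin j (a := ((d : ZMod c)⁻¹).val) (b := b) (by linear_combination hb)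
      (by exact_mod_cast (by omega : c ≠ 0)) (by exact_mod_cast (by omega : d ≠ 0))]
    have := abs_sin_taylor_le (2 * π * j * (((d : ZMod c)⁻¹).val : ℝ) / c) (2 * π * j / (c * d))
    push_cast
    exact this
  · rw [if_neg (fun h' => h ⟨h'.1, h'.2.2⟩), if_neg h]
    simp
    positivity

lemma abs_sum_mul_le_of_antitone (g w : ℕ → ℝ) (B : ℝ) (a b : ℕ) (hab : a < b)
    (hw : ∀ d, a ≤ d → w (d + 1) ≤ w d) (hw0 : ∀ d, a ≤ d → 0 ≤ w d)
    (hB : ∀ b', b' ≤ b → |∑ d ∈ Finset.Ico a b', g d| ≤ B) :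
    |∑ d ∈ Finset.Ico a b, w d * g d| ≤ w a * B := by
  have key : ∀ n, a + n + 1 ≤ b → |∑ d ∈ Finset.Ico a (a + n + 1), w d * g d -
      w (a + n) * ∑ d ∈ Finset.Ico a (a + n + 1), g d| ≤ (w a - w (a + n)) * B := by
    intro n
    induction n with
    | zero => intro _; simp
    | succ n ih =>
      intro h
      have ih := ih (by omega)
      have h1 := hB (a + n + 1) (by omega)
      have h2 := hw (a + n) (by omega)
      have e : ∑ d ∈ Finset.Ico a (a + (n + 1) + 1), w d * g d -
          w (a + (n + 1)) * ∑ d ∈ Finset.Ico a (a + (n + 1) + 1), g d =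
          (∑ d ∈ Finset.Ico a (a + n + 1), w d * g d -
            w (a + n) * ∑ d ∈ Finset.Ico a (a + n + 1), g d) +
          (w (a + n) - w (a + n + 1)) * ∑ d ∈ Finset.Ico a (a + n + 1), g d := by
        rw [show a + (n + 1) = a + n + 1 by ring,
          Finset.sum_Ico_succ_top (b := a + n + 1) (by omega),
          Finset.sum_Ico_succ_top (b := a + n + 1) (by omega)]
        ring
      rw [e]
      refine (abs_add_le _ _).trans ?_
      rw [abs_mul, abs_of_nonneg (by linarith : (0 : ℝ) ≤ w (a + n) - w (a + n + 1))]
      have := mul_le_mul_of_nonneg_left h1 (by linarith : (0 : ℝ) ≤ w (a + n) - w (a + n + 1))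
      rw [show a + (n + 1) = a + n + 1 by ring]
      nlinarith
  obtain ⟨n, rfl⟩ : ∃ n, b = a + n + 1 := ⟨b - a - 1, by omega⟩
  have h1 := key n le_rfl
  have h2 := hB (a + n + 1) le_rfl
  have h3 : |w (a + n) * ∑ d ∈ Finset.Ico a (a + n + 1), g d| ≤ w (a + n) * B := by
    rw [abs_mul, abs_of_nonneg (hw0 _ (by omega))]
    exact mul_le_mul_of_nonneg_left h2 (hw0 _ (by omega))
  have h4 := abs_add_le (∑ d ∈ Finset.Ico a (a + n + 1), w d * g d -
      w (a + n) * ∑ d ∈ Finset.Ico a (a + n + 1), g d)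
      (w (a + n) * ∑ d ∈ Finset.Ico a (a + n + 1), g d)
  rw [sub_add_cancel] at h4
  linarith

lemma exists_eq_Ico_of_convex (S : Finset ℕ) (a b : ℕ) (hS : S ⊆ Finset.Ico a b)
    (hconv : ∀ x ∈ S, ∀ z ∈ S, ∀ y, x ≤ y → y ≤ z → y ∈ S) :
    ∃ a' b', a ≤ a' ∧ b' ≤ b ∧ S = Finset.Ico a' b' := by
  rcases S.eq_empty_or_nonempty with rfl | hne
  · refine ⟨max a b, min a b, le_max_left _ _, min_le_right _ _, ?_⟩
    rw [Finset.Ico_eq_empty (by omega)]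
  · have h1 := Finset.mem_Ico.1 (hS (S.min'_mem hne))
    have h2 := Finset.mem_Ico.1 (hS (S.max'_mem hne))
    refine ⟨S.min' hne, S.max' hne + 1, h1.1, h2.2, ?_⟩
    ext y
    rw [Finset.mem_Ico, Nat.lt_succ_iff]
    exact ⟨fun h => ⟨S.min'_le y h, S.le_max' y h⟩,
      fun h => hconv _ (S.min'_mem hne) _ (S.max'_mem hne) y h.1 h.2⟩

lemma abs_sum_convex_le (h : ℕ → ℝ) (B : ℝ) (a b : ℕ)
    (hB : ∀ a' b', a ≤ a' → b' ≤ b → |∑ d ∈ Finset.Ico a' b', h d| ≤ B)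
    (p : ℕ → Prop) [DecidablePred p] (hp : ∀ x y z, x ≤ y → y ≤ z → p x → p z → p y) :
    |∑ d ∈ Finset.Ico a b, if p d then h d else 0| ≤ B := by
  obtain ⟨a', b', h1, h2, h3⟩ := exists_eq_Ico_of_convex ((Finset.Ico a b).filter p) a b
    (Finset.filter_subset _ _) (by
      intro x hx z hz y hxy hyz
      rw [Finset.mem_filter, Finset.mem_Ico] at *
      exact ⟨by omega, hp x y z hxy hyz hx.2 hz.2⟩)
  rw [← Finset.sum_filter, h3]
  exact hB a' b' h1 h2

lemma quadratic_le_of_between {α β γ M x y z : ℤ} (hα : 0 ≤ α) (hxy : x ≤ y) (hyz : y ≤ z)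
    (hx : α * x ^ 2 + β * x + γ ≤ M) (hz : α * z ^ 2 + β * z + γ ≤ M) :
    α * y ^ 2 + β * y + γ ≤ M := by
  rcases eq_or_lt_of_le (hxy.trans hyz) with h | h
  · obtain rfl : x = y := by omega
    exact hx
  · have e : (α * x ^ 2 + β * x + γ) * (z - y) + (α * z ^ 2 + β * z + γ) * (y - x) -
      (α * y ^ 2 + β * y + γ) * (z - x) = α * ((z - x) * ((z - y) * (y - x))) := by ring
    have h1 : 0 ≤ α * ((z - x) * ((z - y) * (y - x))) :=
      mul_nonneg hα (mul_nonneg (by omega) (mul_nonneg (by omega) (by omega)))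
    have h2 := mul_le_mul_of_nonneg_right hx (by omega : 0 ≤ z - y)
    have h3 := mul_le_mul_of_nonneg_right hz (by omega : 0 ≤ y - x)
    refine le_of_mul_le_mul_right (a := z - x) ?_ (by omega)
    nlinarith

lemma abs_sum_quadratic_le (h : ℕ → ℝ) (B : ℝ) (a b : ℕ)
    (hB : ∀ a' b', a ≤ a' → b' ≤ b → |∑ d ∈ Finset.Ico a' b', h d| ≤ B) (α β γ N : ℤ)
    (hN : 0 ≤ N) :
    |∑ d ∈ Finset.Ico a b, if |α * (d : ℤ) ^ 2 + β * d + γ| ≤ N then h d else 0| ≤ 2 * B := by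
  have key : ∀ α β γ : ℤ, 0 ≤ α →
    |∑ d ∈ Finset.Ico a b, if |α * (d : ℤ) ^ 2 + β * d + γ| ≤ N then h d else 0| ≤ 2 * B := by
    intro α β γ hα
    have e : ∑ d ∈ Finset.Ico a b, (if |α * (d : ℤ) ^ 2 + β * d + γ| ≤ N then h d else 0) =
      ∑ d ∈ Finset.Ico a b, (if α * (d : ℤ) ^ 2 + β * d + γ ≤ N then h d else 0) -
      ∑ d ∈ Finset.Ico a b, (if α * (d : ℤ) ^ 2 + β * d + γ ≤ -N - 1 then h d else 0) := by
      rw [← Finset.sum_sub_distrib]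
      refine Finset.sum_congr rfl fun d _ => ?_
      generalize α * (d : ℤ) ^ 2 + β * d + γ = q
      simp only [abs_le]
      split_ifs <;> first | omega | simp
    rw [e]
    have hc : ∀ M : ℤ, |∑ d ∈ Finset.Ico a b,
        (if α * (d : ℤ) ^ 2 + β * d + γ ≤ M then h d else 0)| ≤ B := fun M =>
      abs_sum_convex_le h B a b hB _ fun x y z hxy hyz hx hz =>
        quadratic_le_of_between hα (by exact_mod_cast hxy) (by exact_mod_cast hyz) hx hz
    refine (abs_sub _ _).trans ?_
    linarith [hc N, hc (-N - 1)]
  rcases le_total 0 α with hα | hα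
  · exact key α β γ hα
  · have := key (-α) (-β) (-γ) (by omega)
    simpa only [show ∀ d : ℕ, -α * (d : ℤ) ^ 2 + -β * d + -γ = -(α * (d : ℤ) ^ 2 + β * d + γ)
      from fun d => by ring, abs_neg] using this

/-- Bound for interval sums of `edgeCls` in the range `c ≤ K d`. -/
def edgeBound (j K c : ℕ) : ℝ :=
  2 * π * j * K * (kloosBound j c / (c : ℝ) ^ 2) +
    12 * π ^ 2 * (j : ℝ) ^ 2 * (K : ℝ) ^ 2 * (1 / (c : ℝ) ^ 3)

lemma kloosBound_nonneg (j c : ℕ) : 0 ≤ kloosBound j c := by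
  have hlog : 0 ≤ Real.log c := Real.log_natCast_nonneg c
  unfold kloosBound
  positivity

lemma edgeBound_nonneg (j K c : ℕ) : 0 ≤ edgeBound j K c := by
  have := kloosBound_nonneg j c
  unfold edgeBound
  positivity

lemma summable_edgeBound (j K : ℕ) : Summable (edgeBound j K) :=
  ((summable_kloosBound j).mul_left _).add
    ((Real.summable_one_div_nat_pow.2 (by norm_num)).mul_left _)

lemma abs_sum_edgeCls_le (j r₁ r₂ K c a b : ℕ) (hj : 1 ≤ j) (hc : 1 ≤ c) (ha : c ≤ K * a)
    (hb : b ≤ c) : |∑ d ∈ Finset.Ico a b, edgeCls j r₁ r₂ c d| ≤ edgeBound j K c := by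
  rcases le_or_gt b a with hab | hab
  · rw [Finset.Ico_eq_empty (by omega)]
    simpa using edgeBound_nonneg j K c
  by_cases hr : c % 2 = r₁
  swap
  · rw [Finset.sum_eq_zero (f := fun d => edgeCls j r₁ r₂ c d)
      fun d _ => if_neg fun h => hr h.2.1]
    simpa using edgeBound_nonneg j K c
  have ha1 : 1 ≤ a := by
    rcases Nat.eq_zero_or_pos a with rfl | h
    · omega
    · exact h
  have hc0 : (0 : ℝ) < c := by exact_mod_cast hc
  have ha0 : (0 : ℝ) < a := by exact_mod_cast ha1
  have hinv : ∀ d : ℕ, a ≤ d → 1 / (d : ℝ) ≤ K / c := by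
    intro d hd
    have hd0 : (0 : ℝ) < d := by exact_mod_cast (by omega : 0 < d)
    rw [div_le_div_iff₀ hd0 hc0, one_mul]
    exact_mod_cast ha.trans (Nat.mul_le_mul_left K hd)
  have h1 : |∑ d ∈ Finset.Ico a b, (1 / (d : ℝ)) * cosInv j c r₂ d| ≤
      1 / (a : ℝ) * kloosBound j c := by
    refine abs_sum_mul_le_of_antitone _ (fun d : ℕ => 1 / (d : ℝ)) _ a b hab ?_ ?_ ?_
    · intro d hd
      have hd0 : (0 : ℝ) < d := by exact_mod_cast (by omega : 0 < d)
      push_cast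
      gcongr
      linarith
    · intro d _
      positivity
    · intro b' hb'
      exact abs_sum_cosInv_le j c r₂ hj hc a b' (by omega)
  have h2 : ∑ d ∈ Finset.Ico a b, edgeCls j r₁ r₂ c d =
      ∑ d ∈ Finset.Ico a b, (edgeCls j r₁ r₂ c d + 2 * π * j / (c * d) * cosInv j c r₂ d) -
      2 * π * j / c * ∑ d ∈ Finset.Ico a b, (1 / (d : ℝ)) * cosInv j c r₂ d := by
    rw [Finset.mul_sum, ← Finset.sum_sub_distrib]
    refine Finset.sum_congr rfl fun d hd => ?_
    have hd0 : (d : ℝ) ≠ 0 := by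
      have := (Finset.mem_Ico.1 hd).1
      exact_mod_cast (by omega : d ≠ 0)
    field_simp
    ring
  have h3 : |∑ d ∈ Finset.Ico a b,
      (edgeCls j r₁ r₂ c d + 2 * π * j / (c * d) * cosInv j c r₂ d)| ≤
      12 * π ^ 2 * (j : ℝ) ^ 2 * (K : ℝ) ^ 2 * (1 / (c : ℝ) ^ 3) := by
    calc _ ≤ ∑ d ∈ Finset.Ico a b,
          |edgeCls j r₁ r₂ c d + 2 * π * j / (c * d) * cosInv j c r₂ d| :=
          Finset.abs_sum_le_sum_abs _ _
      _ ≤ ∑ d ∈ Finset.Ico a b, 3 * (2 * π * j / c * (K / c)) ^ 2 := by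
          refine Finset.sum_le_sum fun d hd => ?_
          have hd := Finset.mem_Ico.1 hd
          refine (abs_edgeCls_add_le j r₁ r₂ hc (by omega) hr).trans ?_
          have e : 2 * π * j / ((c : ℝ) * d) = 2 * π * j / c * (1 / d) := by
            rw [mul_one_div, div_div]
          rw [e]
          have := hinv d hd.1
          gcongr
      _ = ((b - a : ℕ) : ℝ) * (3 * (2 * π * j / c * (K / c)) ^ 2) := by
          rw [Finset.sum_const, Nat.card_Ico, nsmul_eq_mul]
      _ ≤ (c : ℝ) * (3 * (2 * π * j / c * (K / c)) ^ 2) := by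
          gcongr
          omega
      _ = _ := by
          field_simp
          ring
  have h4 : |2 * π * j / c * ∑ d ∈ Finset.Ico a b, (1 / (d : ℝ)) * cosInv j c r₂ d| ≤
      2 * π * j * K * (kloosBound j c / (c : ℝ) ^ 2) := by
    rw [abs_mul, abs_of_nonneg (by positivity)]
    have := kloosBound_nonneg j c
    calc _ ≤ 2 * π * j / c * (K / c * kloosBound j c) := by
          have h5 := hinv a le_rfl
          gcongr
          refine h1.trans ?_
          exact mul_le_mul_of_nonneg_right h5 this
      _ = _ := by
          field_simp
  rw [h2]
  refine (abs_sub _ _).trans ?_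
  unfold edgeBound
  linarith

/-- The value at the row `(c, d)` of the quadratic form with matrix `(A, x; x, y)`. -/
def qf (A x y c d : ℤ) : ℤ := y * c ^ 2 + 2 * x * c * d + A * d ^ 2

/-- The contribution to the tail of the rows `(c, d)` and `(c, -d)`. -/
def tailTerm (j r₁ r₂ : ℕ) (A x y : ℤ) (N c d : ℕ) : ℝ :=
  edgeCls j r₁ r₂ c d * ((if |qf A x y c d| ≤ N then 1 else 0) -
    (if |qf A x y c (-d)| ≤ N then 1 else 0))

lemma abs_sum_tailTerm_le (j r₁ r₂ : ℕ) (A x y : ℤ) (N K c a b : ℕ) (hj : 1 ≤ j) (hc : 1 ≤ c)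
    (ha : c ≤ K * a) (hb : b ≤ c) :
    |∑ d ∈ Finset.Ico a b, tailTerm j r₁ r₂ A x y N c d| ≤ 4 * edgeBound j K c := by
  have hB : ∀ a' b', a ≤ a' → b' ≤ b →
      |∑ d ∈ Finset.Ico a' b', edgeCls j r₁ r₂ c d| ≤ edgeBound j K c := fun a' b' h1 h2 =>
    abs_sum_edgeCls_le j r₁ r₂ K c a' b' hj hc (ha.trans (Nat.mul_le_mul_left K h1)) (h2.trans hb)
  have e : ∑ d ∈ Finset.Ico a b, tailTerm j r₁ r₂ A x y N c d =
      ∑ d ∈ Finset.Ico a b, (if |A * (d : ℤ) ^ 2 + (2 * x * c) * d + y * c ^ 2| ≤ (N : ℤ) then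
        edgeCls j r₁ r₂ c d else 0) -
      ∑ d ∈ Finset.Ico a b, (if |A * (d : ℤ) ^ 2 + (-(2 * x * c)) * d + y * c ^ 2| ≤ (N : ℤ) then
        edgeCls j r₁ r₂ c d else 0) := by
    rw [← Finset.sum_sub_distrib]
    refine Finset.sum_congr rfl fun d _ => ?_
    have e1 : qf A x y c d = A * (d : ℤ) ^ 2 + (2 * x * c) * d + y * c ^ 2 := by
      unfold qf; ring
    have e2 : qf A x y c (-d) = A * (d : ℤ) ^ 2 + (-(2 * x * c)) * d + y * c ^ 2 := by
      unfold qf; ring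
    unfold tailTerm
    rw [e1, e2]
    split_ifs <;> simp
  rw [e]
  refine (abs_sub _ _).trans ?_
  have h1 := abs_sum_quadratic_le _ _ a b hB A (2 * x * c) (y * c ^ 2) N (by omega)
  have h2 := abs_sum_quadratic_le _ _ a b hB A (-(2 * x * c)) (y * c ^ 2) N (by omega)
  linarith

lemma abs_sub_le_and_lt_of_not_iff {u w N : ℤ} (h : ¬ (|u + w| ≤ N ↔ |u - w| ≤ N)) :
    |u| - |w| ≤ N ∧ |w| - |u| ≤ N ∧ N < |u| + |w| := by
  simp only [abs_le] at h
  rcases abs_cases u with ⟨h1, h1'⟩ | ⟨h1, h1'⟩ <;> rcases abs_cases w with ⟨h2, h2'⟩ | ⟨h2, h2'⟩ <;>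
    rw [h1, h2] <;> omega

lemma exceptional_rows_aux {A x y : ℤ} (hy : 0 < y) {K N d c : ℤ}
    (hK : 4 * |x| + 4 * |A| + 1 ≤ K) (hd : 0 < d) (hc : K * d < c)
    (h : ¬ (|qf A x y c d| ≤ N ↔ |qf A x y c (-d)| ≤ N)) :
    K * d ^ 2 ≤ 4 * N ∧ y * c ^ 2 + A * d ^ 2 - 2 * |x| * c * d ≤ N ∧
      N < y * c ^ 2 + A * d ^ 2 + 2 * |x| * c * d := by
  have hx0 := abs_nonneg x
  have hA0 := abs_nonneg A
  have hK1 : 1 ≤ K := by linarith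
  have hdc : d ≤ K * d := by nlinarith
  have hc0 : 0 < c := by linarith
  have e1 : qf A x y c d = (y * c ^ 2 + A * d ^ 2) + 2 * x * c * d := by unfold qf; ring
  have e2 : qf A x y c (-d) = (y * c ^ 2 + A * d ^ 2) - 2 * x * c * d := by unfold qf; ring
  rw [e1, e2] at h
  obtain ⟨h1, -, h2⟩ := abs_sub_le_and_lt_of_not_iff h
  have hw : |2 * x * c * d| = 2 * |x| * c * d := by
    rw [abs_mul, abs_mul, abs_mul, abs_of_pos hd, abs_of_pos hc0]; rfl
  have hAd : 4 * (|A| * d ^ 2) ≤ c ^ 2 := by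
    have : 4 * |A| * d ≤ c := by nlinarith
    nlinarith
  have hxd : 4 * (|x| * c * d) ≤ c ^ 2 := by
    have : 4 * |x| * d ≤ c := by nlinarith
    nlinarith
  have hA1 : -(|A| * d ^ 2) ≤ A * d ^ 2 := by
    have := neg_abs_le A
    nlinarith [sq_nonneg d]
  have hyc : c ^ 2 ≤ y * c ^ 2 := by nlinarith [sq_nonneg c]
  have hu : 0 ≤ y * c ^ 2 + A * d ^ 2 := by nlinarith [sq_nonneg c]
  rw [hw, abs_of_nonneg hu] at h1 h2
  refine ⟨?_, by linarith, by linarith⟩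
  have hKd : K * d ^ 2 ≤ c ^ 2 := by nlinarith
  linarith

lemma exceptional_rows {A x y : ℤ} (hD : 0 < x ^ 2 - A * y) {K N d c : ℤ}
    (hK : 4 * |x| + 4 * |A| + 1 ≤ K) (hd : 0 < d) (hc : K * d < c)
    (h : ¬ (|qf A x y c d| ≤ N ↔ |qf A x y c (-d)| ≤ N)) :
    K * d ^ 2 ≤ 4 * N ∧ ∀ c', c ≤ c' →
      ¬ (|qf A x y c' d| ≤ N ↔ |qf A x y c' (-d)| ≤ N) → c' - c ≤ (2 * |x| + |A|) * d := by
  have hx0 := abs_nonneg x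
  have hA0 := abs_nonneg A
  have hK1 : 1 ≤ K := by linarith
  have hdc : d ≤ K * d := by nlinarith
  have hc0 : 0 < c := by linarith
  have pos : ∀ {A x y : ℤ}, 0 < y → 4 * |x| + 4 * |A| + 1 ≤ K →
      ¬ (|qf A x y c d| ≤ N ↔ |qf A x y c (-d)| ≤ N) →
      K * d ^ 2 ≤ 4 * N ∧ ∀ c', c ≤ c' →
      ¬ (|qf A x y c' d| ≤ N ↔ |qf A x y c' (-d)| ≤ N) → c' - c ≤ (2 * |x| + |A|) * d := by
    intro A x y hy hK h
    obtain ⟨h1, -, h3⟩ := exceptional_rows_aux hy hK hd hc h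
    refine ⟨h1, fun c' hcc h' => ?_⟩
    obtain ⟨-, h2, -⟩ := exceptional_rows_aux hy hK hd (hc.trans_le hcc) h'
    have h4 : y * ((c' - c) * (c' + c)) < (2 * |x| * d) * (c' + c) := by nlinarith
    have h5 : (c' - c) * (c' + c) ≤ y * ((c' - c) * (c' + c)) := by
      have : 0 ≤ (c' - c) * (c' + c) := mul_nonneg (by linarith) (by linarith)
      nlinarith
    have h6 : c' - c < 2 * |x| * d :=
      lt_of_mul_lt_mul_right (h5.trans_lt h4) (by linarith)
    nlinarith [mul_nonneg (abs_nonneg A) hd.le]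
  rcases lt_trichotomy y 0 with hy | rfl | hy
  · have hneg : ∀ c d : ℤ, |qf (-A) (-x) (-y) c d| = |qf A x y c d| := by
      intro c d
      rw [← abs_neg]
      congr 1
      unfold qf
      ring
    have := pos (A := -A) (x := -x) (y := -y) (by omega) (by simpa only [abs_neg] using hK)
      (by simpa only [hneg] using h)
    simpa only [hneg, abs_neg] using this
  · have hx : 1 ≤ |x| := by
      have : x ≠ 0 := by rintro rfl; simp at hD
      have := abs_pos.2 this
      omega
    have mem : ∀ c, K * d < c → ¬ (|qf A x 0 c d| ≤ N ↔ |qf A x 0 c (-d)| ≤ N) →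
        2 * |x| * c * d - |A| * d ^ 2 ≤ N ∧ N < |A| * d ^ 2 + 2 * |x| * c * d := by
      intro c hc h
      have hc0 : 0 < c := by linarith
      have e1 : qf A x 0 c d = A * d ^ 2 + 2 * x * c * d := by unfold qf; ring
      have e2 : qf A x 0 c (-d) = A * d ^ 2 - 2 * x * c * d := by unfold qf; ring
      rw [e1, e2] at h
      obtain ⟨-, h1, h2⟩ := abs_sub_le_and_lt_of_not_iff h
      have hw : |2 * x * c * d| = 2 * |x| * c * d := by
        rw [abs_mul, abs_mul, abs_mul, abs_of_pos hd, abs_of_pos hc0]; rfl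
      have hu : |A * d ^ 2| = |A| * d ^ 2 := by
        rw [abs_mul, abs_of_nonneg (sq_nonneg d)]
      rw [hw, hu] at h1 h2
      exact ⟨h1, h2⟩
    obtain ⟨h1, h2⟩ := mem c hc h
    have hKd : K * d ^ 2 ≤ c * d := by nlinarith
    have hcd : 0 < c * d := mul_pos hc0 hd
    have hAd : |A| * d ^ 2 ≤ K * d ^ 2 := by nlinarith [sq_nonneg d]
    have hxcd : c * d ≤ |x| * c * d := by nlinarith
    refine ⟨by nlinarith, fun c' hcc h' => ?_⟩
    obtain ⟨h3, -⟩ := mem c' (hc.trans_le hcc) h'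
    have h4 : (|x| * (c' - c)) * d < (|A| * d) * d := by nlinarith
    have h5 := lt_of_mul_lt_mul_right h4 hd.le
    nlinarith [mul_nonneg hx0 hd.le]
  · exact pos hy hK h

lemma abs_tailTerm_le (j r₁ r₂ : ℕ) (A x y : ℤ) (N L : ℕ) {c d : ℕ} (hc : L < c) (hd : 1 ≤ d) :
    |tailTerm j r₁ r₂ A x y N c d| ≤
      if ¬ (|qf A x y c d| ≤ N ↔ |qf A x y c (-d)| ≤ N) then 2 * π * j / ((L + 1) * d) else 0 := by
  unfold tailTerm
  have h0 : |edgeCls j r₁ r₂ c d| ≤ 2 * π * j / ((L + 1) * d) := by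
    refine (abs_edgeCls_le j r₁ r₂ (by omega) hd).trans ?_
    have h1 : ((L : ℝ) + 1) ≤ c := by exact_mod_cast hc
    have h2 : (0 : ℝ) < d := by exact_mod_cast hd
    gcongr
  by_cases h1 : |qf A x y c d| ≤ N <;> by_cases h2 : |qf A x y c (-d)| ≤ N <;>
    simp [h1, h2, h0]

lemma card_exceptional_le {A x y : ℤ} (hD : 0 < x ^ 2 - A * y) (K N L Y d : ℕ)
    (hK : 4 * |x| + 4 * |A| + 1 ≤ K) (hd : 1 ≤ d) :
    ((Finset.Ioc L Y).filter fun c : ℕ => K * d < c ∧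
      ¬ (|qf A x y c d| ≤ N ↔ |qf A x y c (-d)| ≤ N)).card ≤
      if K * d ^ 2 ≤ 4 * N then (2 * x.natAbs + A.natAbs) * d + 1 else 0 := by
  set S := (Finset.Ioc L Y).filter fun c : ℕ => K * d < c ∧
      ¬ (|qf A x y c d| ≤ N ↔ |qf A x y c (-d)| ≤ N) with hS
  rcases S.eq_empty_or_nonempty with h | hne
  · rw [h]; simp
  · have hm := S.min'_mem hne
    set m := S.min' hne with hmdef
    obtain ⟨-, hm1, hm2⟩ := Finset.mem_filter.1 hm
    obtain ⟨h1, h2⟩ := exceptional_rows hD (K := K) (N := N) (d := d) (c := m) hK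
      (by exact_mod_cast hd) (by exact_mod_cast hm1) hm2
    rw [if_pos (by exact_mod_cast h1)]
    have hsub : S ⊆ Finset.Icc m (m + (2 * x.natAbs + A.natAbs) * d) := by
      intro c hc
      obtain ⟨-, hc1, hc2⟩ := Finset.mem_filter.1 hc
      have hmc : m ≤ c := S.min'_le c hc
      have := h2 c (by exact_mod_cast hmc) hc2
      rw [Finset.mem_Icc]
      refine ⟨hmc, ?_⟩
      zify
      linarith
    refine (Finset.card_le_card hsub).trans ?_
    rw [Nat.card_Icc]
    omega

lemma sum_exceptional_le {A x y : ℤ} (hD : 0 < x ^ 2 - A * y) (j r₁ r₂ K N L Y C : ℕ)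
    (hK : 4 * |x| + 4 * |A| + 1 ≤ K) (hN : N ≤ (C * (L + 1)) ^ 2) :
    |∑ c ∈ Finset.Ioc L Y, ∑ d ∈ (Finset.Ico 1 c).filter (fun d => K * d < c),
      tailTerm j r₁ r₂ A x y N c d| ≤
      4 * π * j * C * (2 * x.natAbs + A.natAbs + 1 : ℕ) / Real.sqrt K := by
  have hK0 : 0 < K := by
    have := abs_nonneg x
    have := abs_nonneg A
    omega
  have hK0' : (0 : ℝ) < K := by exact_mod_cast hK0
  have hL : (0 : ℝ) < (L : ℝ) + 1 := by positivity
  set c₀ : ℕ := 2 * x.natAbs + A.natAbs with hc₀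
  have step1 : |∑ c ∈ Finset.Ioc L Y, ∑ d ∈ (Finset.Ico 1 c).filter (fun d => K * d < c),
      tailTerm j r₁ r₂ A x y N c d| ≤
      ∑ c ∈ Finset.Ioc L Y, ∑ d ∈ Finset.Ico 1 (Y + 1),
        if (K * d < c ∧ ¬ (|qf A x y c d| ≤ N ↔ |qf A x y c (-d)| ≤ N)) then
          2 * π * j / ((L + 1) * d) else 0 := by
    refine (Finset.abs_sum_le_sum_abs _ _).trans (Finset.sum_le_sum fun c hc => ?_)
    obtain ⟨hLc, hcY⟩ := Finset.mem_Ioc.1 hc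
    refine (Finset.abs_sum_le_sum_abs _ _).trans ?_
    calc _ ≤ ∑ d ∈ (Finset.Ico 1 c).filter (fun d => K * d < c),
          (if (K * d < c ∧ ¬ (|qf A x y c d| ≤ N ↔ |qf A x y c (-d)| ≤ N)) then
          2 * π * j / ((L + 1) * d) else 0 : ℝ) := by
          refine Finset.sum_le_sum fun d hd => ?_
          obtain ⟨hd1, hd2⟩ := Finset.mem_filter.1 hd
          refine (abs_tailTerm_le j r₁ r₂ A x y N L hLc (Finset.mem_Ico.1 hd1).1).trans
            (le_of_eq ?_)
          simp only [hd2, true_and]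
      _ ≤ _ := by
          refine Finset.sum_le_sum_of_subset_of_nonneg ?_ fun _ _ _ => by positivity
          intro d hd
          have := Finset.mem_Ico.1 (Finset.mem_filter.1 hd).1
          rw [Finset.mem_Ico]
          omega
  refine step1.trans ?_
  rw [Finset.sum_comm]
  have step2 : ∀ d ∈ Finset.Ico 1 (Y + 1), (∑ c ∈ Finset.Ioc L Y,
      if (K * d < c ∧ ¬ (|qf A x y c d| ≤ N ↔ |qf A x y c (-d)| ≤ N)) then
          2 * π * j / ((L + 1) * d) else 0 : ℝ) ≤
      if K * d ^ 2 ≤ 4 * N then (c₀ + 1 : ℕ) * (2 * π * j / (L + 1)) else 0 := by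
    intro d hd
    have hd1 := (Finset.mem_Ico.1 hd).1
    have hd0 : (1 : ℝ) ≤ d := by exact_mod_cast hd1
    rw [← Finset.sum_filter, Finset.sum_const, nsmul_eq_mul]
    have h := card_exceptional_le hD K N L Y d hK hd1
    split_ifs at h ⊢ with h'
    · have h1 : ((((Finset.Ioc L Y).filter fun c : ℕ => K * d < c ∧
        ¬ (|qf A x y c d| ≤ N ↔ |qf A x y c (-d)| ≤ N)).card : ℕ) : ℝ) ≤ (c₀ + 1 : ℕ) * d := by
        refine (Nat.cast_le.2 h).trans ?_
        rw [hc₀]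
        push_cast
        nlinarith
      calc _ ≤ ((c₀ + 1 : ℕ) * d : ℝ) * (2 * π * j / ((L + 1) * d)) := by gcongr
        _ = _ := by field_simp
    · rw [Nat.le_zero.1 h]
      simp
  refine (Finset.sum_le_sum step2).trans ?_
  rw [← Finset.sum_filter, Finset.sum_const, nsmul_eq_mul]
  have hsq : (0 : ℝ) < Real.sqrt K := Real.sqrt_pos.2 hK0'
  have hcard : ((((Finset.Ico 1 (Y + 1)).filter fun d => K * d ^ 2 ≤ 4 * N).card : ℕ) : ℝ) ≤
      2 * C * (L + 1) / Real.sqrt K := by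
    set s := ⌊2 * C * ((L : ℝ) + 1) / Real.sqrt K⌋₊ with hs
    have hsub : (Finset.Ico 1 (Y + 1)).filter (fun d => K * d ^ 2 ≤ 4 * N) ⊆ Finset.Icc 1 s := by
      intro d hd
      obtain ⟨hd1, hd2⟩ := Finset.mem_filter.1 hd
      rw [Finset.mem_Icc]
      refine ⟨(Finset.mem_Ico.1 hd1).1, Nat.le_floor ?_⟩
      rw [le_div_iff₀ hsq]
      refine le_of_sq_le_sq ?_ (by positivity)
      rw [mul_pow, Real.sq_sqrt hK0'.le]
      have h1 : (K : ℝ) * (d : ℝ) ^ 2 ≤ 4 * N := by exact_mod_cast hd2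
      have h2 : (N : ℝ) ≤ (C * (L + 1)) ^ 2 := by exact_mod_cast hN
      nlinarith
    calc _ ≤ (((Finset.Icc 1 s).card : ℕ) : ℝ) := by exact_mod_cast Finset.card_le_card hsub
      _ = s := by simp
      _ ≤ _ := Nat.floor_le (by positivity)
  calc _ ≤ 2 * C * (L + 1) / Real.sqrt K * ((c₀ + 1 : ℕ) * (2 * π * j / (L + 1))) := by gcongr
    _ = _ := by
      field_simp
      ring

lemma tail_bound {A x y : ℤ} (hD : 0 < x ^ 2 - A * y) (j r₁ r₂ C : ℕ) (hj : 1 ≤ j) (ε : ℝ)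
    (hε : 0 < ε) : ∃ N₀ : ℕ, ∀ N ≥ N₀, ∀ L, N ≤ (C * (L + 1)) ^ 2 → ∀ Y,
      |∑ c ∈ Finset.Ioc L Y, ∑ d ∈ Finset.Ico 1 c, tailTerm j r₁ r₂ A x y N c d| ≤ ε := by
  obtain ⟨K, hK1, hK2⟩ : ∃ K : ℕ, 4 * |x| + 4 * |A| + 1 ≤ K ∧
      4 * π * j * C * (2 * x.natAbs + A.natAbs + 1 : ℕ) / Real.sqrt K ≤ ε / 2 := by
    have h1 : Tendsto (fun K : ℕ => 4 * π * j * C * (2 * x.natAbs + A.natAbs + 1 : ℕ) /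
        Real.sqrt K) atTop (𝓝 0) :=
      (Real.tendsto_sqrt_atTop.comp tendsto_natCast_atTop_atTop).const_div_atTop _
    have h2 := h1.eventually (eventually_le_nhds (by linarith : (0 : ℝ) < ε / 2))
    have h3 : ∀ᶠ K : ℕ in atTop, 4 * |x| + 4 * |A| + 1 ≤ (K : ℤ) :=
      tendsto_natCast_atTop_atTop.eventually (eventually_ge_atTop _)
    obtain ⟨K, hK⟩ := (h3.and h2).exists
    exact ⟨K, hK.1, hK.2⟩
  have hK0 : 0 < K := by
    have := abs_nonneg x
    have := abs_nonneg A
    omega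
  obtain ⟨s, hs⟩ := summable_iff_vanishing_norm.1 ((summable_edgeBound j K).mul_left 4) (ε / 2)
    (by linarith)
  obtain ⟨L₀, hL₀⟩ : ∃ L₀, s ⊆ Finset.range (L₀ + 1) := by
    obtain ⟨n, hn⟩ := s.exists_nat_subset_range
    exact ⟨n, hn.trans (Finset.range_mono (Nat.le_succ n))⟩
  refine ⟨(C * (L₀ + 1)) ^ 2 + 1, fun N hN L hNL Y => ?_⟩
  have hLL : L₀ ≤ L := by
    by_contra hlt
    push Not at hlt
    have : (C * (L + 1)) ^ 2 ≤ (C * (L₀ + 1)) ^ 2 := by gcongr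
    omega
  have hsplit : ∑ c ∈ Finset.Ioc L Y, ∑ d ∈ Finset.Ico 1 c, tailTerm j r₁ r₂ A x y N c d =
      ∑ c ∈ Finset.Ioc L Y, ∑ d ∈ (Finset.Ico 1 c).filter (fun d => K * d < c),
        tailTerm j r₁ r₂ A x y N c d +
      ∑ c ∈ Finset.Ioc L Y, ∑ d ∈ Finset.Ico ((c + K - 1) / K) c,
        tailTerm j r₁ r₂ A x y N c d := by
    rw [← Finset.sum_add_distrib]
    refine Finset.sum_congr rfl fun c hc => ?_
    have hc1 := (Finset.mem_Ioc.1 hc).1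
    rw [← Finset.sum_filter_add_sum_filter_not (Finset.Ico 1 c) (fun d => K * d < c)]
    congr 1
    refine Finset.sum_congr ?_ fun _ _ => rfl
    ext d
    rw [Finset.mem_filter, Finset.mem_Ico, Finset.mem_Ico, not_lt]
    have h1 : (c + K - 1) / K ≤ d ↔ c ≤ K * d := by
      rw [Nat.div_le_iff_le_mul_add_pred hK0]
      omega
    rw [h1]
    constructor
    · rintro ⟨h2, h3⟩; exact ⟨h3, h2.2⟩
    · rintro ⟨h2, h3⟩
      refine ⟨⟨?_, h3⟩, h2⟩
      rcases Nat.eq_zero_or_pos d with rfl | h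
      · omega
      · exact h
  rw [hsplit]
  refine (abs_add_le _ _).trans ?_
  have h1 := (sum_exceptional_le hD j r₁ r₂ K N L Y C hK1 hNL).trans hK2
  have h2 : |∑ c ∈ Finset.Ioc L Y, ∑ d ∈ Finset.Ico ((c + K - 1) / K) c,
        tailTerm j r₁ r₂ A x y N c d| ≤ ε / 2 := by
    calc _ ≤ ∑ c ∈ Finset.Ioc L Y, 4 * edgeBound j K c := by
          refine (Finset.abs_sum_le_sum_abs _ _).trans (Finset.sum_le_sum fun c hc => ?_)
          have hc1 := (Finset.mem_Ioc.1 hc).1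
          refine abs_sum_tailTerm_le j r₁ r₂ A x y N K c _ _ hj (by omega) ?_ le_rfl
          have e1 := Nat.div_add_mod (c + K - 1) K
          have e2 := Nat.mod_lt (c + K - 1) hK0
          omega
      _ ≤ ‖∑ c ∈ Finset.Ioc L Y, 4 * edgeBound j K c‖ := Real.le_norm_self _
      _ ≤ ε / 2 := by
          refine (hs _ ?_).le
          refine Finset.disjoint_left.2 fun c hc hcs => ?_
          have h3 := Finset.mem_range.1 (hL₀ hcs)
          have h4 := (Finset.mem_Ioc.1 hc).1
          omega
  linarith

lemma qf_sq (A x y c d : ℤ) :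
    (A * d + x * c) ^ 2 = (x ^ 2 - A * y) * c ^ 2 + A * qf A x y c d := by
  unfold qf; ring

lemma qf_swap (A x y c d : ℤ) : qf y x A d c = qf A x y c d := by
  unfold qf; ring

lemma qf_neg_neg (A x y c d : ℤ) : qf A x y (-c) (-d) = qf A x y c d := by
  unfold qf; ring

lemma qf_injective {A x y : ℤ} (hD : 0 < x ^ 2 - A * y) {c d d' : ℤ}
    (h0 : qf A x y c d ≠ 0) (h : qf A x y c d = qf A x y c d')
    (hs : SignType.sign (A * d + x * c) = SignType.sign (A * d' + x * c)) : d = d' := by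
  rcases eq_or_ne A 0 with rfl | hA
  · have hx : x ≠ 0 := by rintro rfl; simp at hD
    have hc : c ≠ 0 := by rintro rfl; simp [qf] at h0
    have : 2 * x * c * (d - d') = 0 := by unfold qf at h; linear_combination h
    simp [hx, hc] at this
    omega
  · have h1 : (A * d + x * c) ^ 2 = (A * d' + x * c) ^ 2 := by rw [qf_sq, qf_sq, h]
    have h2 : A * d + x * c = A * d' + x * c := by
      have h3 := sign_mul_abs (A * d + x * c)
      rw [hs, (sq_eq_sq_iff_abs_eq_abs _ _).1 h1, sign_mul_abs] at h3
      exact h3.symm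
    exact mul_left_cancel₀ hA (by linear_combination h2)

lemma summable_indicator_qf {A x y : ℤ} (hD : 0 < x ^ 2 - A * y) (N : ℕ) :
    Summable (Set.indicator {v : ℤ × ℤ | qf A x y v.1 v.2 ≠ 0 ∧ |qf A x y v.1 v.2| ≤ N}
      (fun v => 1 / (v.1 : ℝ) ^ 2)) := by
  have h1 : Summable (fun c : ℤ => 1 / (c : ℝ) ^ 2) :=
    Real.summable_one_div_int_pow.2 (by norm_num)
  have h2 : Summable (fun p : ℤ × SignType => if |p.1| ≤ N then (1 : ℝ) else 0) := by
    refine summable_of_hasFiniteSupport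
      (((Set.finite_Icc (-(N : ℤ)) N).prod (Set.finite_univ (α := SignType))).subset ?_)
    intro p hp
    have : |p.1| ≤ N := by
      by_contra h
      simp [h] at hp
    exact ⟨abs_le.1 this, trivial⟩
  have h3 := h1.mul_of_nonneg h2 (fun _ => by positivity) (fun p => by positivity)
  rw [← summable_subtype_iff_indicator]
  let φ : {v : ℤ × ℤ | qf A x y v.1 v.2 ≠ 0 ∧ |qf A x y v.1 v.2| ≤ N} → ℤ × ℤ × SignType :=
    fun v => (v.1.1, qf A x y v.1.1 v.1.2, SignType.sign (A * v.1.2 + x * v.1.1))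
  have hφ : Function.Injective φ := by
    rintro ⟨⟨c, d⟩, h, h'⟩ ⟨⟨c', d'⟩, k, k'⟩ he
    simp only [φ, Prod.mk.injEq] at he
    obtain ⟨rfl, he1, he2⟩ := he
    have := qf_injective hD h he1 he2
    subst this
    rfl
  refine (h3.comp_injective hφ).congr fun v => ?_
  have := v.2.2
  simp only [Function.comp, φ]
  rw [if_pos this, mul_one]

lemma edge_zero_left (j : ℕ) {d : ℤ} (h : IsCoprime 0 d) : edge j 0 d = 0 := by
  have := edge_neg_left j h
  simp only [neg_zero] at this
  linarith

lemma edge_zero_right (j : ℕ) {c : ℤ} (h : IsCoprime c 0) : edge j c 0 = 0 := by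
  rw [← edge_swap j h, edge_zero_left j h.symm]

lemma edge_one_one (j : ℕ) : edge j 1 1 = 0 := by
  have h : cuspSin j 1 1 = 0 := by
    rw [cuspSin_eq j (a := 0) (b := -1) (by norm_num)]
    simp
  rw [edge_eq_of_coprime j isCoprime_one_left, h]
  simp

lemma abs_edge_le_add (j : ℕ) {c d : ℤ} (h : IsCoprime c d) :
    |edge j c d| ≤ π * j * (1 / (c : ℝ) ^ 2 + 1 / (d : ℝ) ^ 2) := by
  rcases eq_or_ne c 0 with rfl | hc
  · rw [edge_zero_left j h, abs_zero]; positivity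
  rcases eq_or_ne d 0 with rfl | hd
  · rw [edge_zero_right j h, abs_zero]; positivity
  refine (abs_edge_le j h hc hd).trans ?_
  have hc' : (0 : ℝ) < |(c : ℝ)| := abs_pos.2 (by exact_mod_cast hc)
  have hd' : (0 : ℝ) < |(d : ℝ)| := abs_pos.2 (by exact_mod_cast hd)
  rw [abs_mul, ← sq_abs (c : ℝ), ← sq_abs (d : ℝ)]
  have key : 2 / (|(c : ℝ)| * |(d : ℝ)|) ≤ 1 / |(c : ℝ)| ^ 2 + 1 / |(d : ℝ)| ^ 2 := by
    have := sq_nonneg (1 / |(c : ℝ)| - 1 / |(d : ℝ)|)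
    have e : (1 / |(c : ℝ)| - 1 / |(d : ℝ)|) ^ 2 =
        1 / |(c : ℝ)| ^ 2 + 1 / |(d : ℝ)| ^ 2 - 2 / (|(c : ℝ)| * |(d : ℝ)|) := by
      field_simp; ring
    linarith
  calc 2 * π * j / (|(c : ℝ)| * |(d : ℝ)|) = π * j * (2 / (|(c : ℝ)| * |(d : ℝ)|)) := by ring
    _ ≤ _ := by gcongr

open Classical in
/-- The edge function on coprime pairs in a class modulo two where `|qf| ≤ N`. -/
def edgeTerm (j t₁ t₂ : ℕ) (A x y : ℤ) (N : ℕ) (v : ℤ × ℤ) : ℝ :=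
  if IsCoprime v.1 v.2 ∧ v.1 % 2 = t₁ ∧ v.2 % 2 = t₂ ∧ |qf A x y v.1 v.2| ≤ N then
    edge j v.1 v.2 else 0

lemma summable_edgeTerm {A x y : ℤ} (hD : 0 < x ^ 2 - A * y) (j t₁ t₂ : ℕ)
    (hne : ∀ c d : ℤ, c % 2 = t₁ → d % 2 = t₂ → qf A x y c d ≠ 0) (N : ℕ) :
    Summable (edgeTerm j t₁ t₂ A x y N) := by
  have h1 := summable_indicator_qf hD N
  have h2 := summable_indicator_qf (A := y) (x := x) (y := A) (by linarith) N
  have h2' := (Equiv.prodComm ℤ ℤ).summable_iff.2 h2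
  refine Summable.of_norm_bounded ((h1.add h2').mul_left (π * j)) fun v => ?_
  have h3 : ∀ (s : Set (ℤ × ℤ)) (w : ℤ × ℤ), 0 ≤ s.indicator (fun v => 1 / (v.1 : ℝ) ^ 2) w :=
    fun s w => Set.indicator_nonneg (fun _ _ => by positivity) _
  unfold edgeTerm
  split_ifs with h
  · obtain ⟨hc, e1, e2, hN⟩ := h
    have h0 := hne _ _ e1 e2
    rw [Function.comp, Set.indicator_of_mem (by exact ⟨h0, hN⟩),
      Set.indicator_of_mem (by
        simp only [Equiv.prodComm_apply, Set.mem_ofPred_eq, Prod.fst_swap, Prod.snd_swap]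
        rw [qf_swap]
        exact ⟨h0, hN⟩)]
    exact abs_edge_le_add j hc
  · rw [norm_zero]
    exact mul_nonneg (by positivity) (add_nonneg (h3 _ _) (h3 _ _))

lemma edgeTerm_add_neg_right (j t₁ t₂ : ℕ) (A x y : ℤ) (N c d : ℕ) :
    edgeTerm j t₁ t₂ A x y N (c, d) + edgeTerm j t₁ t₂ A x y N (c, -d) =
      tailTerm j t₁ t₂ A x y N c d := by
  unfold edgeTerm tailTerm edgeCls
  simp only [IsCoprime.neg_right_iff, Int.neg_emod_two, Nat.isCoprime_iff_coprime]
  have e1 : ((c : ℤ) % 2 = t₁) ↔ c % 2 = t₁ := by omega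
  have e2 : ((d : ℤ) % 2 = t₂) ↔ d % 2 = t₂ := by omega
  have e3 : c.Coprime d ↔ d.Coprime c := Nat.coprime_comm
  simp only [e1, e2, e3]
  by_cases h : d.Coprime c ∧ c % 2 = t₁ ∧ d % 2 = t₂
  · have hcop : IsCoprime (c : ℤ) (d : ℤ) := Nat.isCoprime_iff_coprime.2 h.1.symm
    have h1 : ∀ p : Prop, (d.Coprime c ∧ c % 2 = t₁ ∧ d % 2 = t₂ ∧ p) ↔ p :=
      fun p => ⟨fun hp => hp.2.2.2, fun hp => ⟨h.1, h.2.1, h.2.2, hp⟩⟩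
    simp only [h1]
    rw [if_pos h, edge_neg_right j hcop]
    split_ifs <;> ring
  · have h1 : ∀ p : Prop, ¬ (d.Coprime c ∧ c % 2 = t₁ ∧ d % 2 = t₂ ∧ p) :=
      fun p hp => h ⟨hp.1, hp.2.1, hp.2.2.1⟩
    simp [h1, h]

lemma edgeTerm_neg_neg (j t₁ t₂ : ℕ) (A x y : ℤ) (N : ℕ) (c d : ℤ) :
    edgeTerm j t₁ t₂ A x y N (-c, -d) = edgeTerm j t₁ t₂ A x y N (c, d) := by
  unfold edgeTerm
  simp only [IsCoprime.neg_right_iff, IsCoprime.neg_left_iff, Int.neg_emod_two, qf_neg_neg]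
  split_ifs with h
  · exact edge_neg_neg j h.1
  · rfl

lemma edgeTerm_zero_left (j t₁ t₂ : ℕ) (A x y : ℤ) (N : ℕ) (d : ℤ) :
    edgeTerm j t₁ t₂ A x y N (0, d) = 0 := by
  unfold edgeTerm
  split_ifs with h
  · exact edge_zero_left j h.1
  · rfl

lemma edgeTerm_zero_right (j t₁ t₂ : ℕ) (A x y : ℤ) (N : ℕ) (c : ℤ) :
    edgeTerm j t₁ t₂ A x y N (c, 0) = 0 := by
  unfold edgeTerm
  split_ifs with h
  · exact edge_zero_right j h.1
  · rfl

lemma sum_box_edgeTerm (j t₁ t₂ : ℕ) (A x y : ℤ) (N Y : ℕ) :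
    ∑ v ∈ Finset.Icc (-(Y : ℤ)) Y ×ˢ Finset.Icc (-(Y : ℤ)) Y, edgeTerm j t₁ t₂ A x y N v =
      2 * ∑ c ∈ Finset.range (Y + 1), ∑ d ∈ Finset.range (Y + 1),
        tailTerm j t₁ t₂ A x y N c d := by
  rw [Finset.sum_product]
  have e1 : ∀ c : ℤ, ∑ d ∈ Finset.Icc (-(Y : ℤ)) Y, edgeTerm j t₁ t₂ A x y N (c, d) =
      ∑ d ∈ Finset.range (Y + 1),
        (edgeTerm j t₁ t₂ A x y N (c, d) + edgeTerm j t₁ t₂ A x y N (c, -d)) := by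
    intro c
    have h1 : ∑ d ∈ Finset.Icc (-(Y : ℤ)) Y, edgeTerm j t₁ t₂ A x y N (c, -d) =
        ∑ d ∈ Finset.Icc (-(Y : ℤ)) Y, edgeTerm j t₁ t₂ A x y N (c, d) :=
      Finset.sum_nbij' (fun d => -d) (fun d => -d) (by simp; omega) (by simp; omega)
        (by simp) (by simp) (by simp)
    have h2 := Finset.sum_Icc_of_even_eq_range (f := fun d : ℤ =>
      edgeTerm j t₁ t₂ A x y N (c, d) + edgeTerm j t₁ t₂ A x y N (c, -d))
      (fun d => by simp only [neg_neg]; ring) Y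
    rw [Finset.sum_add_distrib, h1] at h2
    simp only [neg_zero, edgeTerm_zero_right, two_nsmul] at h2
    linarith
  simp only [e1]
  rw [Finset.sum_Icc_of_even_eq_range (f := fun c : ℤ => ∑ d ∈ Finset.range (Y + 1),
        (edgeTerm j t₁ t₂ A x y N (c, d) + edgeTerm j t₁ t₂ A x y N (c, -d)))]
  · simp only [edgeTerm_zero_left, edgeTerm_add_neg_right]
    simp
  · intro c
    refine Finset.sum_congr rfl fun d _ => ?_
    rw [edgeTerm_neg_neg, ← edgeTerm_neg_neg j t₁ t₂ A x y N (-c) d, neg_neg, add_comm]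

lemma edgeCls_swap (j t₁ t₂ c d : ℕ) : edgeCls j t₁ t₂ c d = edgeCls j t₂ t₁ d c := by
  unfold edgeCls
  by_cases h : d.Coprime c ∧ c % 2 = t₁ ∧ d % 2 = t₂
  · have hcop : IsCoprime (c : ℤ) (d : ℤ) := Nat.isCoprime_iff_coprime.2 h.1.symm
    rw [if_pos h, if_pos ⟨h.1.symm, h.2.2, h.2.1⟩, edge_swap j hcop]
  · rw [if_neg h, if_neg fun h' => h ⟨h'.1.symm, h'.2.2, h'.2.1⟩]

lemma tailTerm_swap (j t₁ t₂ : ℕ) (A x y : ℤ) (N c d : ℕ) :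
    tailTerm j t₁ t₂ A x y N c d = tailTerm j t₂ t₁ y x A N d c := by
  unfold tailTerm
  rw [edgeCls_swap, qf_swap, ← qf_swap A x y c (-d), ← qf_neg_neg y x A (-d) c, neg_neg]

lemma tailTerm_self (j t₁ t₂ : ℕ) (A x y : ℤ) (N c : ℕ) : tailTerm j t₁ t₂ A x y N c c = 0 := by
  unfold tailTerm edgeCls
  split_ifs with h
  all_goals try simp
  all_goals
    have h1 := (Nat.coprime_self c).1 h.1
    subst h1
    simpa using edge_one_one j

lemma tailTerm_zero_left (j t₁ t₂ : ℕ) (A x y : ℤ) (N d : ℕ) :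
    tailTerm j t₁ t₂ A x y N 0 d = 0 := by
  rw [← edgeTerm_add_neg_right]
  simp [edgeTerm_zero_left]

lemma tailTerm_zero_right (j t₁ t₂ : ℕ) (A x y : ℤ) (N c : ℕ) :
    tailTerm j t₁ t₂ A x y N c 0 = 0 := by
  rw [tailTerm_swap, tailTerm_zero_left]

lemma abs_qf_le {A x y c d : ℤ} {L : ℕ} (hc : |c| ≤ L) (hd : |d| ≤ L) :
    |qf A x y c d| ≤ (|A| + 2 * |x| + |y|) * (L : ℤ) ^ 2 := by
  have h0 := abs_nonneg c
  have h0' := abs_nonneg d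
  have h1 : |y * c ^ 2| ≤ |y| * (L : ℤ) ^ 2 := by
    rw [abs_mul, abs_pow]; gcongr
  have h2 : |2 * x * c * d| ≤ 2 * |x| * (L : ℤ) ^ 2 := by
    rw [abs_mul, abs_mul, abs_mul, abs_two, mul_assoc _ |c|, sq]
    gcongr
  have h3 : |A * d ^ 2| ≤ |A| * (L : ℤ) ^ 2 := by
    rw [abs_mul, abs_pow]; gcongr
  unfold qf
  have h4 := abs_add_le (y * c ^ 2 + 2 * x * c * d) (A * d ^ 2)
  have h5 := abs_add_le (y * c ^ 2) (2 * x * c * d)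
  nlinarith

lemma sum_range_tailTerm {A x y : ℤ} (j t₁ t₂ N L Y : ℕ)
    (hL : (|A| + 2 * |x| + |y|) * (L : ℤ) ^ 2 ≤ N) :
    ∑ c ∈ Finset.range (Y + 1), ∑ d ∈ Finset.range (Y + 1), tailTerm j t₁ t₂ A x y N c d =
      ∑ c ∈ Finset.Ioc L Y, ∑ d ∈ Finset.Ico 1 c, tailTerm j t₁ t₂ A x y N c d +
      ∑ c ∈ Finset.Ioc L Y, ∑ d ∈ Finset.Ico 1 c, tailTerm j t₂ t₁ y x A N c d := by
  have lower : ∀ (A x y : ℤ) (t₁ t₂ : ℕ), (|A| + 2 * |x| + |y|) * (L : ℤ) ^ 2 ≤ N →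
      ∑ c ∈ Finset.Ioc L Y, ∑ d ∈ Finset.Ico 1 c, tailTerm j t₁ t₂ A x y N c d =
      ∑ c ∈ Finset.range (Y + 1), ∑ d ∈ Finset.range c, tailTerm j t₁ t₂ A x y N c d := by
    intro A x y t₁ t₂ hL
    have e1 : ∀ c, ∑ d ∈ Finset.Ico 1 c, tailTerm j t₁ t₂ A x y N c d =
        ∑ d ∈ Finset.range c, tailTerm j t₁ t₂ A x y N c d := by
      intro c
      refine Finset.sum_subset (fun d hd => ?_) fun d hd hd' => ?_
      · simp at hd ⊢; omega
      · have : d = 0 := by simp at hd hd'; omega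
        subst this
        exact tailTerm_zero_right ..
    simp only [e1]
    refine Finset.sum_subset (fun c hc => ?_) fun c hc hc' => Finset.sum_eq_zero fun d hd => ?_
    · simp at hc ⊢; omega
    · have hc1 : c ≤ L := by simp at hc hc'; omega
      have hd1 : d ≤ L := by simp at hd; omega
      unfold tailTerm
      rw [if_pos ((abs_qf_le (L := L) (by simpa using hc1) (by simpa using hd1)).trans hL),
        if_pos ((abs_qf_le (L := L) (by simpa using hc1) (by simpa using hd1)).trans hL)]
      simp
  rw [lower A x y t₁ t₂ hL, lower y x A t₂ t₁ (by linarith)]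
  have e2 : ∑ c ∈ Finset.range (Y + 1), ∑ d ∈ Finset.range c, tailTerm j t₂ t₁ y x A N c d =
      ∑ c ∈ Finset.range (Y + 1), ∑ d ∈ (Finset.range (Y + 1)).filter (fun d => c < d),
        tailTerm j t₁ t₂ A x y N c d := by
    rw [Finset.sum_comm' (t' := Finset.range (Y + 1))
      (s' := fun d => (Finset.range (Y + 1)).filter (fun c => d < c))]
    · refine Finset.sum_congr rfl fun c _ => Finset.sum_congr rfl fun d _ => ?_
      rw [← tailTerm_swap]
    · intro c d
      simp
      omega
  rw [e2, ← Finset.sum_add_distrib]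
  refine Finset.sum_congr rfl fun c hc => ?_
  rw [← Finset.sum_filter_add_sum_filter_not (Finset.range (Y + 1)) (fun d => c < d), add_comm]
  congr 1
  symm
  refine Finset.sum_subset (fun d hd => ?_) fun d hd hd' => ?_
  · simp at hc hd ⊢; omega
  · have : d = c := by simp at hd hd'; omega
    subst this
    exact tailTerm_self ..

lemma tendsto_tsum_edgeTerm {A x y : ℤ} (hD : 0 < x ^ 2 - A * y) (j t₁ t₂ : ℕ) (hj : 1 ≤ j)
    (hne : ∀ c d : ℤ, c % 2 = t₁ → d % 2 = t₂ → qf A x y c d ≠ 0) :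
    Tendsto (fun N : ℕ => ∑' v, edgeTerm j t₁ t₂ A x y N v) atTop (𝓝 0) := by
  rw [Metric.tendsto_atTop]
  intro ε hε
  set C : ℕ := A.natAbs + 2 * x.natAbs + y.natAbs + 1 with hC
  obtain ⟨N₁, hN₁⟩ := tail_bound hD j t₁ t₂ C hj (ε / 8) (by linarith)
  obtain ⟨N₂, hN₂⟩ := tail_bound (A := y) (x := x) (y := A) (by linarith) j t₂ t₁ C hj (ε / 8)
    (by linarith)
  refine ⟨max N₁ N₂, fun N hN => ?_⟩
  set L := Nat.sqrt N / C with hL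
  have hC0 : 0 < C := by omega
  have hL1 : N ≤ (C * (L + 1)) ^ 2 := by
    have h1 := Nat.lt_succ_sqrt N
    have h2 : Nat.sqrt N + 1 ≤ C * (L + 1) := by
      have := Nat.div_add_mod (Nat.sqrt N) C
      have := Nat.mod_lt (Nat.sqrt N) hC0
      rw [← hL] at *
      rw [mul_add, mul_one]
      omega
    have h3 : (Nat.sqrt N + 1) * (Nat.sqrt N + 1) ≤ (C * (L + 1)) * (C * (L + 1)) :=
      Nat.mul_le_mul h2 h2
    rw [sq]
    exact h1.le.trans h3
  have hL2 : (|A| + 2 * |x| + |y|) * (L : ℤ) ^ 2 ≤ N := by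
    have h1 : C * L ≤ Nat.sqrt N := by rw [hL]; exact Nat.mul_div_le _ _
    have h2 : (C * L) * (C * L) ≤ N := (Nat.mul_le_mul h1 h1).trans (Nat.sqrt_le N)
    have h3 : |A| + 2 * |x| + |y| ≤ (C : ℤ) := by
      rw [hC]; push_cast; omega
    have h4 : ((C : ℤ) * L) * (C * L) ≤ N := by exact_mod_cast h2
    have h5 : (1 : ℤ) ≤ C := by exact_mod_cast hC0
    nlinarith [mul_nonneg (sub_nonneg.2 h5) (sq_nonneg (L : ℤ)), sq_nonneg (L : ℤ),
      mul_nonneg (mul_nonneg (sub_nonneg.2 h5) (sq_nonneg (L : ℤ))) (by linarith : (0 : ℤ) ≤ C)]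
  have hbox : ∀ Y : ℕ, |∑ v ∈ Finset.Icc (-(Y : ℤ)) Y ×ˢ Finset.Icc (-(Y : ℤ)) Y,
      edgeTerm j t₁ t₂ A x y N v| ≤ ε / 2 := by
    intro Y
    rw [sum_box_edgeTerm, sum_range_tailTerm j t₁ t₂ N L Y hL2, abs_mul, abs_two]
    have h1 := hN₁ N ((le_max_left _ _).trans hN) L hL1 Y
    have h2 := hN₂ N ((le_max_right _ _).trans hN) L hL1 Y
    have h3 := abs_add_le
      (∑ c ∈ Finset.Ioc L Y, ∑ d ∈ Finset.Ico 1 c, tailTerm j t₁ t₂ A x y N c d)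
      (∑ c ∈ Finset.Ioc L Y, ∑ d ∈ Finset.Ico 1 c, tailTerm j t₂ t₁ y x A N c d)
    linarith
  have hsum := (summable_edgeTerm hD j t₁ t₂ hne N).hasSum
  have hcof : Tendsto (fun Y : ℕ => Finset.Icc (-(Y : ℤ)) Y ×ˢ Finset.Icc (-(Y : ℤ)) Y)
      atTop atTop := by
    refine tendsto_atTop_finset_of_monotone ?_ ?_
    · intro a b hab
      have : (a : ℤ) ≤ b := by exact_mod_cast hab
      exact Finset.product_subset_product (Finset.Icc_subset_Icc (by omega) this)
        (Finset.Icc_subset_Icc (by omega) this)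
    · intro v
      refine ⟨v.1.natAbs + v.2.natAbs, ?_⟩
      simp only [Finset.mem_product, Finset.mem_Icc]
      omega
  have hlim := (hsum.comp hcof).abs
  have h := le_of_tendsto hlim (Eventually.of_forall hbox)
  rw [Real.dist_eq, sub_zero]
  linarith

section
open scoped MatrixGroups

/-- The quadratic form `A u² + 2 x u v + y v²`. -/
@[ext]
structure QForm where
  A : ℤ
  x : ℤ
  y : ℤ

namespace QForm

/-- A quarter of the discriminant. -/
def disc (Q : QForm) : ℤ := Q.x ^ 2 - Q.A * Q.y

/-- The value of the leading coefficient of a form after a substitution with bottom row `v`. -/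
def val (Q : QForm) (v : ℤ × ℤ) : ℤ := qf Q.A Q.x Q.y v.1 v.2

instance : SMul SL(2, ℤ) QForm where
  smul M Q :=
    ⟨qf Q.A Q.x Q.y (M 1 0) (M 1 1),
      Q.A * M 0 1 * M 1 1 + Q.x * (M 0 0 * M 1 1 + M 0 1 * M 1 0) + Q.y * M 0 0 * M 1 0,
      qf Q.A Q.x Q.y (M 0 0) (M 0 1)⟩

lemma smul_A (M : SL(2, ℤ)) (Q : QForm) : (M • Q).A = Q.val (M 1 0, M 1 1) := rfl

lemma smul_x (M : SL(2, ℤ)) (Q : QForm) : (M • Q).x =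
    Q.A * M 0 1 * M 1 1 + Q.x * (M 0 0 * M 1 1 + M 0 1 * M 1 0) + Q.y * M 0 0 * M 1 0 := rfl

lemma smul_y (M : SL(2, ℤ)) (Q : QForm) : (M • Q).y = Q.val (M 0 0, M 0 1) := rfl

instance : MulAction SL(2, ℤ) QForm where
  one_smul Q := by
    ext <;> simp [smul_A, smul_x, smul_y, val, qf]
  mul_smul M N Q := by
    ext <;> simp only [smul_A, smul_x, smul_y, val, qf, Matrix.SpecialLinearGroup.coe_mul,
      Matrix.mul_apply, Fin.sum_univ_two] <;> ring

lemma det_eq (M : SL(2, ℤ)) : M 0 0 * M 1 1 - M 0 1 * M 1 0 = 1 := by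
  have := M.det_coe
  rwa [Matrix.det_fin_two] at this

lemma disc_smul (M : SL(2, ℤ)) (Q : QForm) : (M • Q).disc = Q.disc := by
  have h := det_eq M
  have e : (M • Q).disc = (M 0 0 * M 1 1 - M 0 1 * M 1 0) ^ 2 * Q.disc := by
    simp only [disc, smul_A, smul_x, smul_y, val, qf]
    ring
  rw [e, h]
  ring

end QForm

/-- Right multiplication of a row vector by a matrix. -/
def rowMul (v : ℤ × ℤ) (σ : SL(2, ℤ)) : ℤ × ℤ :=
  (v.1 * σ 0 0 + v.2 * σ 1 0, v.1 * σ 0 1 + v.2 * σ 1 1)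

lemma rowMul_one (v : ℤ × ℤ) : rowMul v 1 = v := by
  simp [rowMul]

lemma rowMul_mul (v : ℤ × ℤ) (σ τ : SL(2, ℤ)) : rowMul v (σ * τ) = rowMul (rowMul v σ) τ := by
  simp only [rowMul, Matrix.SpecialLinearGroup.coe_mul, Matrix.mul_apply, Fin.sum_univ_two]
  ext <;> simp <;> ring

/-- Right multiplication by a matrix as a permutation of rows. -/
def rowEquiv (σ : SL(2, ℤ)) : ℤ × ℤ ≃ ℤ × ℤ where
  toFun v := rowMul v σ
  invFun v := rowMul v σ⁻¹
  left_inv v := by simp only [← rowMul_mul, mul_inv_cancel, rowMul_one]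
  right_inv v := by simp only [← rowMul_mul, inv_mul_cancel, rowMul_one]

lemma val_smul (σ : SL(2, ℤ)) (Q : QForm) (v : ℤ × ℤ) :
    (σ • Q).val v = Q.val (rowMul v σ) := by
  simp only [QForm.val, QForm.smul_A, QForm.smul_x, QForm.smul_y, qf, rowMul]
  ring

lemma isCoprime_rowMul {v : ℤ × ℤ} (h : IsCoprime v.1 v.2) (σ : SL(2, ℤ)) :
    IsCoprime (rowMul v σ).1 (rowMul v σ).2 := by
  obtain ⟨a, b, hab⟩ := h
  have hd := QForm.det_eq σ
  refine ⟨a * σ 1 1 - b * σ 0 1, b * σ 0 0 - a * σ 1 0, ?_⟩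
  simp only [rowMul]
  linear_combination (a * v.1 + b * v.2) * hd + hab

lemma isCoprime_rowMul_iff {v : ℤ × ℤ} (σ : SL(2, ℤ)) :
    IsCoprime (rowMul v σ).1 (rowMul v σ).2 ↔ IsCoprime v.1 v.2 := by
  refine ⟨fun h => ?_, fun h => isCoprime_rowMul h σ⟩
  have := isCoprime_rowMul h σ⁻¹
  rwa [← rowMul_mul, mul_inv_cancel, rowMul_one] at this

/-- The value `sin (2πj a/c)` attached to the row `v = (c, d)`. -/
def rowSin (j : ℕ) (v : ℤ × ℤ) : ℝ := cuspSin j v.1 v.2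

lemma rowSin_mul_S (j : ℕ) (v : ℤ × ℤ) :
    rowSin j (rowMul v ModularGroup.S) = rowSin j v + edge j v.1 v.2 := by
  simp [rowSin, rowMul, ModularGroup.coe_S, edge]

lemma rowSin_mul_T (j : ℕ) {v : ℤ × ℤ} (h : IsCoprime v.1 v.2) :
    rowSin j (rowMul v ModularGroup.T) = rowSin j v := by
  obtain ⟨a, b, hab⟩ := h
  simp only [rowSin, rowMul, ModularGroup.coe_T]
  rw [cuspSin_eq j (a := b) (b := -a) (c := v.1) (d := v.2) (by linear_combination hab),
    cuspSin_eq j (a := b) (b := -a + b)]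
  · simp
  · simp
    linear_combination hab

/-- Rows of elements of `Γ₀(2)` at which a form takes a value bounded by `N`. -/
def rowSet (Q : QForm) (N : ℕ) : Set (ℤ × ℤ) :=
  {v | IsCoprime v.1 v.2 ∧ v.1 % 2 = 0 ∧ |Q.val v| ≤ N}

lemma odd_of_coprime {v : ℤ × ℤ} (h : IsCoprime v.1 v.2) (h2 : v.1 % 2 = 0) : v.2 % 2 = 1 := by
  obtain ⟨a, b, hab⟩ := h
  by_contra hv
  obtain ⟨k, hk⟩ := Int.dvd_of_emod_eq_zero h2
  obtain ⟨l, hl⟩ := Int.dvd_of_emod_eq_zero (by omega : v.2 % 2 = 0)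
  rw [hk, hl] at hab
  have : 2 * (a * k + b * l) = 1 := by linear_combination hab
  omega

lemma row_class_iff {v : ℤ × ℤ} (σ : SL(2, ℤ)) :
    (v.1 % 2 = 0 ∧ v.2 % 2 = 1) ↔
      (rowMul v σ).1 % 2 = σ 1 0 % 2 ∧ (rowMul v σ).2 % 2 = σ 1 1 % 2 := by
  have hd := QForm.det_eq σ
  simp only [rowMul]
  constructor
  · rintro ⟨h1, h2⟩
    obtain ⟨k, hk⟩ := Int.dvd_of_emod_eq_zero h1
    obtain ⟨l, hl⟩ := Int.dvd_of_emod_eq_zero (by omega : (v.2 - 1) % 2 = 0)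
    constructor
    · refine Int.emod_eq_emod_iff_emod_sub_eq_zero.2 (Int.emod_eq_zero_of_dvd ?_)
      exact ⟨k * σ 0 0 + l * σ 1 0, by rw [hk]; linear_combination σ 1 0 * hl⟩
    · refine Int.emod_eq_emod_iff_emod_sub_eq_zero.2 (Int.emod_eq_zero_of_dvd ?_)
      exact ⟨k * σ 0 1 + l * σ 1 1, by rw [hk]; linear_combination σ 1 1 * hl⟩
  · rintro ⟨h1, h2⟩
    obtain ⟨k, hk⟩ := Int.dvd_of_emod_eq_zero (Int.emod_eq_emod_iff_emod_sub_eq_zero.1 h1)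
    obtain ⟨l, hl⟩ := Int.dvd_of_emod_eq_zero (Int.emod_eq_emod_iff_emod_sub_eq_zero.1 h2)
    have e1 : v.1 = 2 * (k * σ 1 1 - l * σ 1 0) := by
      linear_combination (-v.1) * hd + σ 1 1 * hk - σ 1 0 * hl
    have e2 : v.2 = 2 * (l * σ 0 0 - k * σ 0 1) + 1 := by
      linear_combination (1 - v.2) * hd + σ 0 0 * hl - σ 0 1 * hk
    omega

lemma val_ne_zero {Q : QForm} (hA : Q.A % 2 = 1) {v : ℤ × ℤ} (h1 : v.1 % 2 = 0)
    (h2 : v.2 % 2 = 1) : Q.val v % 2 = 1 := by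
  obtain ⟨k, hk⟩ := Int.dvd_of_emod_eq_zero h1
  obtain ⟨l, hl⟩ := Int.dvd_of_emod_eq_zero (by omega : (v.2 - 1) % 2 = 0)
  obtain ⟨m, hm⟩ := Int.dvd_of_emod_eq_zero (by omega : (Q.A - 1) % 2 = 0)
  have hl' : v.2 = 2 * l + 1 := by linarith
  have hm' : Q.A = 2 * m + 1 := by linarith
  have e : Q.val v = 2 * (2 * Q.y * k ^ 2 + 2 * Q.x * k * (2 * l + 1) + 2 * l ^ 2 + 2 * l +
      m * (2 * l + 1) ^ 2) + 1 := by
    rw [QForm.val, qf, hk, hl', hm']; ring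
  omega

lemma edgeTerm_rowMul (j : ℕ) (σ : SL(2, ℤ)) (Q : QForm) (N : ℕ) (v : ℤ × ℤ) :
    edgeTerm j (σ 1 0 % 2).toNat (σ 1 1 % 2).toNat (σ⁻¹ • Q).A (σ⁻¹ • Q).x (σ⁻¹ • Q).y N
      (rowMul v σ) =
    (rowSet Q N).indicator (fun v => edge j (rowMul v σ).1 (rowMul v σ).2) v := by
  have h1 : qf (σ⁻¹ • Q).A (σ⁻¹ • Q).x (σ⁻¹ • Q).y (rowMul v σ).1 (rowMul v σ).2 = Q.val v := by
    change (σ⁻¹ • Q).val (rowMul v σ) = _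
    rw [val_smul, ← rowMul_mul, mul_inv_cancel, rowMul_one]
  have e1 : ((σ 1 0 % 2).toNat : ℤ) = σ 1 0 % 2 := by omega
  have e2 : ((σ 1 1 % 2).toNat : ℤ) = σ 1 1 % 2 := by omega
  unfold edgeTerm
  classical
  rw [h1, e1, e2, Set.indicator_apply]
  refine if_congr ?_ rfl rfl
  rw [rowSet, Set.mem_ofPred_eq, isCoprime_rowMul_iff]
  constructor
  · rintro ⟨a, b, b', c⟩
    exact ⟨a, ((row_class_iff σ).2 ⟨b, b'⟩).1, c⟩
  · rintro ⟨a, b, c⟩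
    have := (row_class_iff σ).1 ⟨b, odd_of_coprime a b⟩
    exact ⟨a, this.1, this.2, c⟩

lemma edge_rowMul_aux {Q : QForm} (hD : 0 < Q.disc) (hA : Q.A % 2 = 1) (j : ℕ) (hj : 1 ≤ j)
    (σ : SL(2, ℤ)) :
    (∀ N, Summable ((rowSet Q N).indicator
      (fun v => edge j (rowMul v σ).1 (rowMul v σ).2))) ∧
    Tendsto (fun N => ∑' v, (rowSet Q N).indicator
      (fun v => edge j (rowMul v σ).1 (rowMul v σ).2) v) atTop (𝓝 0) := by
  have hD' : 0 < (σ⁻¹ • Q).x ^ 2 - (σ⁻¹ • Q).A * (σ⁻¹ • Q).y := by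
    have := QForm.disc_smul σ⁻¹ Q
    rw [QForm.disc] at this
    rwa [this]
  have e1 : ((σ 1 0 % 2).toNat : ℤ) = σ 1 0 % 2 := by omega
  have e2 : ((σ 1 1 % 2).toNat : ℤ) = σ 1 1 % 2 := by omega
  have hne : ∀ c d : ℤ, c % 2 = ((σ 1 0 % 2).toNat : ℤ) → d % 2 = ((σ 1 1 % 2).toNat : ℤ) →
      qf (σ⁻¹ • Q).A (σ⁻¹ • Q).x (σ⁻¹ • Q).y c d ≠ 0 := by
    intro c d hc hd
    rw [e1] at hc
    rw [e2] at hd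
    change (σ⁻¹ • Q).val (c, d) ≠ 0
    have h := (row_class_iff (v := rowMul (c, d) σ⁻¹) σ).2 (by
      rw [← rowMul_mul, inv_mul_cancel, rowMul_one]; exact ⟨hc, hd⟩)
    rw [val_smul]
    have := val_ne_zero hA h.1 h.2
    omega
  have e3 : ∀ N, (rowSet Q N).indicator (fun v => edge j (rowMul v σ).1 (rowMul v σ).2) =
      edgeTerm j (σ 1 0 % 2).toNat (σ 1 1 % 2).toNat (σ⁻¹ • Q).A (σ⁻¹ • Q).x (σ⁻¹ • Q).y N ∘
        rowEquiv σ := by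
    intro N
    funext v
    exact (edgeTerm_rowMul j σ Q N v).symm
  simp only [e3]
  refine ⟨fun N => (rowEquiv σ).summable_iff.2 (summable_edgeTerm hD' j _ _ hne N), ?_⟩
  refine (tendsto_tsum_edgeTerm hD' j _ _ hj hne).congr fun N => ?_
  exact ((rowEquiv σ).tsum_eq _).symm

/-- The difference of `rowSin` along the path from the identity to `σ`. -/
def pathTerm (j : ℕ) (Q : QForm) (σ : SL(2, ℤ)) (N : ℕ) : ℤ × ℤ → ℝ :=
  (rowSet Q N).indicator (fun v => rowSin j (rowMul v σ) - rowSin j v)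

lemma pathTerm_congr (j : ℕ) (Q : QForm) {σ τ : SL(2, ℤ)} (N : ℕ)
    (h : ∀ v : ℤ × ℤ, IsCoprime v.1 v.2 → rowSin j (rowMul v σ) = rowSin j (rowMul v τ)) :
    pathTerm j Q σ N = pathTerm j Q τ N := by
  unfold pathTerm
  refine Set.indicator_congr fun v hv => ?_
  rw [h v hv.1]

lemma pathTerm_mul_S (j : ℕ) (Q : QForm) (σ : SL(2, ℤ)) (N : ℕ) :
    pathTerm j Q (σ * ModularGroup.S) N = pathTerm j Q σ N +
      (rowSet Q N).indicator (fun v => edge j (rowMul v σ).1 (rowMul v σ).2) := by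
  unfold pathTerm
  rw [← Set.indicator_add']
  refine Set.indicator_congr fun v _ => ?_
  rw [rowMul_mul, rowSin_mul_S, Pi.add_apply]
  ring

lemma summable_pathTerm_and_tendsto {Q : QForm} (hD : 0 < Q.disc) (hA : Q.A % 2 = 1) (j : ℕ)
    (hj : 1 ≤ j) (σ : SL(2, ℤ)) :
    (∀ N, Summable (pathTerm j Q σ N)) ∧
      Tendsto (fun N => ∑' v, pathTerm j Q σ N v) atTop (𝓝 0) := by
  have hS : ∀ σ : SL(2, ℤ), ((∀ N, Summable (pathTerm j Q σ N)) ∧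
      Tendsto (fun N => ∑' v, pathTerm j Q σ N v) atTop (𝓝 0)) →
      ((∀ N, Summable (pathTerm j Q (σ * ModularGroup.S) N)) ∧
      Tendsto (fun N => ∑' v, pathTerm j Q (σ * ModularGroup.S) N v) atTop (𝓝 0)) := by
    intro σ ⟨h1, h2⟩
    obtain ⟨h3, h4⟩ := edge_rowMul_aux hD hA j hj σ
    simp only [pathTerm_mul_S]
    refine ⟨fun N => (h1 N).add (h3 N), ?_⟩
    have := h2.add h4
    rw [add_zero] at this
    refine this.congr fun N => ?_
    rw [← (h1 N).tsum_add (h3 N)]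
    rfl
  have hmem : σ ∈ Subgroup.closure {ModularGroup.S, ModularGroup.T} := by
    rw [SpecialLinearGroup.SL2Z_generators]; trivial
  induction hmem using Subgroup.closure_induction_right with
  | one =>
    have : ∀ N, pathTerm j Q 1 N = fun _ => 0 := by
      intro N
      simp [pathTerm, rowMul_one]
    simp only [this]
    exact ⟨fun _ => summable_zero, by simp⟩
  | mul_right σ _ τ hτ ih =>
    rcases hτ with rfl | rfl
    · exact hS σ ih
    · simp only [fun N => pathTerm_congr j Q (σ := σ * ModularGroup.T) (τ := σ) N
        (fun v hv => by rw [rowMul_mul, rowSin_mul_T j (isCoprime_rowMul hv σ)])]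
      exact ih
  | mul_inv_cancel σ _ τ hτ ih =>
    rcases hτ with rfl | rfl
    · simp only [fun N => pathTerm_congr j Q (σ := σ * ModularGroup.S⁻¹)
        (τ := σ * ModularGroup.S) N (fun v hv => by
          rw [rowMul_mul, rowMul_mul]
          have h1 := isCoprime_rowMul (isCoprime_rowMul hv σ) ModularGroup.S
          have h2 : rowMul (rowMul v σ) ModularGroup.S⁻¹ =
              (-(rowMul (rowMul v σ) ModularGroup.S).1,
                -(rowMul (rowMul v σ) ModularGroup.S).2) := by
            generalize rowMul v σ = w
            simp [rowMul, ModularGroup.coe_S, Matrix.SpecialLinearGroup.coe_inv,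
              Matrix.adjugate_fin_two]
          rw [h2, rowSin, rowSin, cuspSin_neg_neg j h1])]
      exact hS σ ih
    · simp only [fun N => pathTerm_congr j Q (σ := σ * ModularGroup.T⁻¹) (τ := σ) N
        (fun v hv => by
          have h1 := isCoprime_rowMul hv (σ * ModularGroup.T⁻¹)
          rw [← rowSin_mul_T j h1, ← rowMul_mul, inv_mul_cancel_right])]
      exact ih

/-- The bottom row of a matrix. -/
def botRow (M : SL(2, ℤ)) : ℤ × ℤ := (M 1 0, M 1 1)

lemma botRow_mul (M σ : SL(2, ℤ)) : botRow (M * σ) = rowMul (botRow M) σ := by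
  simp [botRow, rowMul, Matrix.SpecialLinearGroup.coe_mul, Matrix.mul_apply, Fin.sum_univ_two]

lemma isCoprime_botRow (M : SL(2, ℤ)) : IsCoprime (botRow M).1 (botRow M).2 :=
  ⟨-M 0 1, M 0 0, by have := QForm.det_eq M; simp only [botRow]; linear_combination this⟩

lemma exists_eq_T_zpow_mul {M M' : SL(2, ℤ)} (h : botRow M = botRow M') :
    ∃ k : ℤ, M' = ModularGroup.T ^ k * M := by
  have h1 : M 1 0 = M' 1 0 := congrArg Prod.fst h
  have h2 : M 1 1 = M' 1 1 := congrArg Prod.snd h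
  have hd := QForm.det_eq M
  have hd' := QForm.det_eq M'
  refine ⟨(M' * M⁻¹) 0 1, ?_⟩
  rw [← mul_inv_eq_iff_eq_mul]
  have e10 : (M' * M⁻¹) 1 0 = 0 := by
    simp [Matrix.SpecialLinearGroup.coe_mul, Matrix.mul_apply, Fin.sum_univ_two,
      Matrix.SpecialLinearGroup.coe_inv, Matrix.adjugate_fin_two]
    rw [h1, h2]; ring
  have e11 : (M' * M⁻¹) 1 1 = 1 := by
    simp [Matrix.SpecialLinearGroup.coe_mul, Matrix.mul_apply, Fin.sum_univ_two,
      Matrix.SpecialLinearGroup.coe_inv, Matrix.adjugate_fin_two]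
    rw [← h1, ← h2]; linear_combination hd
  have e00 : (M' * M⁻¹) 0 0 = 1 := by
    have := QForm.det_eq (M' * M⁻¹)
    rw [e10, e11] at this
    linarith
  generalize M' * M⁻¹ = n at *
  ext i j
  rw [ModularGroup.coe_T_zpow]
  fin_cases i <;> fin_cases j <;> simp [e00, e10, e11]

lemma T_zpow_smul_A (k : ℤ) (Q : QForm) : (ModularGroup.T ^ k • Q).A = Q.A := by
  rw [QForm.smul_A, ModularGroup.coe_T_zpow]
  simp [QForm.val, qf]

lemma T_zpow_smul_x (k : ℤ) (Q : QForm) : (ModularGroup.T ^ k • Q).x = Q.x + k * Q.A := by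
  rw [QForm.smul_x, ModularGroup.coe_T_zpow]
  simp
  ring

lemma mem_Gamma0_two {M : SL(2, ℤ)} : M ∈ CongruenceSubgroup.Gamma0 2 ↔ M 1 0 % 2 = 0 := by
  rw [CongruenceSubgroup.Gamma0_mem, ZMod.intCast_zmod_eq_zero_iff_dvd]
  exact Int.dvd_iff_emod_eq_zero

lemma T_zpow_mem (k : ℤ) : ModularGroup.T ^ k ∈ CongruenceSubgroup.Gamma0 2 := by
  rw [mem_Gamma0_two, ModularGroup.coe_T_zpow]
  simp

/-- Forms equivalent to `R` under `Γ₀(2)`, reduced modulo translations, with bounded leading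
coefficient. -/
def redSet (R : QForm) (N : ℕ) : Set QForm :=
  {Q | (∃ M ∈ CongruenceSubgroup.Gamma0 2, M • R = Q) ∧ 0 ≤ Q.x ∧ Q.x < |Q.A| ∧ |Q.A| ≤ N}

/-- The stabilizer of a form in `Γ₀(2)`. -/
def stab (R : QForm) : Subgroup SL(2, ℤ) :=
  CongruenceSubgroup.Gamma0 2 ⊓ MulAction.stabilizer SL(2, ℤ) R

/-- A matrix carrying `R` to a given form equivalent to it. -/
def redMat {R : QForm} {N : ℕ} (Q : redSet R N) : SL(2, ℤ) := Q.2.1.choose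

lemma redMat_mem {R : QForm} {N : ℕ} (Q : redSet R N) :
    redMat Q ∈ CongruenceSubgroup.Gamma0 2 := Q.2.1.choose_spec.1

lemma redMat_smul {R : QForm} {N : ℕ} (Q : redSet R N) : redMat Q • R = Q :=
  Q.2.1.choose_spec.2

lemma redMat_mul_smul {R : QForm} {N : ℕ} (Q : redSet R N) (s : stab R) :
    (redMat Q * s) • R = Q := by
  rw [mul_smul, MulAction.mem_stabilizer_iff.1 (Subgroup.mem_inf.1 s.2).2, redMat_smul]

lemma botRow_mem_rowSet {R : QForm} {N : ℕ} {M : SL(2, ℤ)}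
    (hM : M ∈ CongruenceSubgroup.Gamma0 2) (hA : |(M • R).A| ≤ N) : botRow M ∈ rowSet R N :=
  ⟨isCoprime_botRow M, mem_Gamma0_two.1 hM, hA⟩

/-- Parametrization of the rows by reduced forms and stabilizer elements. -/
def unfoldMap (R : QForm) (N : ℕ) (p : redSet R N × stab R) : rowSet R N :=
  ⟨botRow (redMat p.1 * p.2), botRow_mem_rowSet
    (mul_mem (redMat_mem p.1) (Subgroup.mem_inf.1 p.2.2).1)
    (by rw [redMat_mul_smul]; exact p.1.2.2.2.2)⟩

lemma eq_of_reduced {Q : QForm} {k : ℤ} (h1 : 0 ≤ Q.x) (h2 : Q.x < |Q.A|)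
    (h1' : 0 ≤ Q.x + k * Q.A) (h2' : Q.x + k * Q.A < |Q.A|) : k = 0 := by
  have h : |k * Q.A| < |Q.A| := abs_lt.2 ⟨by linarith, by linarith⟩
  rw [abs_mul] at h
  have h0 : 0 < |Q.A| := by linarith
  have : |k| < 1 := by
    by_contra hk
    push Not at hk
    nlinarith
  exact Int.abs_lt_one_iff.1 this

lemma unfoldMap_bijective {R : QForm} (hA : R.A % 2 = 1) (N : ℕ) :
    Function.Bijective (unfoldMap R N) := by
  constructor
  · rintro ⟨Q, s⟩ ⟨Q', s'⟩ h
    have h1 : botRow (redMat Q * s) = botRow (redMat Q' * s') := congrArg Subtype.val h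
    obtain ⟨k, hk⟩ := exists_eq_T_zpow_mul h1
    have h2 : (Q' : QForm) = ModularGroup.T ^ k • (Q : QForm) := by
      rw [← redMat_mul_smul Q' s', hk, mul_smul, redMat_mul_smul]
    have hx : (Q' : QForm).x = (Q : QForm).x + k * (Q : QForm).A := by rw [h2, T_zpow_smul_x]
    have hA' : (Q' : QForm).A = (Q : QForm).A := by rw [h2, T_zpow_smul_A]
    have hk0 : k = 0 := eq_of_reduced Q.2.2.1 Q.2.2.2.1 (by rw [← hx]; exact Q'.2.2.1)
      (by rw [← hx, ← hA']; exact Q'.2.2.2.1)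
    subst hk0
    rw [zpow_zero, one_smul] at h2
    have h3 : Q' = Q := Subtype.ext h2
    subst h3
    rw [zpow_zero, one_mul] at hk
    have h4 : s' = s := Subtype.ext (mul_left_cancel hk)
    rw [h4]
  · rintro ⟨v, hv1, hv2, hv3⟩
    obtain ⟨M, hM, hMG, hx1, hx2⟩ : ∃ M : SL(2, ℤ), botRow M = v ∧
        M ∈ CongruenceSubgroup.Gamma0 2 ∧ 0 ≤ (M • R).x ∧ (M • R).x < |(M • R).A| := by
      obtain ⟨a, b, hab⟩ := hv1
      let M₀ : SL(2, ℤ) := ⟨!![b, -a; v.1, v.2], by rw [Matrix.det_fin_two_of]; linarith⟩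
      have hM₀ : M₀ ∈ CongruenceSubgroup.Gamma0 2 := by
        rw [mem_Gamma0_two]
        simpa [M₀] using hv2
      have hb : botRow M₀ = v := by simp [botRow, M₀]
      have hA0 : (M₀ • R).A ≠ 0 := by
        rw [QForm.smul_A]
        change R.val (botRow M₀) ≠ 0
        rw [hb]
        have := val_ne_zero hA hv2 (odd_of_coprime ⟨a, b, hab⟩ hv2)
        omega
      refine ⟨ModularGroup.T ^ (-((M₀ • R).x / (M₀ • R).A)) * M₀, ?_, mul_mem (T_zpow_mem _) hM₀,
        ?_, ?_⟩
      · rw [botRow_mul, botRow, ModularGroup.coe_T_zpow]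
        simp [rowMul, M₀]
      · rw [mul_smul, T_zpow_smul_x]
        have := Int.emod_nonneg (M₀ • R).x hA0
        rw [Int.emod_def] at this
        linarith
      · rw [mul_smul, T_zpow_smul_x, T_zpow_smul_A]
        have := Int.emod_lt_abs (M₀ • R).x hA0
        rw [Int.emod_def] at this
        linarith
    have hval : |(M • R).A| ≤ N := by
      rw [QForm.smul_A]
      change |R.val (botRow M)| ≤ N
      rwa [hM]
    let Q : redSet R N := ⟨M • R, ⟨M, hMG, rfl⟩, hx1, hx2, hval⟩
    have hs : (redMat Q)⁻¹ * M ∈ stab R := by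
      refine Subgroup.mem_inf.2 ⟨mul_mem (inv_mem (redMat_mem Q)) hMG, ?_⟩
      rw [MulAction.mem_stabilizer_iff, mul_smul, inv_smul_eq_iff, redMat_smul]
    refine ⟨(Q, ⟨_, hs⟩), Subtype.ext ?_⟩
    simp only [unfoldMap, mul_inv_cancel_left]
    exact hM

/-- Representatives times subgroup elements parametrize a group. -/
def quotProdMap {G : Type*} [Group G] (H : Subgroup G) (p : (G ⧸ H) × H) : G := p.1.out * p.2

lemma quotProdMap_bijective {G : Type*} [Group G] (H : Subgroup G) :
    Function.Bijective (quotProdMap H) := by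
  constructor
  · rintro ⟨q, h⟩ ⟨q', h'⟩ e
    have e' : q.out * (h : G) = q'.out * h' := e
    have hq : q = q' := by
      have := congrArg (QuotientGroup.mk (s := H)) e'
      rwa [QuotientGroup.mk_mul_of_mem _ h.2, QuotientGroup.mk_mul_of_mem _ h'.2,
        QuotientGroup.out_eq', QuotientGroup.out_eq'] at this
    subst hq
    rw [Subtype.ext (mul_left_cancel e')]
  · intro s
    refine ⟨((s : G ⧸ H), ⟨(s : G ⧸ H).out⁻¹ * s, ?_⟩), ?_⟩
    · rw [← QuotientGroup.eq, QuotientGroup.out_eq']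
    · simp [quotProdMap]

/-- Unfolding of a sum over rows along a subgroup of the stabilizer. -/
lemma tsum_rowSet_eq {R : QForm} (hA : R.A % 2 = 1) (N : ℕ) (F : ℤ × ℤ → ℝ)
    (hF : Summable ((rowSet R N).indicator F)) (H : Subgroup (stab R)) (val : QForm → ℝ)
    (hval : ∀ M ∈ CongruenceSubgroup.Gamma0 2,
      Summable (fun h : H => F (botRow (M * (h : stab R)))) →
      ∑' h : H, F (botRow (M * (h : stab R))) = val (M • R)) :
    ∑' v, (rowSet R N).indicator F v =
      Nat.card (stab R ⧸ H) * ∑' Q : redSet R N, val Q ∧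
    (Nat.card (stab R ⧸ H) = 0 → ∀ Q : redSet R N, val Q = 0) := by
  let e₁ := Equiv.ofBijective _ (unfoldMap_bijective hA N)
  let e₂ := (Equiv.refl (redSet R N)).prodCongr (Equiv.ofBijective _ (quotProdMap_bijective H))
  let e := e₂.trans e₁
  rw [← summable_subtype_iff_indicator] at hF
  rw [← tsum_subtype]
  have hs : Summable ((F ∘ ((↑) : rowSet R N → ℤ × ℤ)) ∘ e) := e.summable_iff.2 hF
  have he : ∀ Q q h, (F ∘ ((↑) : rowSet R N → ℤ × ℤ)) (e (Q, (q, h))) =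
      F (botRow (redMat Q * ((q.out : stab R) : SL(2, ℤ)) * (h : stab R))) := by
    intro Q q h
    simp [e, e₁, e₂, unfoldMap, quotProdMap, mul_assoc]
  have hQ : ∀ Q : redSet R N, Summable (fun p : (stab R ⧸ H) × H =>
      ((F ∘ ((↑) : rowSet R N → ℤ × ℤ)) ∘ e) (Q, p)) := fun Q => hs.prod_factor Q
  have hin : ∀ (Q : redSet R N) (q : stab R ⧸ H), ∑' h : H,
      ((F ∘ ((↑) : rowSet R N → ℤ × ℤ)) ∘ e) (Q, (q, h)) = val Q := by
    intro Q q
    have h1 := (hQ Q).prod_factor q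
    simp only [Function.comp_apply (g := e), he] at h1 ⊢
    rw [hval _ (mul_mem (redMat_mem Q) (Subgroup.mem_inf.1 q.out.2).1) h1, redMat_mul_smul]
  have hmid : ∀ Q : redSet R N, ∑' p : (stab R ⧸ H) × H,
      ((F ∘ ((↑) : rowSet R N → ℤ × ℤ)) ∘ e) (Q, p) = Nat.card (stab R ⧸ H) * val Q := by
    intro Q
    rw [(hQ Q).tsum_prod]
    simp only [hin]
    rw [tsum_const, nsmul_eq_mul]
  constructor
  · have : ∑' v : rowSet R N, F v = ∑' p, ((F ∘ ((↑) : rowSet R N → ℤ × ℤ)) ∘ e) p :=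
      (e.tsum_eq (F ∘ ((↑) : rowSet R N → ℤ × ℤ))).symm
    rw [this, hs.tsum_prod]
    simp only [hmid]
    rw [tsum_mul_left]
  · intro hc Q
    rcases Nat.card_eq_zero.1 hc with h | h
    · exact (h.false ((1 : stab R) : stab R ⧸ H)).elim
    · have h1 := (hQ Q).prod
      simp only [hin] at h1
      exact (summable_const_iff _).1 h1

lemma tendsto_redSet {R : QForm} (hA : R.A % 2 = 1) (F : ℤ × ℤ → ℝ)
    (hF : ∀ N, Summable ((rowSet R N).indicator F))
    (hlim : Tendsto (fun N => ∑' v, (rowSet R N).indicator F v) atTop (𝓝 0))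
    (H : Subgroup (stab R)) (val : QForm → ℝ)
    (hval : ∀ M ∈ CongruenceSubgroup.Gamma0 2,
      Summable (fun h : H => F (botRow (M * (h : stab R)))) →
      ∑' h : H, F (botRow (M * (h : stab R))) = val (M • R)) :
    Tendsto (fun N => ∑' Q : redSet R N, val Q) atTop (𝓝 0) := by
  have h := fun N => tsum_rowSet_eq hA N F (hF N) H val hval
  by_cases hc : Nat.card (stab R ⧸ H) = 0
  · have : ∀ N, ∑' Q : redSet R N, val Q = 0 := by
      intro N
      simp only [(h N).2 hc, tsum_zero]
    simp only [this]
    exact tendsto_const_nhds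
  · have hc' : (Nat.card (stab R ⧸ H) : ℝ) ≠ 0 := by exact_mod_cast hc
    have h1 := hlim.const_mul (Nat.card (stab R ⧸ H) : ℝ)⁻¹
    rw [mul_zero] at h1
    refine h1.congr fun N => ?_
    rw [(h N).1, inv_mul_cancel_left₀ hc']

lemma rowSin_botRow (j : ℕ) (M : SL(2, ℤ)) :
    rowSin j (botRow M) = Real.sin (2 * π * j * ((M 0 0 : ℝ) / M 1 0)) := by
  rw [rowSin, cuspSin_eq j (a := M 0 0) (b := M 0 1)]
  · simp only [botRow, mul_div_assoc]
  · exact QForm.det_eq M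

/-- The difference of the sines at the two roots of a form. -/
def pval (j : ℕ) (Q : QForm) : ℝ :=
  Real.sin (2 * π * j * ((Q.x + √(Q.disc : ℝ)) / Q.A)) -
    Real.sin (2 * π * j * ((Q.x - √(Q.disc : ℝ)) / Q.A))

lemma det_eq_real (M : SL(2, ℤ)) : (M 0 0 : ℝ) * M 1 1 - M 0 1 * M 1 0 = 1 := by
  exact_mod_cast QForm.det_eq M

/-- Möbius action on a root of a form. -/
lemma root_smul (R : QForm) (M : SL(2, ℤ)) {s : ℝ} (hs : s ^ 2 = R.disc) :
    ((M 0 0 : ℝ) * (R.x + s) + M 0 1 * R.A) * (M • R).A =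
      ((M • R).x + s) * (M 1 0 * (R.x + s) + M 1 1 * R.A) := by
  have hd := det_eq_real M
  rw [QForm.smul_A, QForm.smul_x]
  simp only [QForm.val, qf, QForm.disc] at hs ⊢
  push_cast at hs ⊢
  linear_combination (-(M 1 0 : ℝ) * (M 0 0 * M 1 1 - M 0 1 * M 1 0)) * hs +
    s * (M 1 0 * (R.x + s) + M 1 1 * R.A) * hd

lemma denom_mul (R : QForm) (M : SL(2, ℤ)) {s : ℝ} (hs : s ^ 2 = R.disc) :
    ((M 1 0 : ℝ) * (R.x + s) + M 1 1 * R.A) * (M 1 0 * (R.x - s) + M 1 1 * R.A) =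
      R.A * (M • R).A := by
  rw [QForm.smul_A]
  simp only [QForm.val, qf, QForm.disc] at hs ⊢
  push_cast at hs ⊢
  linear_combination (-(M 1 0 : ℝ) ^ 2) * hs

lemma smul_A_odd {R : QForm} (hA : R.A % 2 = 1) {M : SL(2, ℤ)}
    (hM : M ∈ CongruenceSubgroup.Gamma0 2) : (M • R).A % 2 = 1 := by
  rw [QForm.smul_A]
  have h := mem_Gamma0_two.1 hM
  exact val_ne_zero hA h (odd_of_coprime (isCoprime_botRow M) h)

lemma denom_ne_zero {R : QForm} (hA : R.A % 2 = 1) {M : SL(2, ℤ)}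
    (hM : M ∈ CongruenceSubgroup.Gamma0 2) {s : ℝ} (hs : s ^ 2 = R.disc) :
    (M 1 0 : ℝ) * (R.x + s) + M 1 1 * R.A ≠ 0 := by
  have h := denom_mul R M hs
  have h1 : (R.A : ℝ) * (M • R).A ≠ 0 := by
    have := smul_A_odd hA hM
    refine mul_ne_zero ?_ ?_ <;> norm_cast <;> omega
  rw [← h] at h1
  exact left_ne_zero_of_mul h1

lemma root_smul_div {R : QForm} (hA : R.A % 2 = 1) {M : SL(2, ℤ)}
    (hM : M ∈ CongruenceSubgroup.Gamma0 2) {s : ℝ} (hs : s ^ 2 = R.disc) :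
    ((M 0 0 : ℝ) * (R.x + s) + M 0 1 * R.A) / (M 1 0 * (R.x + s) + M 1 1 * R.A) =
      ((M • R).x + s) / (M • R).A := by
  have h1 : ((M • R).A : ℝ) ≠ 0 := by
    have := smul_A_odd hA hM
    norm_cast
    omega
  rw [div_eq_div_iff (denom_ne_zero hA hM hs) h1, root_smul R M hs]

lemma SL_mul_apply (M σ : SL(2, ℤ)) (i k : Fin 2) :
    (M * σ) i k = M i 0 * σ 0 k + M i 1 * σ 1 k := by
  simp [Matrix.SpecialLinearGroup.coe_mul, Matrix.mul_apply, Fin.sum_univ_two]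

/-- A matrix whose first column is proportional to an integral vector. -/
lemma exists_SL_col (p q : ℤ) (h : q ≠ 0) :
    ∃ (σ : SL(2, ℤ)) (k : ℤ), k ≠ 0 ∧ p = k * σ 0 0 ∧ q = k * σ 1 0 := by
  have hk : (Int.gcd p q : ℤ) ≠ 0 := by
    simp [Int.gcd_eq_zero_iff, h]
  obtain ⟨a, ha⟩ := Int.gcd_dvd_left p q
  obtain ⟨b, hb⟩ := Int.gcd_dvd_right p q
  have hcop : IsCoprime a b := by
    have h1 := Int.gcd_eq_gcd_ab p q
    refine ⟨Int.gcdA p q, Int.gcdB p q, mul_left_cancel₀ hk ?_⟩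
    linear_combination (-Int.gcdA p q) * ha - Int.gcdB p q * hb - h1
  obtain ⟨u, v, huv⟩ := hcop
  refine ⟨⟨!![a, -v; b, u], by rw [Matrix.det_fin_two_of]; linarith⟩, _, hk, ?_, ?_⟩
  · simpa using ha
  · simpa using hb

lemma tendsto_pval_square {R : QForm} (hD : 0 < R.disc) (hA : R.A % 2 = 1) {j : ℕ} (hj : 1 ≤ j)
    (hsq : IsSquare R.disc) :
    Tendsto (fun N => ∑' Q : redSet R N, pval j Q) atTop (𝓝 0) := by
  obtain ⟨r, hr⟩ := hsq
  have hr0 : (R.disc : ℝ) = ((|r| : ℤ) : ℝ) ^ 2 := by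
    rw [hr]; push_cast; rw [sq_abs]; ring
  have hsqrt : √(R.disc : ℝ) = ((|r| : ℤ) : ℝ) := by
    rw [hr0, Real.sqrt_sq (by positivity)]
  obtain ⟨σ, k, hk, h0, h1⟩ := exists_SL_col (R.x + |r|) R.A (by omega)
  obtain ⟨σ', k', hk', h0', h1'⟩ := exists_SL_col (R.x - |r|) R.A (by omega)
  have hσ := summable_pathTerm_and_tendsto hD hA j hj σ
  have hσ' := summable_pathTerm_and_tendsto hD hA j hj σ'
  have hind : ∀ N, (rowSet R N).indicator (fun v => rowSin j (rowMul v σ) - rowSin j (rowMul v σ'))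
      = fun v => pathTerm j R σ N v - pathTerm j R σ' N v := by
    intro N
    ext v
    classical
    simp only [pathTerm, Set.indicator_apply]
    split_ifs <;> ring
  have key : ∀ (M : SL(2, ℤ)) (σ : SL(2, ℤ)) (s : ℝ) (k : ℤ), M ∈ CongruenceSubgroup.Gamma0 2 →
      s ^ 2 = R.disc → k ≠ 0 → (R.x + s) = k * σ 0 0 → R.A = k * σ 1 0 →
      rowSin j (rowMul (botRow M) σ) = Real.sin (2 * π * j * (((M • R).x + s) / (M • R).A)) := by
    intro M σ s k hM hs hk h0 h1
    rw [← botRow_mul, rowSin_botRow, ← root_smul_div hA hM hs, SL_mul_apply, SL_mul_apply]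
    have hk' : (k : ℝ) ≠ 0 := by exact_mod_cast hk
    have h1' : (R.A : ℝ) = k * σ 1 0 := by exact_mod_cast h1
    rw [h0, h1', ← mul_div_mul_left _ _ hk']
    push_cast
    congr 3 <;> ring
  refine tendsto_redSet hA (fun v => rowSin j (rowMul v σ) - rowSin j (rowMul v σ')) ?_ ?_ ⊥
    (pval j) ?_
  · intro N
    rw [hind]
    exact (hσ.1 N).sub (hσ'.1 N)
  · have := hσ.2.sub hσ'.2
    rw [sub_zero] at this
    refine this.congr fun N => ?_
    rw [hind, (hσ.1 N).tsum_sub (hσ'.1 N)]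
  · intro M hM _
    rw [tsum_eq_single (1 : (⊥ : Subgroup (stab R))) (fun b hb => (hb (Subsingleton.elim _ _)).elim)]
    simp only [Subgroup.coe_one, mul_one]
    rw [key M σ (|r| : ℤ) k hM hr0.symm hk (by exact_mod_cast h0) h1,
      key M σ' (-(|r| : ℤ)) k' hM (by rw [neg_sq]; exact hr0.symm) hk'
        (by rw [← sub_eq_add_neg]; exact_mod_cast h0') h1', pval, QForm.disc_smul, hsqrt]
    rfl

/-- Powers of a hyperbolic matrix push the apex towards a fixed point. -/
lemma tendsto_apex {R : QForm} (hA : R.A % 2 = 1) {M g : SL(2, ℤ)}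
    (hM : M ∈ CongruenceSubgroup.Gamma0 2) {s ε : ℝ} (hs : s ^ 2 = R.disc) (hε : 1 < ε)
    (h0 : (g 0 0 : ℝ) * (R.x + s) + g 0 1 * R.A = ε * (R.x + s))
    (h1 : (g 1 0 : ℝ) * (R.x + s) + g 1 1 * R.A = ε * R.A) :
    Tendsto (fun n : ℕ => ((M * g ^ n) 0 0 : ℝ) / (M * g ^ n) 1 0) atTop
      (𝓝 (((M • R).x + s) / (M • R).A)) := by
  rw [← root_smul_div hA hM hs]
  have hU0 := denom_ne_zero hA hM hs
  set U := (M 1 0 : ℝ) * (R.x + s) + M 1 1 * R.A with hU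
  set P := (M 0 0 : ℝ) * (R.x + s) + M 0 1 * R.A with hP
  have hpow : ∀ n : ℕ, ∀ i : Fin 2, ((M * g ^ n) i 0 : ℝ) * (R.x + s) + (M * g ^ n) i 1 * R.A =
      ε ^ n * ((M i 0 : ℝ) * (R.x + s) + M i 1 * R.A) := by
    intro n
    induction n with
    | zero => intro i; simp
    | succ n ih =>
      intro i
      rw [pow_succ, ← mul_assoc, SL_mul_apply _ g, SL_mul_apply _ g]
      push_cast
      linear_combination ((M * g ^ n) i 0 : ℝ) * h0 + ((M * g ^ n) i 1 : ℝ) * h1 + ε * ih i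
  have hbig : Tendsto (fun n : ℕ => ε ^ n * |U|) atTop atTop :=
    (tendsto_pow_atTop_atTop_of_one_lt hε).atTop_mul_const (abs_pos.2 hU0)
  have hdiv : Tendsto (fun n : ℕ => |(R.A : ℝ)| / (ε ^ n * |U|)) atTop (𝓝 0) :=
    hbig.const_div_atTop _
  rw [tendsto_iff_dist_tendsto_zero]
  refine squeeze_zero' (Eventually.of_forall fun _ => dist_nonneg) ?_ hdiv
  filter_upwards [hbig.eventually_gt_atTop |(R.A : ℝ)|] with n hn
  have hp0 := hpow n 0
  have hp1 := hpow n 1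
  rw [← hP] at hp0
  rw [← hU] at hp1
  have hdet := det_eq_real (M * g ^ n)
  have hN := QForm.det_eq (M * g ^ n)
  have hεn : ε ^ n ≠ 0 := by positivity
  generalize M * g ^ n = N at *
  have hc : N 1 0 ≠ 0 := by
    intro hc
    rw [hc, mul_zero, sub_zero] at hN
    have hu : |N 1 1| = 1 := Int.isUnit_iff_abs_eq.1 (isUnit_iff_exists_inv'.2 ⟨_, hN⟩)
    have hu' : |(N 1 1 : ℝ)| = 1 := by exact_mod_cast hu
    rw [hc, Int.cast_zero, zero_mul, zero_add] at hp1
    have := congrArg abs hp1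
    rw [abs_mul, hu', one_mul, abs_mul, abs_of_pos (by positivity : 0 < ε ^ n)] at this
    linarith
  have hc' : (1 : ℝ) ≤ |(N 1 0 : ℝ)| := by exact_mod_cast Int.one_le_abs hc
  have hc0 : (N 1 0 : ℝ) ≠ 0 := by exact_mod_cast hc
  have e : (N 0 0 : ℝ) / N 1 0 - P / U = R.A / (N 1 0 * (ε ^ n * U)) := by
    rw [← mul_div_mul_left P U hεn, ← hp0, ← hp1]
    have hne : (N 1 0 : ℝ) * (R.x + s) + N 1 1 * R.A ≠ 0 := by
      rw [hp1]; exact mul_ne_zero hεn hU0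
    rw [div_sub_div _ _ hc0 hne]
    congr 1
    linear_combination (R.A : ℝ) * hdet
  rw [Real.dist_eq, e, abs_div, abs_mul, abs_mul, abs_of_pos (by positivity : 0 < ε ^ n)]
  apply div_le_div_of_nonneg_left (abs_nonneg _) (by positivity)
  nlinarith [mul_pos (by positivity : 0 < ε ^ n) (abs_pos.2 hU0)]

lemma tsum_telescope {φ : ℤ → ℝ} (hs : Summable (fun k : ℤ => φ (k + 1) - φ k)) {a b : ℝ}
    (ha : Tendsto (fun n : ℕ => φ n) atTop (𝓝 a)) (hb : Tendsto (fun n : ℕ => φ (-n)) atTop (𝓝 b)) :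
    ∑' k : ℤ, (φ (k + 1) - φ k) = a - b := by
  have h1 : Summable (fun n : ℕ => φ ((n : ℤ) + 1) - φ n) :=
    hs.comp_injective (i := fun n : ℕ => (n : ℤ)) (fun a b h => by simpa using h)
  have h2 : Summable (fun n : ℕ => φ (-((n : ℤ) + 1) + 1) - φ (-((n : ℤ) + 1))) :=
    hs.comp_injective (i := fun n : ℕ => -((n : ℤ) + 1)) (fun a b h => by simpa using h)
  rw [tsum_of_nat_of_neg_add_one (f := fun k : ℤ => φ (k + 1) - φ k) h1 h2]
  have e1 : ∑' n : ℕ, (φ ((n : ℤ) + 1) - φ n) = a - φ 0 := by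
    refine tendsto_nhds_unique h1.tendsto_sum_tsum_nat ?_
    have : ∀ N : ℕ, ∑ n ∈ Finset.range N, (φ ((n : ℤ) + 1) - φ n) = φ N - φ 0 := by
      intro N
      simpa using Finset.sum_range_sub (fun n : ℕ => φ (n : ℤ)) N
    simp only [this]
    exact ha.sub_const _
  have e2 : ∑' n : ℕ, (φ (-((n : ℤ) + 1) + 1) - φ (-((n : ℤ) + 1))) = φ 0 - b := by
    refine tendsto_nhds_unique h2.tendsto_sum_tsum_nat ?_
    have : ∀ N : ℕ, ∑ n ∈ Finset.range N, (φ (-((n : ℤ) + 1) + 1) - φ (-((n : ℤ) + 1))) =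
        φ 0 - φ (-N) := by
      intro N
      have := Finset.sum_range_sub' (fun n : ℕ => φ (-(n : ℤ))) N
      simpa using this
    simp only [this]
    exact hb.const_sub _
  rw [e1, e2]
  ring

/-- The automorph of a form attached to a solution of the Pell equation. -/
def automorph (R : QForm) (t s : ℤ) (h : t ^ 2 - R.disc * s ^ 2 = 1) : SL(2, ℤ) :=
  ⟨!![t + R.x * s, -R.y * s; R.A * s, t - R.x * s], by
    rw [Matrix.det_fin_two_of]
    simp only [QForm.disc] at h
    linear_combination h⟩

lemma automorph_smul (R : QForm) (t s : ℤ) (h : t ^ 2 - R.disc * s ^ 2 = 1) :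
    automorph R t s h • R = R := by
  have e00 : automorph R t s h 0 0 = t + R.x * s := rfl
  have e01 : automorph R t s h 0 1 = -R.y * s := rfl
  have e10 : automorph R t s h 1 0 = R.A * s := rfl
  have e11 : automorph R t s h 1 1 = t - R.x * s := rfl
  have h' := h
  simp only [QForm.disc] at h'
  ext
  · rw [QForm.smul_A, e10, e11]
    simp only [QForm.val, qf]
    linear_combination R.A * h'
  · rw [QForm.smul_x, e00, e01, e10, e11]
    linear_combination R.x * h'
  · rw [QForm.smul_y, e00, e01]
    simp only [QForm.val, qf]
    linear_combination R.y * h'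

lemma exists_pell {D : ℤ} (hD : 0 < D) (hsq : ¬IsSquare D) :
    ∃ t s : ℤ, t ^ 2 - D * s ^ 2 = 1 ∧ 0 < t ∧ 0 < s ∧ s % 2 = 0 := by
  have h4 : ¬IsSquare (4 * D) := by
    rintro ⟨r, hr⟩
    have h2 : (2 : ℤ) ∣ r := by
      have : (2 : ℤ) ∣ r * r := ⟨2 * D, by rw [← hr]; ring⟩
      exact (Int.prime_two.dvd_mul.1 this).elim id id
    obtain ⟨k, rfl⟩ := h2
    exact hsq ⟨k, by linarith⟩
  obtain ⟨t, s, h, hs⟩ := Pell.exists_of_not_isSquare (by linarith) h4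
  refine ⟨|t|, 2 * |s|, ?_, ?_, ?_, by omega⟩
  · rw [mul_pow, sq_abs, sq_abs]
    linear_combination h
  · refine abs_pos.2 fun ht => ?_
    subst ht
    nlinarith [sq_nonneg s]
  · have := abs_pos.2 hs
    linarith

lemma tendsto_pval_nonsquare {R : QForm} (hD : 0 < R.disc) (hA : R.A % 2 = 1) {j : ℕ}
    (hj : 1 ≤ j) (hsq : ¬IsSquare R.disc) :
    Tendsto (fun N => ∑' Q : redSet R N, pval j Q) atTop (𝓝 0) := by
  obtain ⟨t, s, hts, ht, hs, hs2⟩ := exists_pell hD hsq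
  set g := automorph R t s hts with hg
  have e00 : g 0 0 = t + R.x * s := rfl
  have e01 : g 0 1 = -R.y * s := rfl
  have e10 : g 1 0 = R.A * s := rfl
  have e11 : g 1 1 = t - R.x * s := rfl
  have hgG : g ∈ CongruenceSubgroup.Gamma0 2 := by
    rw [mem_Gamma0_two, e10, Int.mul_emod, hs2, mul_zero]
    rfl
  have hgS : g ∈ stab R :=
    Subgroup.mem_inf.2 ⟨hgG, MulAction.mem_stabilizer_iff.2 (automorph_smul R t s hts)⟩
  let γ : stab R := ⟨g, hgS⟩
  have hDr : (0 : ℝ) < R.disc := by exact_mod_cast hD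
  have hq : √(R.disc : ℝ) ^ 2 = R.disc := Real.sq_sqrt hDr.le
  have hq' : (-√(R.disc : ℝ)) ^ 2 = R.disc := by rw [neg_sq, hq]
  have hq2 : √(R.disc : ℝ) ^ 2 = (R.x : ℝ) ^ 2 - R.A * R.y := by
    rw [hq, QForm.disc]; push_cast; ring
  set ε := (t : ℝ) + s * √(R.disc : ℝ) with hεdef
  have hε : 1 < ε := by
    have h1 : (1 : ℝ) ≤ t := by exact_mod_cast ht
    have h2 : (1 : ℝ) ≤ s := by exact_mod_cast hs
    have h3 := Real.sqrt_pos.2 hDr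
    nlinarith
  let φ : SL(2, ℤ) → ℝ := fun M => rowSin j (botRow M)
  have hF : ∀ M : SL(2, ℤ), rowSin j (rowMul (botRow M) g) - rowSin j (botRow M) =
      φ (M * g) - φ M := fun M => by simp only [φ, botRow_mul]
  have lim : ∀ (M h : SL(2, ℤ)) (w : ℝ), M ∈ CongruenceSubgroup.Gamma0 2 → w ^ 2 = R.disc →
      (h 0 0 : ℝ) * (R.x + w) + h 0 1 * R.A = ε * (R.x + w) →
      (h 1 0 : ℝ) * (R.x + w) + h 1 1 * R.A = ε * R.A →
      Tendsto (fun n : ℕ => φ (M * h ^ n)) atTop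
        (𝓝 (Real.sin (2 * π * j * (((M • R).x + w) / (M • R).A)))) := by
    intro M h w hM hw h0 h1
    have := tendsto_apex hA hM hw hε h0 h1
    simp only [φ, rowSin_botRow]
    exact (Real.continuous_sin.tendsto _).comp (this.const_mul _)
  have limp : ∀ M ∈ CongruenceSubgroup.Gamma0 2, Tendsto (fun n : ℕ => φ (M * g ^ n)) atTop
      (𝓝 (Real.sin (2 * π * j * (((M • R).x + √(R.disc : ℝ)) / (M • R).A)))) := by
    intro M hM
    refine lim M g _ hM hq ?_ ?_
    · rw [e00, e01]; push_cast
      linear_combination (-s : ℝ) * hq2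
    · rw [e10, e11]; push_cast
      ring
  have limn : ∀ M ∈ CongruenceSubgroup.Gamma0 2, Tendsto (fun n : ℕ => φ (M * g⁻¹ ^ n)) atTop
      (𝓝 (Real.sin (2 * π * j * (((M • R).x - √(R.disc : ℝ)) / (M • R).A)))) := by
    intro M hM
    have i00 : (g⁻¹) 0 0 = t - R.x * s := by
      rw [Matrix.SpecialLinearGroup.coe_inv, Matrix.adjugate_fin_two]; rfl
    have i01 : (g⁻¹) 0 1 = R.y * s := by
      rw [Matrix.SpecialLinearGroup.coe_inv, Matrix.adjugate_fin_two]
      simp [e01]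
    have i10 : (g⁻¹) 1 0 = -(R.A * s) := by
      rw [Matrix.SpecialLinearGroup.coe_inv, Matrix.adjugate_fin_two]
      simp [e10]
    have i11 : (g⁻¹) 1 1 = t + R.x * s := by
      rw [Matrix.SpecialLinearGroup.coe_inv, Matrix.adjugate_fin_two]; rfl
    have := lim M g⁻¹ _ hM hq' ?_ ?_
    · simpa only [← sub_eq_add_neg] using this
    · rw [i00, i01]; push_cast
      linear_combination (s : ℝ) * hq2
    · rw [i10, i11]; push_cast
      ring
  have hinj : Function.Injective (fun k : ℤ => γ ^ k) := by
    rw [injective_zpow_iff_not_isOfFinOrder, isOfFinOrder_iff_pow_eq_one]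
    rintro ⟨n, hn, hgn⟩
    have hgn' : g ^ n = 1 := by
      have := congrArg (Subtype.val) hgn
      simpa [γ] using this
    have hpow : ∀ n : ℕ, ((g ^ n) 1 0 : ℝ) * (R.x + √(R.disc : ℝ)) + (g ^ n) 1 1 * R.A =
        ε ^ n * R.A ∧ ((g ^ n) 0 0 : ℝ) * (R.x + √(R.disc : ℝ)) + (g ^ n) 0 1 * R.A =
        ε ^ n * (R.x + √(R.disc : ℝ)) := by
      intro n
      induction n with
      | zero => simp
      | succ n ih =>
        have h0 : ((t : ℝ) + R.x * s) * (R.x + √(R.disc : ℝ)) + (-R.y * s) * R.A =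
            ε * (R.x + √(R.disc : ℝ)) := by linear_combination (-s : ℝ) * hq2
        have h1 : ((R.A : ℝ) * s) * (R.x + √(R.disc : ℝ)) + (t - R.x * s) * R.A = ε * R.A := by
          ring
        constructor <;>
        · rw [pow_succ, SL_mul_apply _ g, SL_mul_apply _ g, e00, e01, e10, e11]
          push_cast
          first
          | linear_combination ((g ^ n) 1 0 : ℝ) * h0 + ((g ^ n) 1 1 : ℝ) * h1 + ε * ih.1
          | linear_combination ((g ^ n) 0 0 : ℝ) * h0 + ((g ^ n) 0 1 : ℝ) * h1 + ε * ih.2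
    have h1 := (hpow n).1
    rw [hgn'] at h1
    have hA0 : (R.A : ℝ) ≠ 0 := by norm_cast; omega
    have h2 : ε ^ n = 1 := by
      have h3 : (R.A : ℝ) = ε ^ n * R.A := by simpa using h1
      field_simp at h3
      linarith
    have := one_lt_pow₀ hε hn.ne'
    linarith
  let e : ℤ ≃ Subgroup.zpowers γ := Equiv.ofBijective (fun k => ⟨γ ^ k, k, rfl⟩)
    ⟨fun a b h => hinj (congrArg Subtype.val h), fun ⟨x, k, hk⟩ => ⟨k, Subtype.ext hk⟩⟩
  have hpt := summable_pathTerm_and_tendsto hD hA j hj g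
  refine tendsto_redSet hA (fun v => rowSin j (rowMul v g) - rowSin j v) hpt.1 hpt.2
    (Subgroup.zpowers γ) (pval j) ?_
  intro M hM hsum
  rw [← e.summable_iff] at hsum
  rw [← e.tsum_eq]
  have he : ∀ k : ℤ, rowSin j (rowMul (botRow (M * ((e k : stab R) : SL(2, ℤ)))) g) -
      rowSin j (botRow (M * ((e k : stab R) : SL(2, ℤ)))) = φ (M * g ^ (k + 1)) - φ (M * g ^ k) := by
    intro k
    have hek : ((e k : stab R) : SL(2, ℤ)) = g ^ k := Subgroup.coe_zpow _ γ k
    rw [hF, hek, zpow_add_one, ← mul_assoc]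
  simp only [Function.comp_def, he] at hsum ⊢
  rw [tsum_telescope (φ := fun k : ℤ => φ (M * g ^ k)) hsum
    (by simpa only [zpow_natCast] using limp M hM)
    (by simpa only [zpow_neg, zpow_natCast, inv_pow] using limn M hM), pval, QForm.disc_smul]

lemma tendsto_pval {R : QForm} (hD : 0 < R.disc) (hA : R.A % 2 = 1) {j : ℕ} (hj : 1 ≤ j) :
    Tendsto (fun N => ∑' Q : redSet R N, pval j Q) atTop (𝓝 0) := by
  by_cases h : IsSquare R.disc
  · exact tendsto_pval_square hD hA hj h
  · exact tendsto_pval_nonsquare hD hA hj h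

lemma S_smul_A (Q : QForm) : (ModularGroup.S • Q).A = Q.y := by
  rw [QForm.smul_A]
  simp [ModularGroup.coe_S, QForm.val, qf]

lemma T_zpow_smul_y (k : ℤ) (Q : QForm) :
    (ModularGroup.T ^ k • Q).y = Q.y + 2 * Q.x * k + Q.A * k ^ 2 := by
  rw [QForm.smul_y, ModularGroup.coe_T_zpow]
  simp [QForm.val, qf]

/-- Forms with coefficients bounded by `2 * D`. -/
def boxSet (D : ℤ) : Set QForm :=
  {Q | |Q.A| ≤ 2 * D ∧ |Q.x| ≤ 2 * D ∧ |Q.y| ≤ 2 * D}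

lemma boxSet_finite (D : ℤ) : (boxSet D).Finite := by
  let f : QForm → ℤ × ℤ × ℤ := fun Q => (Q.A, Q.x, Q.y)
  have hf : Function.Injective f := fun Q Q' h => by
    simp only [f, Prod.mk.injEq] at h
    exact QForm.ext h.1 h.2.1 h.2.2
  refine Set.Finite.subset (((Set.finite_Icc (-(2 * D)) (2 * D)).prod
    ((Set.finite_Icc (-(2 * D)) (2 * D)).prod (Set.finite_Icc (-(2 * D)) (2 * D)))).preimage
    hf.injOn) ?_
  rintro Q ⟨h1, h2, h3⟩
  exact ⟨abs_le.1 h1, abs_le.1 h2, abs_le.1 h3⟩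

lemma exists_two_mul_abs_le (x A : ℤ) (hA : A ≠ 0) : ∃ k : ℤ, 2 * |x + k * A| ≤ |A| := by
  have h0 := Int.emod_nonneg x hA
  have h1 := Int.emod_lt_abs x hA
  have h2 := Int.emod_def x A
  by_cases h : 2 * (x % A) ≤ |A|
  · refine ⟨-(x / A), ?_⟩
    rw [show x + -(x / A) * A = x % A by rw [h2]; ring, abs_of_nonneg h0]
    exact h
  · push Not at h
    rcases abs_cases A with ⟨hA', _⟩ | ⟨hA', _⟩
    · refine ⟨-(x / A) - 1, ?_⟩
      rw [show x + (-(x / A) - 1) * A = x % A - A by rw [h2]; ring,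
        abs_of_nonpos (by omega)]
      omega
    · refine ⟨-(x / A) + 1, ?_⟩
      rw [show x + (-(x / A) + 1) * A = x % A + A by rw [h2]; ring,
        abs_of_nonpos (by omega)]
      omega

lemma exists_smul_mem_boxSet {D : ℤ} (hD : 0 < D) :
    ∀ (n : ℕ) (Q : QForm), Q.disc = D → Q.A.natAbs = n → ∃ M : SL(2, ℤ), M • Q ∈ boxSet D := by
  intro n
  induction n using Nat.strong_induction_on with
  | _ n ih =>
    intro Q hQ hn
    by_cases hA : Q.A = 0
    · have hx : Q.x ^ 2 = D := by rw [← hQ, QForm.disc, hA]; ring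
      have hx0 : Q.x ≠ 0 := by rintro h; rw [h] at hx; simp at hx; omega
      have hxD : |Q.x| ≤ D := by
        rw [← hx, ← sq_abs]
        have := Int.one_le_abs hx0
        nlinarith
      refine ⟨ModularGroup.T ^ (-(Q.y / (2 * Q.x))), ?_, ?_, ?_⟩
      · rw [T_zpow_smul_A, hA]; simp; omega
      · rw [T_zpow_smul_x, hA]; simp; omega
      · rw [T_zpow_smul_y, hA]
        have h0 := Int.emod_nonneg Q.y (b := 2 * Q.x) (by omega)
        have h1 := Int.emod_lt_abs Q.y (b := 2 * Q.x) (by omega)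
        rw [show Q.y + 2 * Q.x * -(Q.y / (2 * Q.x)) + 0 * (-(Q.y / (2 * Q.x))) ^ 2 =
          Q.y % (2 * Q.x) by rw [Int.emod_def]; ring, abs_of_nonneg h0]
        rw [abs_mul, abs_two] at h1
        omega
    · obtain ⟨k, hk⟩ := exists_two_mul_abs_le Q.x Q.A hA
      set Q' := ModularGroup.T ^ k • Q with hQ'
      have hA' : Q'.A = Q.A := T_zpow_smul_A k Q
      have hx' : Q'.x = Q.x + k * Q.A := T_zpow_smul_x k Q
      have hd' : Q'.disc = D := by rw [hQ', QForm.disc_smul, hQ]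
      by_cases hy : |Q'.y| < |Q'.A|
      · obtain ⟨M, hM⟩ := ih (ModularGroup.S • Q').A.natAbs
          (by rw [S_smul_A, ← hn, ← hA']; zify; exact hy)
          (ModularGroup.S • Q') (by rw [QForm.disc_smul, hd']) rfl
        exact ⟨M * (ModularGroup.S * ModularGroup.T ^ k), by rwa [mul_smul, mul_smul]⟩
      · push Not at hy
        rw [← hx', ← hA'] at hk
        rw [← hA'] at hA
        have ha := Int.one_le_abs hA
        have hprod : Q'.A * Q'.y = Q'.x ^ 2 - D := by rw [← hd', QForm.disc]; ring
        have habs : |Q'.A| * |Q'.y| = |Q'.x ^ 2 - D| := by rw [← abs_mul, hprod]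
        have hx2 : Q'.x ^ 2 = |Q'.x| ^ 2 := (sq_abs _).symm
        have hx0 := abs_nonneg Q'.x
        have hle : |Q'.A| * |Q'.y| ≤ D := by
          rw [habs]
          rcases le_total D (Q'.x ^ 2) with h | h
          · exfalso
            rw [abs_of_nonneg (by linarith : 0 ≤ Q'.x ^ 2 - D)] at habs
            nlinarith
          · rw [abs_of_nonpos (by linarith : Q'.x ^ 2 - D ≤ 0)]
            nlinarith [sq_nonneg Q'.x]
        refine ⟨ModularGroup.T ^ k, ?_, ?_, ?_⟩
        · nlinarith
        · nlinarith
        · nlinarith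

/-- There are finitely many classes of forms of given discriminant under `Γ₀(2)`. -/
lemma exists_finite_reps {D : ℤ} (hD : 0 < D) :
    ∃ S : Set QForm, S.Finite ∧ ∀ Q : QForm, Q.disc = D →
      ∃ R ∈ S, ∃ M ∈ CongruenceSubgroup.Gamma0 2, M • R = Q := by
  let Γ := CongruenceSubgroup.Gamma0 2
  have : Finite (SL(2, ℤ) ⧸ Γ) := Subgroup.finite_quotient_of_finiteIndex
  refine ⟨(fun p : (SL(2, ℤ) ⧸ Γ) × QForm => p.1.out⁻¹ • p.2) '' (Set.univ ×ˢ boxSet D),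
    (Set.finite_univ.prod (boxSet_finite D)).image _, ?_⟩
  intro Q hQ
  obtain ⟨M, hM⟩ := exists_smul_mem_boxSet hD _ Q hQ rfl
  refine ⟨_, ⟨((M : SL(2, ℤ) ⧸ Γ), M • Q), ⟨Set.mem_univ _, hM⟩, rfl⟩,
    ((M : SL(2, ℤ) ⧸ Γ).out⁻¹ * M)⁻¹, inv_mem ?_, ?_⟩
  · rw [← QuotientGroup.eq, QuotientGroup.out_eq']
  · simp only
    rw [← mul_smul, ← mul_smul]
    simp

/-- Canonical representative of a class. -/
def classRep (Q : QForm) : QForm :=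
  (Quotient.mk (MulAction.orbitRel (CongruenceSubgroup.Gamma0 2) QForm) Q).out

lemma classRep_eq_iff {Q Q' : QForm} : classRep Q = classRep Q' ↔
    ∃ M ∈ CongruenceSubgroup.Gamma0 2, M • Q' = Q := by
  rw [classRep, classRep, Quotient.out_inj, Quotient.eq]
  rw [MulAction.orbitRel_apply, MulAction.mem_orbit_iff]
  exact ⟨fun ⟨g, hg⟩ => ⟨g, g.2, hg⟩, fun ⟨M, hM, h⟩ => ⟨⟨M, hM⟩, h⟩⟩

lemma classRep_classRep (Q : QForm) : classRep (classRep Q) = classRep Q := by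
  rw [classRep, classRep, Quotient.out_eq]

lemma exists_smul_classRep (Q : QForm) :
    ∃ M ∈ CongruenceSubgroup.Gamma0 2, M • classRep Q = Q :=
  classRep_eq_iff.1 (classRep_classRep Q).symm


/-- Pairs `(c, x)` with `c` odd, `0 ≤ x < c ≤ N` and `c ∣ x ^ 2 - D`. -/
def pairSet (D : ℤ) (N : ℕ) : Finset (Σ _ : ℕ, ℕ) :=
  ((Finset.range (N + 1)).sigma fun c => Finset.range c).filter
    fun p => Odd p.1 ∧ (p.1 : ℤ) ∣ (p.2 : ℤ) ^ 2 - D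

/-- The positive form attached to a pair. -/
def posForm (D : ℤ) (p : Σ _ : ℕ, ℕ) : QForm := ⟨p.1, p.2, ((p.2 : ℤ) ^ 2 - D) / p.1⟩

/-- The form attached to a pair, with negative leading coefficient. -/
def negForm (D : ℤ) (p : Σ _ : ℕ, ℕ) : QForm := ⟨-p.1, p.2, -(((p.2 : ℤ) ^ 2 - D) / p.1)⟩

open Classical in
/-- The reduced forms of discriminant `D`. -/
def redForms (D : ℤ) (N : ℕ) : Finset QForm :=
  (pairSet D N).image (posForm D) ∪ (pairSet D N).image (negForm D)

lemma mem_redForms {D : ℤ} {N : ℕ} {Q : QForm} : Q ∈ redForms D N ↔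
    Q.disc = D ∧ Q.A % 2 = 1 ∧ 0 ≤ Q.x ∧ Q.x < |Q.A| ∧ |Q.A| ≤ N := by
  simp only [redForms, pairSet, Finset.mem_union, Finset.mem_image, Finset.mem_filter,
    Finset.mem_sigma, Finset.mem_range, Nat.lt_succ_iff]
  constructor
  · rintro (⟨⟨c, x⟩, ⟨⟨hc, hx⟩, hodd, y, hy⟩, rfl⟩ | ⟨⟨c, x⟩, ⟨⟨hc, hx⟩, hodd, y, hy⟩, rfl⟩) <;>
    · simp only at hc hx hodd hy
      have hc0 : (c : ℤ) ≠ 0 := by omega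
      rw [Nat.odd_iff] at hodd
      simp only [posForm, negForm, QForm.disc, hy, Int.mul_ediv_cancel_left _ hc0, abs_neg,
        Nat.abs_cast]
      refine ⟨by linear_combination hy, by omega, by omega, by omega, by omega⟩
  · rintro ⟨hd, hA, h0, h1, h2⟩
    have hA0 : Q.A ≠ 0 := by omega
    have hprod : Q.x ^ 2 - D = Q.A * Q.y := by rw [← hd, QForm.disc]; ring
    have hx : ((Q.x.toNat : ℕ) : ℤ) = Q.x := Int.toNat_of_nonneg h0
    rcases lt_or_gt_of_ne hA0 with hneg | hpos
    · right
      rw [abs_of_neg hneg] at h1 h2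
      have hc : ((Q.A.natAbs : ℕ) : ℤ) = -Q.A := by omega
      refine ⟨⟨Q.A.natAbs, Q.x.toNat⟩, ⟨⟨by simp only; omega, by simp only; omega⟩, ?_, ?_⟩, ?_⟩
      · rw [Nat.odd_iff]; simp only; omega
      · simp only [hc, hx, hprod]
        exact ⟨-Q.y, by ring⟩
      · ext
        · simp only [negForm, hc, neg_neg]
        · simp only [negForm, hx]
        · simp only [negForm, hc, hx, hprod, Int.ediv_neg, neg_neg,
            Int.mul_ediv_cancel_left _ hA0]
    · left
      rw [abs_of_pos hpos] at h1 h2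
      have hc : ((Q.A.natAbs : ℕ) : ℤ) = Q.A := by omega
      refine ⟨⟨Q.A.natAbs, Q.x.toNat⟩, ⟨⟨by simp only; omega, by simp only; omega⟩, ?_, ?_⟩, ?_⟩
      · rw [Nat.odd_iff]; simp only; omega
      · simp only [hc, hx, hprod]
        exact ⟨Q.y, rfl⟩
      · ext
        · simp only [posForm, hc]
        · simp only [posForm, hx]
        · simp only [posForm, hc, hx, hprod, Int.mul_ediv_cancel_left _ hA0]

lemma sum_redForms (D : ℤ) (N : ℕ) (f : QForm → ℝ) : ∑ Q ∈ redForms D N, f Q =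
    ∑ p ∈ pairSet D N, (f (posForm D p) + f (negForm D p)) := by
  classical
  rw [redForms, Finset.sum_union, Finset.sum_image, Finset.sum_image, Finset.sum_add_distrib]
  · rintro ⟨c, x⟩ _ ⟨c', x'⟩ _ h
    simp only [negForm, QForm.mk.injEq, neg_inj, Nat.cast_inj] at h
    rw [h.1, h.2.1]
  · rintro ⟨c, x⟩ _ ⟨c', x'⟩ _ h
    simp only [posForm, QForm.mk.injEq, Nat.cast_inj] at h
    rw [h.1, h.2.1]
  · rw [Finset.disjoint_left]
    rintro Q h h'
    simp only [Finset.mem_image, pairSet, Finset.mem_filter, Finset.mem_sigma,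
      Finset.mem_range] at h h'
    obtain ⟨⟨c, x⟩, ⟨⟨_, hx⟩, _⟩, rfl⟩ := h
    obtain ⟨⟨c', x'⟩, ⟨⟨_, hx'⟩, _⟩, h⟩ := h'
    simp only [negForm, posForm, QForm.mk.injEq] at h hx hx'
    omega

lemma disc_posForm {D : ℤ} {N : ℕ} {p : Σ _ : ℕ, ℕ} (hp : p ∈ pairSet D N) :
    (posForm D p).disc = D := by
  classical
  exact (mem_redForms.1 (Finset.mem_union_left _ (Finset.mem_image_of_mem (posForm D) hp))).1

lemma pval_negForm (j : ℕ) (D : ℤ) (p : Σ _ : ℕ, ℕ) :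
    pval j (negForm D p) = -pval j (posForm D p) := by
  have h : (negForm D p).disc = (posForm D p).disc := by
    simp only [QForm.disc, negForm, posForm]; ring
  rw [pval, pval, h]
  simp only [negForm, posForm, Int.cast_neg, Int.cast_natCast, div_neg, mul_neg, Real.sin_neg]
  ring

lemma pval_posForm (j : ℕ) {D : ℤ} (p : Σ _ : ℕ, ℕ) (h : (posForm D p).disc = D) :
    pval j (posForm D p) =
      2 * (Real.cos (2 * π * j * p.2 / p.1) * Real.sin (2 * π * j * √(D : ℝ) / p.1)) := by
  rw [pval, h]
  simp only [posForm, Int.cast_natCast]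
  rw [show 2 * π * j * (((p.2 : ℝ) + √(D : ℝ)) / p.1) =
      2 * π * j * p.2 / p.1 + 2 * π * j * √(D : ℝ) / p.1 by ring,
    show 2 * π * j * (((p.2 : ℝ) - √(D : ℝ)) / p.1) =
      2 * π * j * p.2 / p.1 - 2 * π * j * √(D : ℝ) / p.1 by ring, Real.sin_add, Real.sin_sub]
  ring

lemma tendsto_sum_redForms {D : ℤ} (hD : 0 < D) {j : ℕ} (hj : 1 ≤ j) (ψ : QForm → ℝ)
    (hinv : ∀ M ∈ CongruenceSubgroup.Gamma0 2, ∀ Q : QForm, Q.disc = D → Q.A % 2 = 1 →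
      ψ (M • Q) = ψ Q) :
    Tendsto (fun N => ∑ Q ∈ redForms D N, ψ Q * pval j Q) atTop (𝓝 0) := by
  classical
  obtain ⟨S, hS, hrep⟩ := exists_finite_reps hD
  let S' := (hS.toFinset.image classRep).filter fun R => R.disc = D ∧ R.A % 2 = 1
  have hcl : ∀ Q : QForm, Q.disc = D → Q.A % 2 = 1 →
      (classRep Q).disc = D ∧ (classRep Q).A % 2 = 1 := by
    intro Q hd hA
    obtain ⟨M, hM, h⟩ := exists_smul_classRep Q
    have h' : M⁻¹ • Q = classRep Q := by rw [inv_smul_eq_iff, h]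
    rw [← h']
    exact ⟨by rw [QForm.disc_smul, hd], smul_A_odd hA (inv_mem hM)⟩
  have hmaps : ∀ N, ∀ Q ∈ redForms D N, classRep Q ∈ S' := by
    intro N Q hQ
    obtain ⟨hd, hA, _⟩ := mem_redForms.1 hQ
    refine Finset.mem_filter.2 ⟨?_, hcl Q hd hA⟩
    obtain ⟨R, hR, hRQ⟩ := hrep Q hd
    exact Finset.mem_image.2 ⟨R, hS.mem_toFinset.2 hR, (classRep_eq_iff.2 hRQ).symm⟩
  have hsplit : ∀ N, ∑ Q ∈ redForms D N, ψ Q * pval j Q =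
      ∑ R ∈ S', ψ R * ∑' Q : redSet R N, pval j Q := by
    intro N
    rw [← Finset.sum_fiberwise_of_maps_to (hmaps N)]
    refine Finset.sum_congr rfl fun R hR => ?_
    obtain ⟨hR1, hRd, hRA⟩ := Finset.mem_filter.1 hR
    have hRR : classRep R = R := by
      obtain ⟨P, _, rfl⟩ := Finset.mem_image.1 hR1
      exact classRep_classRep P
    have hset : redSet R N = ((redForms D N).filter fun Q => classRep Q = R : Finset QForm) := by
      ext Q
      rw [Finset.mem_coe, Finset.mem_filter, mem_redForms]
      constructor
      · rintro ⟨⟨M, hM, rfl⟩, h⟩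
        exact ⟨⟨by rw [QForm.disc_smul, hRd], smul_A_odd hRA hM, h⟩,
          (classRep_eq_iff.2 ⟨M, hM, rfl⟩).trans hRR⟩
      · rintro ⟨⟨_, _, h⟩, hc⟩
        have := exists_smul_classRep Q
        rw [hc] at this
        exact ⟨this, h⟩
    rw [hset, Finset.tsum_subtype', Finset.mul_sum]
    refine Finset.sum_congr rfl fun Q hQ => ?_
    obtain ⟨M, hM, hMQ⟩ := exists_smul_classRep Q
    rw [(Finset.mem_filter.1 hQ).2] at hMQ
    rw [← hMQ, hinv M hM R hRd hRA]
  simp only [hsplit]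
  rw [← Finset.sum_const_zero (s := S')]
  refine tendsto_finsetSum _ fun R hR => ?_
  obtain ⟨_, hRd, hRA⟩ := Finset.mem_filter.1 hR
  have := (tendsto_pval (by rw [hRd]; exact hD) hRA hj).const_mul (ψ R)
  rwa [mul_zero] at this

/-- Vanishing of the twisted Salié-type sums. -/
lemma tendsto_twisted_sum {D : ℤ} (hD : 0 < D) {j : ℕ} (hj : 1 ≤ j) (ψ : QForm → ℝ)
    (hinv : ∀ M ∈ CongruenceSubgroup.Gamma0 2, ∀ Q : QForm, Q.disc = D → Q.A % 2 = 1 →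
      ψ (M • Q) = ψ Q)
    (hneg : ∀ Q : QForm, ψ ⟨-Q.A, Q.x, -Q.y⟩ = -ψ Q) :
    Tendsto (fun N : ℕ => ∑ c ∈ Finset.range (N + 1), if Odd c then
      (∑ x ∈ Finset.range c, if (c : ℤ) ∣ (x : ℤ) ^ 2 - D then
        ψ ⟨c, x, ((x : ℤ) ^ 2 - D) / c⟩ * Real.cos (2 * π * j * x / c) else 0) *
        Real.sin (2 * π * j * √(D : ℝ) / c) else 0) atTop (𝓝 0) := by
  have h := (tendsto_sum_redForms hD hj ψ hinv).const_mul (1 / 4)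
  rw [mul_zero] at h
  refine h.congr fun N => ?_
  rw [sum_redForms, Finset.mul_sum]
  have hterm : ∀ p ∈ pairSet D N, 1 / 4 * (ψ (posForm D p) * pval j (posForm D p) +
      ψ (negForm D p) * pval j (negForm D p)) = ψ (posForm D p) *
      Real.cos (2 * π * j * p.2 / p.1) * Real.sin (2 * π * j * √(D : ℝ) / p.1) := by
    intro p hp
    have hn : ψ (negForm D p) = -ψ (posForm D p) := hneg (posForm D p)
    rw [hn, pval_negForm, pval_posForm j p (disc_posForm hp)]
    ring
  rw [Finset.sum_congr rfl hterm, pairSet, Finset.sum_filter, Finset.sum_sigma]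
  refine Finset.sum_congr rfl fun c _ => ?_
  by_cases hc : Odd c
  · simp only [hc, true_and, if_true]
    rw [Finset.sum_mul]
    refine Finset.sum_congr rfl fun x _ => ?_
    split_ifs <;> simp [posForm]
  · simp [hc]

end

/-- `ec c n = exp(2πi n / c)`. -/
def ec (c : ℕ) (n : ℤ) : ℂ := ee ((n : ℂ) / c)

lemma ee_add (x y : ℂ) : ee (x + y) = ee x * ee y := by
  simp only [ee, ← Complex.exp_add]; ring_nf

lemma ee_eq_one_iff (x : ℂ) : ee x = 1 ↔ ∃ n : ℤ, x = n := by
  rw [ee, Complex.exp_eq_one_iff]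
  constructor
  · rintro ⟨n, hn⟩
    refine ⟨n, mul_left_cancel₀ Complex.two_pi_I_ne_zero ?_⟩
    rw [hn]; ring
  · rintro ⟨n, rfl⟩
    exact ⟨n, by ring⟩

lemma ec_add (c : ℕ) (m n : ℤ) : ec c (m + n) = ec c m * ec c n := by
  rw [ec, ec, ec, ← ee_add]; push_cast; rw [add_div]

lemma ec_zero (c : ℕ) : ec c 0 = 1 := by simp [ec, ee]

lemma ec_eq_one_iff {c : ℕ} (hc : c ≠ 0) (n : ℤ) : ec c n = 1 ↔ (c : ℤ) ∣ n := by
  have hc' : (c : ℂ) ≠ 0 := by exact_mod_cast hc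
  rw [ec, ee_eq_one_iff]
  constructor
  · rintro ⟨k, hk⟩
    refine ⟨k, ?_⟩
    rw [div_eq_iff hc'] at hk
    have : n = k * c := by exact_mod_cast hk
    rw [this]; ring
  · rintro ⟨k, rfl⟩
    exact ⟨k, by push_cast; field_simp⟩

lemma ec_mul_left {c : ℕ} (hc : c ≠ 0) (k : ℤ) : ec c (c * k) = 1 :=
  (ec_eq_one_iff hc _).2 ⟨k, rfl⟩

lemma ec_mul_mul {l : ℕ} (hl : l ≠ 0) (c : ℕ) (n : ℤ) : ec (l * c) (l * n) = ec c n := by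
  have hl' : (l : ℂ) ≠ 0 := by exact_mod_cast hl
  rw [ec, ec]
  push_cast
  rw [mul_div_mul_left _ _ hl']

lemma ec_congr {c : ℕ} (hc : c ≠ 0) {m n : ℤ} (h : (c : ℤ) ∣ m - n) : ec c m = ec c n := by
  have : m = n + (m - n) := by ring
  rw [this, ec_add, (ec_eq_one_iff hc _).2 h, mul_one]

/-- A function on the integers only depending on the class modulo `c`. -/
def IsPer (c : ℕ) (F : ℤ → ℂ) : Prop := ∀ m n : ℤ, (c : ℤ) ∣ m - n → F m = F n

lemma sum_range_mul_eq (m n : ℕ) (F : ℤ → ℂ) : ∑ v ∈ Finset.range (m * n), F v =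
    ∑ a ∈ Finset.range m, ∑ b ∈ Finset.range n, F (a + m * b) := by
  rw [Finset.sum_comm]
  induction n with
  | zero => simp
  | succ n ih =>
    rw [Nat.mul_succ, Finset.sum_range_add, ih, Finset.sum_range_succ]
    congr 1
    refine Finset.sum_congr rfl fun a _ => ?_
    push_cast
    rw [add_comm]

lemma sum_affine {c : ℕ} (hc : c ≠ 0) {F : ℤ → ℂ} (hF : IsPer c F) {u : ℤ}
    (hu : IsCoprime u c) (t : ℤ) :
    ∑ v ∈ Finset.range c, F (u * v + t) = ∑ v ∈ Finset.range c, F v := by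
  have hc' : (c : ℤ) ≠ 0 := by exact_mod_cast hc
  have hnn : ∀ v : ℕ, ((((u * v + t) % c).toNat : ℕ) : ℤ) = (u * v + t) % c := fun v =>
    Int.toNat_of_nonneg (Int.emod_nonneg _ hc')
  have hmaps : ∀ v ∈ Finset.range c, ((u * v + t) % c).toNat ∈ Finset.range c := by
    intro v _
    rw [Finset.mem_range]
    have := Int.emod_lt_of_pos (u * v + t) (by omega : (0 : ℤ) < c)
    have := hnn v
    omega
  have hinj : Set.InjOn (fun v : ℕ => ((u * v + t) % c).toNat) (Finset.range c) := by
    intro v hv w hw h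
    have h1 : (u * v + t) % c = (u * w + t) % c := by
      have := congrArg (fun k : ℕ => (k : ℤ)) h
      simpa only [hnn] using this
    have h2 : (c : ℤ) ∣ u * (v - w) := by
      have := Int.ModEq.dvd (Int.ModEq.symm h1)
      rwa [show u * v + t - (u * w + t) = u * (v - w) by ring] at this
    have h3 : (c : ℤ) ∣ v - w := hu.symm.dvd_of_dvd_mul_left h2
    have hv' := Finset.mem_range.1 (Finset.mem_coe.1 hv)
    have hw' := Finset.mem_range.1 (Finset.mem_coe.1 hw)
    have := Int.eq_zero_of_abs_lt_dvd h3 (by rw [abs_lt]; omega)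
    omega
  refine Finset.sum_nbij _ hmaps hinj
    (Finset.surjOn_of_injOn_of_card_le _ hmaps hinj le_rfl) fun v _ => ?_
  rw [hnn]
  apply hF
  rw [Int.emod_def]
  exact ⟨(u * v + t) / c, by ring⟩

lemma sum_crt {m n : ℕ} (hm : m ≠ 0) (hn : n ≠ 0) (hmn : m.Coprime n) {F : ℤ → ℂ}
    (hF : IsPer (m * n) F) : ∑ v ∈ Finset.range (m * n), F v =
      ∑ a ∈ Finset.range m, ∑ b ∈ Finset.range n, F (a * n + b * m) := by
  rw [sum_range_mul_eq]
  have hper : IsPer m (fun a => ∑ b ∈ Finset.range n, F (a + m * b)) := by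
    rintro a a' ⟨k, hk⟩
    have h1 : IsPer n (fun b => F (a' + m * b)) := by
      rintro b b' ⟨l, hl⟩
      exact hF _ _ ⟨l, by push_cast; linear_combination (m : ℤ) * hl⟩
    have := sum_affine hn h1 isCoprime_one_left k
    refine Eq.trans (Finset.sum_congr rfl fun b _ => ?_) this
    congr 1
    linear_combination hk
  have hco : IsCoprime (n : ℤ) (m : ℤ) := Nat.isCoprime_iff_coprime.2 hmn.symm
  rw [← sum_affine hm hper hco 0]
  refine Finset.sum_congr rfl fun a _ => Finset.sum_congr rfl fun b _ => ?_
  congr 1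
  ring

lemma sum_ec {c : ℕ} (hc : c ≠ 0) (n : ℤ) :
    ∑ v ∈ Finset.range c, ec c (n * v) = if (c : ℤ) ∣ n then (c : ℂ) else 0 := by
  have hpow : ∀ v : ℕ, ec c (n * v) = ec c n ^ v := by
    intro v
    induction v with
    | zero => simp [ec_zero]
    | succ v ih => rw [pow_succ, ← ih, ← ec_add]; push_cast; ring_nf
  simp only [hpow]
  split_ifs with h
  · rw [(ec_eq_one_iff hc n).2 h]; simp
  · have h1 : ec c n ≠ 1 := fun h' => h ((ec_eq_one_iff hc n).1 h')
    rw [geom_sum_eq h1, ← hpow, (ec_eq_one_iff hc _).2 ⟨n, by ring⟩, sub_self, zero_div]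

lemma sum_range_eq_sum_zmod {c : ℕ} [NeZero c] (F : ℤ → ℂ) :
    ∑ v ∈ Finset.range c, F v = ∑ x : ZMod c, F x.val := by
  refine Finset.sum_nbij' (fun v => (v : ZMod c)) (fun x => x.val) (fun _ _ => Finset.mem_univ _)
    (fun x _ => Finset.mem_range.2 (ZMod.val_lt x)) (fun v hv => ?_) (fun x _ => ?_) (fun v hv => ?_)
  · exact ZMod.val_cast_of_lt (Finset.mem_range.1 hv)
  · simp
  · rw [ZMod.val_cast_of_lt (Finset.mem_range.1 hv)]

lemma per_val {c : ℕ} [NeZero c] {F : ℤ → ℂ} (hF : IsPer c F) (n : ℤ) :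
    F ((n : ZMod c).val) = F n := by
  apply hF
  rw [ZMod.val_intCast, Int.emod_def]
  exact ⟨-(n / c), by ring⟩

lemma jacobiSym_congr {c : ℕ} {a b : ℤ} (h : (c : ℤ) ∣ a - b) : jacobiSym a c = jacobiSym b c := by
  have : a % c = b % c := Int.modEq_iff_dvd.2 (dvd_sub_comm.1 h)
  rw [jacobiSym.mod_left a, jacobiSym.mod_left b, this]

lemma sum_sq_prime {p : ℕ} (hp : p.Prime) (hp2 : p ≠ 2) {F : ℤ → ℂ} (hF : IsPer p F) :
    ∑ v ∈ Finset.range p, F ((v : ℤ) ^ 2) =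
      ∑ h ∈ Finset.range p, (1 + (jacobiSym h p : ℂ)) * F h := by
  have : Fact p.Prime := ⟨hp⟩
  rw [sum_range_eq_sum_zmod fun v => F (v ^ 2),
    sum_range_eq_sum_zmod fun h => (1 + (jacobiSym h p : ℂ)) * F h]
  have h1 : ∀ x : ZMod p, F ((x.val : ℤ) ^ 2) = F ((x ^ 2 : ZMod p).val) := by
    intro x
    rw [← per_val hF]
    push_cast
    simp
  simp only [h1]
  rw [← Finset.sum_fiberwise_of_maps_to (g := fun x : ZMod p => x ^ 2) (t := Finset.univ)
    (fun _ _ => Finset.mem_univ _)]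
  refine Finset.sum_congr rfl fun h _ => ?_
  rw [Finset.sum_congr rfl (g := fun _ => F (h.val : ℤ))
    (fun x hx => by rw [(Finset.mem_filter.1 hx).2]), Finset.sum_const, nsmul_eq_mul]
  congr 1
  have hc := legendreSym.card_sqrts p hp2 (h.val : ℤ)
  have hh : (((h.val : ℕ) : ℤ) : ZMod p) = h := by simp
  rw [hh, jacobiSym.legendreSym.to_jacobiSym] at hc
  have hcard : ({x | x ^ 2 = h} : Set (ZMod p)).toFinset =
      Finset.univ.filter fun x : ZMod p => x ^ 2 = h := by
    ext; simp
  rw [hcard] at hc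
  have hc' := congrArg (fun z : ℤ => (z : ℂ)) hc
  push_cast at hc'
  rw [hc']
  ring


/-- The quadratic Gauss sum. -/
def gs (d : ℤ) (c : ℕ) : ℂ := ∑ v ∈ Finset.range c, ec c (d * (v : ℤ) ^ 2)

lemma isPer_sq {c : ℕ} (hc : c ≠ 0) (d : ℤ) : IsPer c (fun v => ec c (d * v ^ 2)) := by
  rintro a b ⟨k, hk⟩
  exact ec_congr hc ⟨d * k * (a + b), by linear_combination d * (a + b) * hk⟩

lemma gs_prime_sq_mul {p : ℕ} (hp : p.Prime) (hp2 : p ≠ 2) {d : ℤ} (hd : ¬(p : ℤ) ∣ d) {c : ℕ}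
    (hc : c ≠ 0) : gs d (p * (p * c)) = p * gs d c := by
  have hp0 : p ≠ 0 := hp.ne_zero
  have hpp : Prime (p : ℤ) := Nat.prime_iff_prime_int.1 hp
  have h1 : ∀ a b : ℕ, ec (p * (p * c)) (d * ((a : ℤ) + (p * c : ℕ) * b) ^ 2) =
      ec (p * (p * c)) (d * (a : ℤ) ^ 2) * ec p ((2 * d * a) * b) := by
    intro a b
    have e : d * ((a : ℤ) + (p * c : ℕ) * b) ^ 2 =
        d * (a : ℤ) ^ 2 + ((p * c : ℕ) * (2 * d * a * b) + (p * (p * c) : ℕ) * (d * c * b ^ 2)) := by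
      push_cast; ring
    rw [e, ec_add, ec_add, ec_mul_left (by positivity), mul_one, mul_comm p (p * c),
      ec_mul_mul (by positivity)]
  have h2 : ∀ a : ℕ, (p : ℤ) ∣ 2 * d * a ↔ (p : ℤ) ∣ (a : ℤ) := by
    intro a
    rw [mul_assoc, hpp.dvd_mul, hpp.dvd_mul]
    have : ¬(p : ℤ) ∣ 2 := by
      intro h
      have h' : p ∣ 2 := by exact_mod_cast h
      exact hp2 ((Nat.prime_dvd_prime_iff_eq hp Nat.prime_two).1 h')
    tauto
  rw [gs, mul_comm p (p * c), sum_range_mul_eq (p * c) p (fun v => ec (p * c * p) (d * v ^ 2)),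
    mul_comm (p * c) p]
  simp only [h1, ← Finset.mul_sum, sum_ec hp0, h2]
  rw [sum_range_mul_eq p c (fun a => ec (p * (p * c)) (d * a ^ 2) *
    if (p : ℤ) ∣ a then (p : ℂ) else 0), Finset.sum_eq_single 0]
  · rw [gs, Finset.mul_sum]
    refine Finset.sum_congr rfl fun b _ => ?_
    rw [Nat.cast_zero, zero_add, if_pos ⟨_, rfl⟩, mul_comm,
      show d * ((p : ℤ) * b) ^ 2 = p * (p * (d * b ^ 2)) by ring, ec_mul_mul hp0, ec_mul_mul hp0]
  · intro a ha ha0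
    refine Finset.sum_eq_zero fun b _ => ?_
    rw [if_neg, mul_zero]
    intro h
    have h3 : (p : ℤ) ∣ a := (dvd_add_left ⟨(b : ℤ), rfl⟩).1 h
    have h4 : p ∣ a := by exact_mod_cast h3
    have := Nat.le_of_dvd (by omega) h4
    have := Finset.mem_range.1 ha
    omega
  · intro h
    exact absurd (Finset.mem_range.2 hp.pos) h

lemma gs_mul {m n : ℕ} (hm : m ≠ 0) (hn : n ≠ 0) (hmn : m.Coprime n) (d : ℤ) :
    gs d (m * n) = gs (d * n) m * gs (d * m) n := by
  rw [gs, sum_crt hm hn hmn (isPer_sq (by positivity) d), gs, gs, Finset.sum_mul_sum]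
  refine Finset.sum_congr rfl fun a _ => Finset.sum_congr rfl fun b _ => ?_
  have e : d * ((a : ℤ) * n + b * m) ^ 2 =
      n * (d * n * a ^ 2) + (m * (d * m * b ^ 2) + (m * n : ℕ) * (2 * d * a * b)) := by
    push_cast; ring
  rw [e, ec_add, ec_add, ec_mul_left (by positivity), mul_one, ec_mul_mul hm, mul_comm m n,
    ec_mul_mul hn]

lemma sum_jacobi_ec_prime {p : ℕ} (hp : p.Prime) {d : ℤ} (hd : ¬(p : ℤ) ∣ d) :
    ∑ h ∈ Finset.range p, (jacobiSym h p : ℂ) * ec p (d * h) =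
      jacobiSym d p * ∑ h ∈ Finset.range p, (jacobiSym h p : ℂ) * ec p h := by
  have hcop : IsCoprime d (p : ℤ) :=
    ((Nat.prime_iff_prime_int.1 hp).coprime_iff_not_dvd.2 hd).symm
  have hJ : IsPer p (fun h => (jacobiSym h p : ℂ) * ec p h) := by
    intro a b hab
    simp only
    rw [jacobiSym_congr hab, ec_congr hp.ne_zero hab]
  rw [← sum_affine hp.ne_zero hJ hcop 0, Finset.mul_sum]
  refine Finset.sum_congr rfl fun h _ => ?_
  have hsq : jacobiSym d p * jacobiSym d p = 1 := by
    rw [← sq]; exact jacobiSym.sq_one (Int.isCoprime_iff_gcd_eq_one.1 hcop)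
  have hsq' : (jacobiSym d p : ℂ) * jacobiSym d p = 1 := by exact_mod_cast hsq
  rw [add_zero, jacobiSym.mul_left]
  push_cast
  linear_combination (-(jacobiSym h p : ℂ) * ec p (d * h)) * hsq'

lemma gs_prime {p : ℕ} (hp : p.Prime) (hp2 : p ≠ 2) {d : ℤ} (hd : ¬(p : ℤ) ∣ d) :
    gs d p = jacobiSym d p * ∑ h ∈ Finset.range p, (jacobiSym h p : ℂ) * ec p h := by
  have hF : IsPer p (fun h => ec p (d * h)) := by
    rintro a b ⟨k, hk⟩
    exact ec_congr hp.ne_zero ⟨d * k, by linear_combination d * hk⟩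
  rw [gs, sum_sq_prime hp hp2 hF, ← sum_jacobi_ec_prime hp hd]
  simp only [add_mul, one_mul, Finset.sum_add_distrib, sum_ec hp.ne_zero, if_neg hd, zero_add]

lemma gs_one_prime {p : ℕ} (hp : p.Prime) (hp2 : p ≠ 2) :
    gs 1 p = ∑ h ∈ Finset.range p, (jacobiSym h p : ℂ) * ec p h := by
  rw [gs_prime hp hp2, jacobiSym.one_left, Int.cast_one, one_mul]
  exact fun h => hp.one_lt.ne' (by exact_mod_cast Int.eq_one_of_dvd_one (by positivity) h)

lemma not_dvd_of_isCoprime {p : ℕ} (hp : p.Prime) {d : ℤ} (h : IsCoprime d (p : ℤ)) :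
    ¬(p : ℤ) ∣ d := (Nat.prime_iff_prime_int.1 hp).coprime_iff_not_dvd.1 h.symm

lemma odd_prime_factor {c : ℕ} (hodd : Odd c) (h1 : c ≠ 1) :
    ∃ p c₁ : ℕ, p.Prime ∧ p ≠ 2 ∧ c = p * c₁ ∧ Odd c₁ ∧ c₁ < c := by
  obtain ⟨p, hp, c₁, rfl⟩ := Nat.exists_prime_and_dvd h1
  rw [Nat.odd_mul] at hodd
  refine ⟨p, c₁, hp, ?_, rfl, hodd.2, ?_⟩
  · rintro rfl; exact absurd hodd.1 (by decide)
  · have := hodd.2.pos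
    have := hp.two_le
    nlinarith

lemma gs_eq (c : ℕ) : Odd c → ∀ d : ℤ, IsCoprime d (c : ℤ) → gs d c = jacobiSym d c * gs 1 c := by
  induction c using Nat.strong_induction_on with
  | _ c ih =>
    intro hodd d hd
    by_cases h1 : c = 1
    · subst h1; simp [gs, ec, ee]
    obtain ⟨p, c₁, hp, hp2, rfl, hodd₁, hlt⟩ := odd_prime_factor hodd h1
    have : NeZero p := ⟨hp.ne_zero⟩
    have : NeZero c₁ := ⟨hodd₁.pos.ne'⟩
    rw [Nat.cast_mul] at hd
    have hdp := hd.of_mul_right_left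
    have hd1 := hd.of_mul_right_right
    have hone : IsCoprime (1 : ℤ) (p : ℤ) := isCoprime_one_left
    by_cases hpc : p ∣ c₁
    · obtain ⟨c₂, rfl⟩ := hpc
      have hodd₂ := (Nat.odd_mul.1 hodd₁).2
      have : NeZero c₂ := ⟨hodd₂.pos.ne'⟩
      rw [Nat.cast_mul] at hd1
      have hd2 := hd1.of_mul_right_right
      rw [gs_prime_sq_mul hp hp2 (not_dvd_of_isCoprime hp hdp) hodd₂.pos.ne',
        gs_prime_sq_mul hp hp2 (not_dvd_of_isCoprime hp hone) hodd₂.pos.ne',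
        ih c₂ (lt_of_le_of_lt (Nat.le_mul_of_pos_left _ hp.pos) hlt) hodd₂ d hd2,
        jacobiSym.mul_right, jacobiSym.mul_right]
      have hsq : jacobiSym d p * jacobiSym d p = 1 := by
        rw [← sq]; exact jacobiSym.sq_one (Int.isCoprime_iff_gcd_eq_one.1 hdp)
      have hsq' : (jacobiSym d p : ℂ) * jacobiSym d p = 1 := by exact_mod_cast hsq
      push_cast
      linear_combination (-(p : ℂ) * jacobiSym d c₂ * gs 1 c₂) * hsq'
    · have hcop : p.Coprime c₁ := hp.coprime_iff_not_dvd.2 hpc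
      have hpc1 : IsCoprime (p : ℤ) c₁ := Nat.isCoprime_iff_coprime.2 hcop
      rw [gs_mul hp.ne_zero hodd₁.pos.ne' hcop, gs_mul hp.ne_zero hodd₁.pos.ne' hcop,
        gs_prime hp hp2 (not_dvd_of_isCoprime hp (hdp.mul_left hpc1.symm)),
        gs_prime hp hp2 (not_dvd_of_isCoprime hp (hone.mul_left hpc1.symm)),
        ih c₁ hlt hodd₁ _ (hd1.mul_left hpc1), ih c₁ hlt hodd₁ _ (isCoprime_one_left.mul_left hpc1),
        jacobiSym.mul_left, jacobiSym.mul_left, jacobiSym.mul_left, jacobiSym.mul_left,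
        jacobiSym.mul_right, jacobiSym.one_left, jacobiSym.one_left]
      push_cast
      ring

lemma sum_jacobi_prime {p : ℕ} (hp : p.Prime) (hp2 : p ≠ 2) :
    ∑ h ∈ Finset.range p, (jacobiSym h p : ℂ) = 0 := by
  have h := sum_sq_prime hp hp2 (F := fun _ => 1) (fun _ _ _ => rfl)
  simp only [mul_one, Finset.sum_add_distrib] at h
  linear_combination -h

/-- Gauss sum of the Jacobi symbol to a squarefree modulus. -/
lemma sum_jacobi_ec (q : ℕ) : Odd q → Squarefree q → ∀ y : ℤ,
    ∑ h ∈ Finset.range q, (jacobiSym h q : ℂ) * ec q (h * y) = jacobiSym y q * gs 1 q := by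
  induction q using Nat.strong_induction_on with
  | _ q ih =>
    intro hodd hsf y
    by_cases h1 : q = 1
    · subst h1; simp [gs, ec, ee]
    obtain ⟨p, q₁, hp, hp2, rfl, hodd₁, hlt⟩ := odd_prime_factor hodd h1
    have : NeZero p := ⟨hp.ne_zero⟩
    have : NeZero q₁ := ⟨hodd₁.pos.ne'⟩
    have hcop : p.Coprime q₁ := Nat.coprime_of_squarefree_mul hsf
    have hpq : IsCoprime (p : ℤ) q₁ := Nat.isCoprime_iff_coprime.2 hcop
    have hprime : ∑ h ∈ Finset.range p, (jacobiSym h p : ℂ) * ec p (h * y) =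
        jacobiSym y p * gs 1 p := by
      simp only [mul_comm _ y]
      by_cases hy : (p : ℤ) ∣ y
      · have h0 : jacobiSym y p = 0 := by
          refine jacobiSym.eq_zero_iff_not_coprime.2 fun h => ?_
          exact not_dvd_of_isCoprime hp (Int.isCoprime_iff_gcd_eq_one.2 h) hy
        obtain ⟨k, rfl⟩ := hy
        simp only [mul_assoc, ec_mul_left hp.ne_zero, mul_one, sum_jacobi_prime hp hp2, h0,
          Int.cast_zero, zero_mul]
      · rw [sum_jacobi_ec_prime hp hy, gs_one_prime hp hp2]
    have hF : IsPer (p * q₁) (fun h => (jacobiSym h (p * q₁) : ℂ) * ec (p * q₁) (h * y)) := by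
      intro a b hab
      simp only
      rw [jacobiSym_congr hab, ec_congr (NeZero.ne _) (m := a * y) (n := b * y)]
      rw [← sub_mul]
      exact hab.mul_right y
    rw [sum_crt hp.ne_zero hodd₁.pos.ne' hcop hF]
    have hterm : ∀ a b : ℕ, (jacobiSym ((a : ℤ) * q₁ + b * p) (p * q₁) : ℂ) *
        ec (p * q₁) (((a : ℤ) * q₁ + b * p) * y) = (jacobiSym q₁ p * jacobiSym p q₁) *
          (((jacobiSym a p : ℂ) * ec p (a * y)) * ((jacobiSym b q₁ : ℂ) * ec q₁ (b * y))) := by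
      intro a b
      have e : ((a : ℤ) * q₁ + b * p) * y = q₁ * (a * y) + p * (b * y) := by ring
      rw [e, ec_add, ec_mul_mul hp.ne_zero, mul_comm p q₁, ec_mul_mul hodd₁.pos.ne',
        jacobiSym.mul_right, jacobiSym_congr (c := p) (b := (a : ℤ) * q₁) ⟨b, by ring⟩,
        jacobiSym_congr (c := q₁) (b := (b : ℤ) * p) ⟨a, by ring⟩, jacobiSym.mul_left,
        jacobiSym.mul_left]
      push_cast
      ring
    simp only [hterm]
    simp only [← Finset.mul_sum]
    rw [← Finset.sum_mul, hprime, ih q₁ hlt hodd₁ (hsf.squarefree_of_dvd ⟨p, mul_comm _ _⟩) y,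
      gs_mul hp.ne_zero hodd₁.pos.ne' hcop, one_mul, one_mul, gs_eq p (hp.odd_of_ne_two hp2) _
      hpq.symm, gs_eq q₁ hodd₁ _ hpq, jacobiSym.mul_right]
    push_cast
    ring

lemma summable_gauss_char {a : ℂ} (ha : 0 < a.re) (t : ℂ) :
    Summable fun n : ℤ => cexp (-π * a * (n : ℂ) ^ 2 + 2 * π * (I * t) * n) := by
  have h := (summable_jacobiTheta₂_term_iff t (I * a)).2 (by simpa using ha)
  refine h.congr fun n => ?_
  rw [jacobiTheta₂_term]
  congr 1
  linear_combination (π : ℂ) * n ^ 2 * a * I_sq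

lemma tendsto_gauss_char {ι : Type*} {l : Filter ι} {a : ι → ℂ} (ha : ∀ᶠ i in l, 0 < (a i).re)
    (hinv : Tendsto (fun i => (1 / a i).re) l atTop) {t : ℝ} (ht0 : 0 ≤ t) (ht1 : t < 1) :
    Tendsto (fun i => (a i) ^ (1 / 2 : ℂ) *
      ∑' n : ℤ, cexp (-π * a i * (n : ℂ) ^ 2 + 2 * π * (I * t) * n)) l
      (𝓝 (if t = 0 then 1 else 0)) := by
  have hnorm : ∀ i (n : ℤ), ‖cexp (-π / a i * ((n : ℂ) + I * (I * t)) ^ 2)‖ =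
      rexp (-(π * (n - t) ^ 2) * (1 / a i).re) := by
    intro i n
    rw [Complex.norm_exp]
    congr 1
    have : -π / a i * ((n : ℂ) + I * (I * t)) ^ 2 = ((-(π * (n - t) ^ 2) : ℝ) : ℂ) * (1 / a i) := by
      have : (n : ℂ) + I * (I * t) = n - t := by linear_combination (t : ℂ) * I_sq
      rw [this]; push_cast; ring
    rw [this, re_ofReal_mul]
  have key : Tendsto (fun i => ∑' n : ℤ, cexp (-π / a i * ((n : ℂ) + I * (I * t)) ^ 2)) l
      (𝓝 (∑' n : ℤ, if n = 0 ∧ t = 0 then 1 else 0)) := by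
    refine tendsto_tsum_of_dominated_convergence
      (bound := fun n : ℤ => rexp (-(π * (n - t) ^ 2))) ?_ ?_ ?_
    · have h := (summable_gauss_char (a := 1) (by simp) (-I * t)).norm.mul_left (rexp (-π * t ^ 2))
      refine h.congr fun n => ?_
      rw [Complex.norm_exp, ← Real.exp_add]
      congr 1
      have : -π * 1 * (n : ℂ) ^ 2 + 2 * π * (I * (-I * t)) * n =
          ((-π * n ^ 2 + 2 * π * t * n : ℝ) : ℂ) := by
        push_cast; linear_combination -(2 * π * t * n : ℂ) * I_sq
      rw [this, ofReal_re]; ring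
    · intro n
      by_cases h : n = 0 ∧ t = 0
      · rw [if_pos h]
        simp [h.1, h.2, tendsto_const_nhds]
      · rw [if_neg h, tendsto_zero_iff_norm_tendsto_zero]
        simp only [hnorm]
        refine Real.tendsto_exp_atBot.comp ?_
        refine hinv.const_mul_atTop_of_neg ?_
        have : (n : ℝ) - t ≠ 0 := by
          intro h0
          apply h
          have h1 : (n : ℝ) = t := by linarith
          have h2 : (0 : ℝ) ≤ n := by linarith
          have h3 : (n : ℝ) < 1 := by linarith
          have h2' : (0 : ℤ) ≤ n := by exact_mod_cast h2
          have h3' : n < 1 := by exact_mod_cast h3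
          have : n = 0 := by omega
          refine ⟨this, ?_⟩
          rw [← h1, this]; simp
        have := Real.pi_pos
        have : 0 < π * (n - t) ^ 2 := by positivity
        linarith
    · filter_upwards [hinv.eventually_ge_atTop 1] with i hi n
      rw [hnorm]
      apply Real.exp_le_exp.2
      have := Real.pi_pos
      have : 0 ≤ π * (n - t) ^ 2 := by positivity
      nlinarith
  have hlim : (∑' n : ℤ, if n = 0 ∧ t = 0 then (1 : ℂ) else 0) = if t = 0 then 1 else 0 := by
    rw [tsum_eq_single 0 (fun n hn => by simp [hn])]
    simp
  rw [hlim] at key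
  refine key.congr' ?_
  filter_upwards [ha] with i hi
  rw [Complex.tsum_exp_neg_quadratic hi (I * t)]
  symm
  rw [← mul_assoc (a i ^ (1 / 2 : ℂ)), mul_one_div_cancel, one_mul]
  have : a i ≠ 0 := by rintro h; simp [h] at hi
  rw [Ne, cpow_eq_zero_iff]
  tauto

lemma tendsto_gauss_per {ι : Type*} {l : Filter ι} {a : ι → ℂ} (ha : ∀ᶠ i in l, 0 < (a i).re)
    (hinv : Tendsto (fun i => (1 / a i).re) l atTop) {M : ℕ} (hM : M ≠ 0) {φ : ℤ → ℂ}
    (hφ : IsPer M φ) :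
    Tendsto (fun i => (a i) ^ (1 / 2 : ℂ) *
      ∑' n : ℤ, φ n * cexp (-π * a i * (n : ℂ) ^ 2)) l
      (𝓝 (1 / M * ∑ v ∈ Finset.range M, φ v)) := by
  have hMC : (M : ℂ) ≠ 0 := by exact_mod_cast hM
  have hM0 : (0 : ℝ) < M := by exact_mod_cast Nat.pos_of_ne_zero hM
  have hinvn : ∀ n : ℤ, φ n = ∑ j ∈ Finset.range M,
      (1 / M * ∑ v ∈ Finset.range M, φ v * ec M (-(j * v))) * ec M (j * n) := by
    intro n
    have h1 : ∀ v : ℕ, ∑ j ∈ Finset.range M, φ v * ec M (-(j * v)) * ec M (j * n) =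
        φ v * if (M : ℤ) ∣ n - v then (M : ℂ) else 0 := by
      intro v
      rw [← sum_ec hM, Finset.mul_sum]
      refine Finset.sum_congr rfl fun j _ => ?_
      rw [mul_assoc, ← ec_add]
      congr 2; ring
    simp only [mul_assoc, Finset.sum_mul, ← Finset.mul_sum]
    rw [Finset.sum_comm]
    simp only [← mul_assoc, h1]
    have h2 : ∀ v : ℕ, (φ v * if (M : ℤ) ∣ n - v then (M : ℂ) else 0) =
        φ n * if (M : ℤ) ∣ n - v then (M : ℂ) else 0 := by
      intro v
      by_cases h : (M : ℤ) ∣ n - v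
      · rw [hφ n v h]
      · simp [h]
    simp only [h2]
    rw [← Finset.mul_sum]
    have h3 : ∑ v ∈ Finset.range M, (if (M : ℤ) ∣ n - (v : ℤ) then (M : ℂ) else 0) = M := by
      have hp : IsPer M fun v : ℤ => if (M : ℤ) ∣ v then (M : ℂ) else 0 := by
        intro x y hxy
        have : (M : ℤ) ∣ x ↔ (M : ℤ) ∣ y := by
          constructor <;> intro h
          · simpa using dvd_sub h hxy
          · simpa using dvd_add hxy h
        simp [this]
      have := sum_affine hM hp (u := -1) (isCoprime_one_left.neg_left) n
      have h4 : ∀ v : ℕ, n - (v : ℤ) = -1 * v + n := fun v => by ring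
      simp only [h4]
      rw [this, Finset.sum_eq_single 0]
      · simp
      · intro b hb hb0
        rw [if_neg]
        intro h
        have := Int.le_of_dvd (by omega) h
        have := Finset.mem_range.1 hb
        omega
      · intro h; simp at h; omega
    rw [h3]; field_simp
  have hec : ∀ (j : ℕ) (n : ℤ) (x : ℂ), ec M (j * n) * cexp x =
      cexp (x + 2 * π * (I * ((j / M : ℝ) : ℂ)) * n) := by
    intro j n x
    rw [ec, ee, ← Complex.exp_add]
    congr 1; push_cast; ring
  have hlim := tendsto_finsetSum (Finset.range M) fun j hj =>
    (tendsto_gauss_char ha hinv (t := j / M) (by positivity)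
      (by rw [div_lt_one hM0]; exact_mod_cast Finset.mem_range.1 hj)).const_mul
      (1 / M * ∑ v ∈ Finset.range M, φ v * ec M (-(j * v)))
  have hval : ∑ j ∈ Finset.range M, (1 / M * ∑ v ∈ Finset.range M, φ v * ec M (-(j * v))) *
      (if (j / M : ℝ) = 0 then (1 : ℂ) else 0) = 1 / M * ∑ v ∈ Finset.range M, φ v := by
    rw [Finset.sum_eq_single 0]
    · simp [ec_zero]
    · intro b _ hb
      rw [if_neg, mul_zero]
      have : (b : ℝ) ≠ 0 := by exact_mod_cast hb
      positivity
    · intro h; simp at h; omega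
  rw [hval] at hlim
  refine hlim.congr' ?_
  filter_upwards [ha] with i hi
  have hs : ∀ n : ℤ, φ n * cexp (-π * a i * (n : ℂ) ^ 2) = ∑ j ∈ Finset.range M,
      (1 / M * ∑ v ∈ Finset.range M, φ v * ec M (-(j * v))) *
        cexp (-π * a i * (n : ℂ) ^ 2 + 2 * π * (I * ((j / M : ℝ) : ℂ)) * n) := by
    intro n
    conv_lhs => rw [hinvn n]
    rw [Finset.sum_mul]
    refine Finset.sum_congr rfl fun j _ => ?_
    rw [mul_assoc, hec]
  simp only [hs]
  rw [Summable.tsum_finsetSum]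
  · simp only [tsum_mul_left]
    rw [Finset.mul_sum]
    refine Finset.sum_congr rfl fun j _ => ?_
    ring
  · intro j _
    exact (summable_gauss_char hi _).mul_left _

lemma cpow_half_ofReal_mul {r : ℝ} (hr : 0 < r) {x : ℂ} (hx : x ≠ 0) :
    ((r : ℂ) * x) ^ (1 / 2 : ℂ) = (r : ℂ) ^ (1 / 2 : ℂ) * x ^ (1 / 2 : ℂ) := by
  have hrC : (r : ℂ) ≠ 0 := by exact_mod_cast hr.ne'
  rw [cpow_def_of_ne_zero (mul_ne_zero hrC hx), cpow_def_of_ne_zero hrC, cpow_def_of_ne_zero hx,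
    ← Complex.exp_add, log_ofReal_mul hr hx, ← add_mul, ofReal_log hr.le]

/-- The quadratic Gauss sum to an odd modulus. -/
lemma gs_one {c : ℕ} (hc : Odd c) : gs 1 c = epsFactor c * (√(c : ℝ) : ℝ) := by
  have hc0 : 0 < c := hc.pos
  have hcR : (0 : ℝ) < c := by exact_mod_cast hc0
  have hcC : (c : ℂ) ≠ 0 := by exact_mod_cast hc0.ne'
  let l : Filter ℝ := 𝓝[>] 0
  have hpos : ∀ᶠ ε : ℝ in l, 0 < ε := eventually_mem_nhdsWithin
  have hto : Tendsto (fun ε : ℝ => (ε : ℂ)) l (𝓝 0) := by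
    have : Tendsto (fun ε : ℝ => (ε : ℂ)) (𝓝 0) (𝓝 ((0 : ℝ) : ℂ)) :=
      Complex.continuous_ofReal.tendsto 0
    simpa using this.mono_left nhdsWithin_le_nhds
  have hinv0 : Tendsto (fun ε : ℝ => ε⁻¹) l atTop := tendsto_inv_nhdsGT_zero
  have h1 := tendsto_gauss_per (l := l) (a := fun ε : ℝ => (ε : ℂ)) (by simpa using hpos)
    (by
      refine hinv0.congr fun ε => ?_
      rw [one_div, ← ofReal_inv, ofReal_re]) hc0.ne' (isPer_sq hc0.ne' 1)
  let w : ℝ → ℂ := fun ε => (c ^ 2 / 4) / (1 + I * c * ε / 2)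
  let z : ℝ → ℂ := fun ε => ε - 2 * I / c
  have hw1 : ∀ ε : ℝ, (1 + I * c * ε / 2 : ℂ) ≠ 0 := by
    intro ε h
    have := congrArg Complex.re h
    simp at this
  have hwne : ∀ ε, w ε ≠ 0 := fun ε => div_ne_zero (div_ne_zero (pow_ne_zero _ hcC) (by norm_num)) (hw1 ε)
  have hwinv : ∀ ε : ℝ, 0 < ε → (1 / ((ε : ℂ) * w ε)) = ((4 / (c ^ 2 * ε) : ℝ) : ℂ) + (2 / c : ℝ) * I := by
    intro ε hε
    have hεC : (ε : ℂ) ≠ 0 := by exact_mod_cast hε.ne'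
    have := hw1 ε
    simp only [w]
    push_cast
    field_simp
    ring
  have hwre : ∀ ε : ℝ, 0 < ε → (1 / ((ε : ℂ) * w ε)).re = 4 / (c ^ 2 * ε) := by
    intro ε hε
    rw [hwinv ε hε, add_re, ofReal_re, re_ofReal_mul]; simp
  have hεwre : ∀ ε : ℝ, 0 < ε → 0 < ((ε : ℂ) * w ε).re := by
    intro ε hε
    have h2 := hwre ε hε
    rw [one_div, inv_re] at h2
    by_contra hcon
    have h3 : ((ε : ℂ) * w ε).re / normSq ((ε : ℂ) * w ε) ≤ 0 :=
      div_nonpos_of_nonpos_of_nonneg (not_lt.1 hcon) (normSq_nonneg _)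
    rw [h2] at h3
    have : 0 < 4 / ((c : ℝ) ^ 2 * ε) := by positivity
    linarith
  have hper2 : IsPer 2 fun n => ec 4 (-(c * n ^ 2)) := by
    rintro m n ⟨k, hk⟩
    apply ec_congr (by norm_num)
    have : m = n + 2 * k := by push_cast at hk; linarith
    subst this
    exact ⟨-(c * (n * k + k ^ 2)), by push_cast; ring⟩
  have h2 := tendsto_gauss_per (l := l) (a := fun ε : ℝ => (ε : ℂ) * w ε)
    (hpos.mono hεwre)
    (by
      have : Tendsto (fun ε : ℝ => 4 / (c : ℝ) ^ 2 * ε⁻¹) l atTop :=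
        hinv0.const_mul_atTop (by positivity)
      refine this.congr' ?_
      filter_upwards [hpos] with ε hε
      rw [hwre ε hε]; field_simp) (by norm_num) hper2
  have hwlim : Tendsto w l (𝓝 (c ^ 2 / 4)) := by
    have : Tendsto w l (𝓝 ((c ^ 2 / 4) / (1 + I * c * 0 / 2))) :=
      tendsto_const_nhds.div (((hto.const_mul (I * c)).div_const 2).const_add 1) (by simp)
    simpa using this
  have hzlim : Tendsto z l (𝓝 (-(2 * I / c))) := by
    have : Tendsto z l (𝓝 (0 - 2 * I / c)) := hto.sub_const _
    simpa using this
  have hz0 : -(2 * I / (c : ℂ)) ∈ slitPlane := by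
    right
    have : -(2 * I / (c : ℂ)) = ((-2 / c : ℝ) : ℂ) * I := by push_cast; ring
    rw [this, im_ofReal_mul]
    simp [hc0.ne']
  have hw0 : (c ^ 2 / 4 : ℂ) ∈ slitPlane := by
    left
    have : (c ^ 2 / 4 : ℂ) = ((c ^ 2 / 4 : ℝ) : ℂ) := by push_cast; ring
    rw [this, ofReal_re]; positivity
  have hzp := hzlim.cpow (tendsto_const_nhds (x := (1 / 2 : ℂ))) hz0
  have hwp := hwlim.cpow (tendsto_const_nhds (x := (1 / 2 : ℂ))) hw0
  have hsc : (0 : ℝ) < √(c : ℝ) := Real.sqrt_pos.2 hcR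
  have hscC : ((√(c : ℝ) : ℝ) : ℂ) ≠ 0 := by exact_mod_cast hsc.ne'
  have hsc2 : ((√(c : ℝ) : ℝ) : ℂ) ^ 2 = c := by
    rw [← ofReal_pow, Real.sq_sqrt hcR.le]; simp
  have hzv : (-(2 * I / (c : ℂ))) ^ (1 / 2 : ℂ) = (1 - I) / (√(c : ℝ) : ℝ) := by
    have : -(2 * I / (c : ℂ)) = ((1 - I) / (√(c : ℝ) : ℝ)) ^ 2 := by
      rw [div_pow, hsc2, ← neg_div]
      congr 1
      linear_combination -I_sq
    rw [this, one_div, sq_cpow_two_inv]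
    have : (1 - I) / ((√(c : ℝ) : ℝ) : ℂ) = ((1 / √(c : ℝ) : ℝ) : ℂ) * (1 - I) := by
      push_cast; ring
    rw [this, re_ofReal_mul]
    simp [hc0]
  have hwv : (c ^ 2 / 4 : ℂ) ^ (1 / 2 : ℂ) = c / 2 := by
    have : (c ^ 2 / 4 : ℂ) = (c / 2) ^ 2 := by ring
    rw [this, one_div, sq_cpow_two_inv]
    have : (c / 2 : ℂ) = ((c / 2 : ℝ) : ℂ) := by push_cast; ring
    rw [this, ofReal_re]; positivity
  rw [hzv] at hzp
  rw [hwv] at hwp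
  have hrel : ∀ ε : ℝ, 0 < ε →
      (ε : ℂ) ^ (1 / 2 : ℂ) * ∑' n : ℤ, ec c (1 * n ^ 2) * cexp (-π * (ε : ℂ) * (n : ℂ) ^ 2) =
      ((ε : ℂ) * w ε) ^ (1 / 2 : ℂ) *
        (∑' n : ℤ, ec 4 (-(c * n ^ 2)) * cexp (-π * ((ε : ℂ) * w ε) * (n : ℂ) ^ 2)) /
        (z ε ^ (1 / 2 : ℂ) * w ε ^ (1 / 2 : ℂ)) := by
    intro ε hε
    have hzre : 0 < (z ε).re := by
      have : z ε = ((ε : ℝ) : ℂ) + ((-2 / c : ℝ) : ℂ) * I := by simp only [z]; push_cast; ring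
      rw [this, add_re, re_ofReal_mul]; simpa using hε
    have hzne : z ε ≠ 0 := by intro h; simp [h] at hzre
    have e1 : ∀ n : ℤ, ec c (1 * n ^ 2) * cexp (-π * (ε : ℂ) * (n : ℂ) ^ 2) =
        cexp (-π * z ε * (n : ℂ) ^ 2) := by
      intro n
      rw [ec, ee, ← Complex.exp_add]
      congr 1
      simp only [z]; push_cast; ring
    have hzi : 1 / z ε = I * c / 2 + ε * w ε := by
      have h0 : (2 + I * c * ε : ℂ) ≠ 0 := by
        have := hw1 ε
        contrapose! this
        linear_combination this / 2
      have hwe : w ε = c ^ 2 / 2 / (2 + I * c * ε) := by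
        simp only [w]
        rw [div_eq_div_iff (hw1 ε) h0]
        ring
      rw [div_eq_iff hzne, hwe]
      simp only [z]
      field_simp
      linear_combination (4 + 2 * I * c * ε - c ^ 2 * ε ^ 2 : ℂ) * I_sq
    have e2 : ∀ n : ℤ, ec 4 (-(c * n ^ 2)) * cexp (-π * ((ε : ℂ) * w ε) * (n : ℂ) ^ 2) =
        cexp (-π / z ε * (n : ℂ) ^ 2) := by
      intro n
      rw [ec, ee, ← Complex.exp_add]
      congr 1
      have : -π / z ε * (n : ℂ) ^ 2 = -π * (1 / z ε) * (n : ℂ) ^ 2 := by ring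
      rw [this, hzi]; push_cast; ring
    simp only [e1, e2]
    rw [Complex.tsum_exp_neg_mul_int_sq hzre, cpow_half_ofReal_mul hε (hwne ε)]
    have p1 : z ε ^ (1 / 2 : ℂ) ≠ 0 := by rw [Ne, cpow_eq_zero_iff]; tauto
    have p2 : w ε ^ (1 / 2 : ℂ) ≠ 0 := by
      rw [Ne, cpow_eq_zero_iff]
      have := hwne ε
      tauto
    field_simp
  have hne2 : (1 - I) / ((√(c : ℝ) : ℝ) : ℂ) * (c / 2) ≠ 0 := by
    have : (1 - I : ℂ) ≠ 0 := by
      intro h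
      have := congrArg Complex.re h
      simp at this
    exact mul_ne_zero (div_ne_zero this hscC) (div_ne_zero hcC (by norm_num))
  have h3 := h2.div (hzp.mul hwp) hne2
  have h4 := tendsto_nhds_unique (h1.congr' (hpos.mono hrel)) h3
  have h5 : (1 / (c : ℂ) * gs 1 c) = _ := h4
  have hr2 : ∑ v ∈ Finset.range 2, ec 4 (-((c : ℤ) * (v : ℤ) ^ 2)) = 1 + ec 4 (-c) := by
    simp [Finset.sum_range_succ, ec_zero]
  rw [hr2] at h5
  have hI : ec 4 (-1) = -I := by
    rw [ec, ee]
    have : 2 * π * I * (((-1 : ℤ) : ℂ) / (4 : ℕ)) = -(π / 2 * I) := by push_cast; ring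
    rw [this, Complex.exp_neg, Complex.exp_pi_div_two_mul_I, inv_I]
  have hm : ∀ k : ℕ, ec 4 (-((4 * k : ℕ) : ℤ)) = 1 := by
    intro k
    rw [ec_eq_one_iff (by norm_num)]
    exact ⟨-k, by push_cast; ring⟩
  have h1I : (1 - I : ℂ) ≠ 0 := by
    intro h
    have := congrArg Complex.re h
    simp at this
  have h6 : gs 1 c = (√(c : ℝ) : ℝ) * ((1 + ec 4 (-c)) / (1 - I)) := by
    have : gs 1 c = c * (1 / (c : ℂ) * gs 1 c) := by field_simp
    rw [this, h5]
    field_simp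
    push_cast
    ring
  rw [h6, mul_comm]
  congr 1
  rw [epsFactor, div_eq_iff h1I]
  obtain ⟨k, hk⟩ := hc
  rcases Nat.even_or_odd' k with ⟨j, hj | hj⟩
  · have : (-(c : ℤ)) = -((4 * j : ℕ) : ℤ) + -1 := by push_cast; omega
    rw [this, ec_add, hm, hI, if_pos (by omega)]; ring
  · have : (-(c : ℤ)) = -((4 * j : ℕ) : ℤ) + (-1 + (-1 + -1)) := by push_cast; omega
    rw [this, ec_add, ec_add, ec_add, hm, hI, if_neg (by omega)]
    linear_combination (1 - I) * I_sq

/-- The normalised Kloosterman sum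
`c⁻¹ ∑_{4 a d ≡ 1 (mod c)} (∑_v e(a v² / c)) e((m a + n d) / c)`. -/
def kl (m n : ℤ) (c : ℕ) : ℂ :=
  1 / c * ∑ a ∈ Finset.range c, ∑ d ∈ Finset.range c,
    if (c : ℤ) ∣ 4 * a * d - 1 then gs a c * ec c (m * a + n * d) else 0

lemma sum_range_two_mul_even {f : ℕ → ℂ} (hf : ∀ d, d % 2 ≠ 0 → f d = 0) (c : ℕ) :
    ∑ d ∈ Finset.range (2 * c), f d = ∑ d ∈ Finset.range c, f (2 * d) := by
  induction c with
  | zero => simp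
  | succ c ih =>
    rw [mul_add, mul_one, Finset.sum_range_succ, Finset.sum_range_succ, ih,
      Finset.sum_range_succ, hf (2 * c + 1) (by omega), add_zero]

lemma isCoprime_of_dvd_mul_sub_one {c : ℤ} {a b : ℤ} (h : c ∣ a * b - 1) : IsCoprime a c := by
  obtain ⟨k, hk⟩ := h
  exact ⟨b, -k, by linarith⟩

lemma gs_eq_of_coprime {c : ℕ} (hc : Odd c) {a : ℤ} (h : IsCoprime a (c : ℤ)) :
    gs a c = jacobiSym a c * (epsFactor c * (√(c : ℝ) : ℝ)) := by
  rw [gs_eq c hc a h, gs_one hc]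

lemma SKo_eq_kl {c : ℕ} (hc : Odd c) (m n : ℤ) :
    SKo m n c 3 / ((√(c : ℝ) : ℝ) : ℂ) = ee (3 / 8) * kl m n c := by
  have hc0 : 0 < c := hc.pos
  have hcR : (0 : ℝ) < c := by exact_mod_cast hc0
  have hcC : (c : ℂ) ≠ 0 := by exact_mod_cast hc0.ne'
  have hscC : ((√(c : ℝ) : ℝ) : ℂ) ≠ 0 := by exact_mod_cast (Real.sqrt_pos.2 hcR).ne'
  have hsc2 : ((√(c : ℝ) : ℝ) : ℂ) * ((√(c : ℝ) : ℝ) : ℂ) = c := by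
    rw [← ofReal_mul, Real.mul_self_sqrt hcR.le]; simp
  have heps : (epsFactor c)⁻¹ ^ 3 = epsFactor c := by
    unfold epsFactor
    split_ifs
    · simp
    · rw [inv_I]; linear_combination (-I) * I_sq
  rw [SKo, heps, sum_range_two_mul_even]
  swap
  · intro d hd
    refine Finset.sum_eq_zero fun a _ => ?_
    rw [if_neg (by tauto)]
  have h1 : ∀ d : ℕ, (∑ a ∈ Finset.range (2 * c),
      if 2 * d % 2 = 0 ∧ a % 2 = 0 ∧ (a * (2 * d)) % c = 1 % c then
        ((jacobiSym (2 * ((2 * d : ℕ) : ℤ)) c : ℤ) : ℂ) ^ 3 *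
          ee (((m * a + n * (2 * d : ℕ) : ℤ) : ℂ) / (2 * (c : ℕ))) else 0) =
      ∑ a ∈ Finset.range c, if (c : ℤ) ∣ 4 * a * d - 1 then
        (jacobiSym a c : ℂ) * ec c (m * a + n * d) else 0 := by
    intro d
    rw [sum_range_two_mul_even]
    swap
    · intro a ha
      rw [if_neg (by tauto)]
    refine Finset.sum_congr rfl fun a _ => ?_
    have hiff : (2 * d % 2 = 0 ∧ 2 * a % 2 = 0 ∧ (2 * a * (2 * d)) % c = 1 % c) ↔
        (c : ℤ) ∣ 4 * a * d - 1 := by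
      have : (2 * a * (2 * d)) % c = 1 % c ↔ (c : ℤ) ∣ 4 * a * d - 1 := by
        rw [show (2 * a * (2 * d)) % c = 1 % c ↔ 1 ≡ 2 * a * (2 * d) [MOD c] from eq_comm,
          Nat.modEq_iff_dvd]
        push_cast
        rw [show (2 * (a : ℤ) * (2 * d) - 1) = 4 * a * d - 1 by ring]
      rw [this]
      constructor
      · tauto
      · intro h; exact ⟨by omega, by omega, h⟩
    simp only [hiff]
    split_ifs with h
    · have hJ : jacobiSym (2 * ((2 * d : ℕ) : ℤ)) c = jacobiSym a c := by
        have hmul : jacobiSym (2 * ((2 * d : ℕ) : ℤ)) c * jacobiSym a c = 1 := by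
          rw [← jacobiSym.mul_left, jacobiSym_congr (b := 1), jacobiSym.one_left]
          push_cast
          rw [show 2 * (2 * (d : ℤ)) * a - 1 = 4 * a * d - 1 by ring]
          exact h
        rcases Int.eq_one_or_neg_one_of_mul_eq_one' hmul with h | h <;> rw [h.1, h.2]
      have hcub : (jacobiSym a c : ℂ) ^ 3 = jacobiSym a c := by
        rcases jacobiSym.trichotomy a c with h | h | h <;> rw [h] <;> norm_num
      rw [hJ, hcub, ec]
      congr 2
      push_cast
      field_simp
    · rfl
  simp only [h1]
  rw [kl, Finset.sum_comm]
  have h2 : ∀ a d : ℕ, (if (c : ℤ) ∣ 4 * a * d - 1 then gs a c * ec c (m * a + n * d) else 0) =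
      (epsFactor c * (√(c : ℝ) : ℝ)) * if (c : ℤ) ∣ 4 * a * d - 1 then
        (jacobiSym a c : ℂ) * ec c (m * a + n * d) else 0 := by
    intro a d
    split_ifs with h
    · have hco : IsCoprime (a : ℤ) c :=
        isCoprime_of_dvd_mul_sub_one (b := 4 * d) (by rwa [show (a : ℤ) * (4 * d) = 4 * a * d by ring])
      rw [gs_eq_of_coprime hc hco]; ring
    · simp
  simp only [h2, ← Finset.mul_sum]
  rw [div_eq_iff hscC]
  rw [show (((3 : ℕ) : ℂ) / 8) = 3 / 8 by norm_num]
  field_simp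
  linear_combination (-ee (3 / 8) * epsFactor c * ∑ x ∈ Finset.range c, ∑ i ∈ Finset.range c,
    if (c : ℤ) ∣ 4 * x * i - 1 then (jacobiSym x c : ℂ) * ec c (m * x + n * i) else 0) * hsc2

/-- Completing the square in a quadratic exponential sum. -/
lemma sum_quad {q c₂ : ℕ} (hq : Odd q) (hc₂ : c₂ ≠ 0) {a n₁ ν : ℤ}
    (ha : IsCoprime a ((q * c₂ : ℕ) : ℤ)) (hν : (c₂ : ℤ) ∣ ν * n₁ - 1) (x : ℤ) :
    ∑ s ∈ Finset.range (q * c₂), ec (q * c₂) (a * (q * n₁ * (s : ℤ) ^ 2 - 2 * x * s)) =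
      if (q : ℤ) ∣ x then q * (gs (a * n₁) c₂ * ec c₂ (-(a * ν * (x / q) ^ 2))) else 0 := by
  have hq0 : q ≠ 0 := hq.pos.ne'
  have hqc : q * c₂ ≠ 0 := mul_ne_zero hq0 hc₂
  have hco : IsCoprime a (q : ℤ) := by
    push_cast at ha; exact ha.of_mul_right_left
  have h2q : IsCoprime (2 : ℤ) (q : ℤ) := by
    rw [← Nat.cast_ofNat, Nat.isCoprime_iff_coprime]
    exact (Nat.coprime_two_left).2 hq
  have hin : ∀ t b : ℤ, ec (c₂ * q) (a * (q * n₁ * (t + c₂ * b) ^ 2 - 2 * x * (t + c₂ * b))) =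
      ec (c₂ * q) (a * (q * n₁ * t ^ 2 - 2 * x * t)) * ec q (-(2 * a * x) * b) := by
    intro t b
    rw [← ec_mul_mul hc₂ q (-(2 * a * x) * b), ← ec_add]
    apply ec_congr (mul_ne_zero hc₂ hq0)
    exact ⟨a * n₁ * (2 * t * b + c₂ * b ^ 2), by push_cast; ring⟩
  rw [mul_comm q c₂, sum_range_mul_eq c₂ q
    (fun s => ec (c₂ * q) (a * (q * n₁ * s ^ 2 - 2 * x * s)))]
  simp only [hin, ← Finset.mul_sum, sum_ec hq0]
  have hdvd : (q : ℤ) ∣ -(2 * a * x) ↔ (q : ℤ) ∣ x := by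
    rw [dvd_neg]
    constructor
    · intro h; exact (h2q.mul_left hco).symm.dvd_of_dvd_mul_left h
    · intro h; exact h.mul_left _
  simp only [hdvd]
  split_ifs with h
  · obtain ⟨x₁, rfl⟩ := h
    have hqZ : (q : ℤ) ≠ 0 := by exact_mod_cast hq0
    rw [Int.mul_ediv_cancel_left _ hqZ, ← Finset.sum_mul, mul_comm]
    congr 1
    have hsh := sum_affine hc₂ (isPer_sq hc₂ (a * n₁)) (u := 1) isCoprime_one_left (-(ν * x₁))
    simp only [one_mul] at hsh
    rw [gs, ← hsh, Finset.sum_mul]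
    refine Finset.sum_congr rfl fun s _ => ?_
    rw [← ec_add, ← ec_mul_mul hq0 c₂, mul_comm q c₂]
    apply ec_congr (mul_ne_zero hc₂ hq0)
    obtain ⟨k, hk⟩ := hν
    refine ⟨a * k * (2 * x₁ * s - ν * x₁ ^ 2), ?_⟩
    push_cast
    linear_combination (a * q * (2 * x₁ * s - ν * x₁ ^ 2)) * hk
  · simp

lemma sum_if_dvd_sub_one {c : ℕ} (hc : Odd c) (a : ℤ) :
    ∑ d ∈ Finset.range c, (if (c : ℤ) ∣ 4 * a * d - 1 then (1 : ℂ) else 0) =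
      if IsCoprime a (c : ℤ) then 1 else 0 := by
  have hc0 : c ≠ 0 := hc.pos.ne'
  have hp : IsPer c fun v : ℤ => if (c : ℤ) ∣ v then (1 : ℂ) else 0 := by
    intro x y hxy
    have : (c : ℤ) ∣ x ↔ (c : ℤ) ∣ y := by
      constructor <;> intro h
      · simpa using dvd_sub h hxy
      · simpa using dvd_add hxy h
    simp [this]
  have h0 : ∑ v ∈ Finset.range c, (if (c : ℤ) ∣ (v : ℤ) then (1 : ℂ) else 0) = 1 := by
    rw [Finset.sum_eq_single 0]
    · simp
    · intro b hb hb0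
      rw [if_neg]
      intro h
      have := Int.le_of_dvd (by omega) h
      have := Finset.mem_range.1 hb
      omega
    · intro h; simp at h; omega
  split_ifs with h
  · have h4 : IsCoprime (4 : ℤ) (c : ℤ) := by
      rw [show (4 : ℤ) = 2 ^ 2 by norm_num]
      apply IsCoprime.pow_left
      rw [← Nat.cast_ofNat, Nat.isCoprime_iff_coprime]
      exact (Nat.coprime_two_left).2 hc
    have := sum_affine hc0 hp (h4.mul_left h) (-1)
    rw [h0] at this
    exact this
  · refine Finset.sum_eq_zero fun d _ => if_neg fun hd => h ?_
    exact isCoprime_of_dvd_mul_sub_one (b := 4 * d) (by rwa [show a * (4 * d) = 4 * a * d by ring])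

lemma isPer_quad {c : ℕ} (hc : c ≠ 0) (A B C : ℤ) :
    IsPer c (fun v => ec c (A * v ^ 2 + B * v + C)) := by
  rintro m n ⟨k, hk⟩
  apply ec_congr hc
  exact ⟨(A * (m + n) + B) * k, by linear_combination (A * (m + n) + B) * hk⟩

/-- Finite Fourier transform of `i ↦ kl m (n₀ i²) c`. -/
lemma sum_ec_mul_kl {q c₂ : ℕ} (hq : Odd q) (hc₂ : Odd c₂) {n₁ ν : ℤ}
    (hν : (c₂ : ℤ) ∣ ν * n₁ - 1) (m x : ℤ) :
    ∑ i ∈ Finset.range (q * c₂), ec (q * c₂) (-(i * x)) * kl m (q * n₁ * (i : ℤ) ^ 2) (q * c₂) =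
      if (q : ℤ) ∣ x then ((√(q : ℝ) : ℝ) : ℂ) * (epsFactor (q * c₂) * epsFactor c₂ *
        jacobiSym n₁ c₂) * ∑ a ∈ Finset.range (q * c₂),
          (if IsCoprime (a : ℤ) ((q * c₂ : ℕ) : ℤ) then
            (jacobiSym a q : ℂ) * ec (q * c₂) (a * (m - q * ν * (x / q) ^ 2)) else 0) else 0 := by
  have hq0 : q ≠ 0 := hq.pos.ne'
  have hc0 : c₂ ≠ 0 := hc₂.pos.ne'
  have hcodd : Odd (q * c₂) := hq.mul hc₂
  set c := q * c₂ with hc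
  have hcne : c ≠ 0 := mul_ne_zero hq0 hc0
  have h2c : IsCoprime (2 : ℤ) (c : ℤ) := by
    rw [← Nat.cast_ofNat, Nat.isCoprime_iff_coprime]
    exact (Nat.coprime_two_left).2 hcodd
  have key : ∀ a d : ℕ, (c : ℤ) ∣ 4 * a * d - 1 →
      ∑ i ∈ Finset.range c, ec c (-(i * x)) * (gs a c * ec c (m * a + q * n₁ * (i : ℤ) ^ 2 * d)) =
      gs a c * ec c (m * a) * if (q : ℤ) ∣ x then
        q * (gs (a * n₁) c₂ * ec c₂ (-(a * ν * (x / q) ^ 2))) else 0 := by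
    intro a d had
    have hco : IsCoprime (a : ℤ) c :=
      isCoprime_of_dvd_mul_sub_one (b := 4 * d) (by rwa [show (a : ℤ) * (4 * d) = 4 * a * d by ring])
    rw [← sum_quad hq hc0 hco hν x, ← hc, Finset.mul_sum]
    have e1 : ∀ i : ℤ, ec c (-(i * x)) * (gs a c * ec c (m * a + q * n₁ * i ^ 2 * d)) =
        gs a c * ec c (m * a) * ec c (q * n₁ * d * i ^ 2 + -x * i + 0) := by
      intro i
      rw [ec_add c (m * a), show q * n₁ * d * i ^ 2 + -x * i + 0 = -(i * x) + q * n₁ * i ^ 2 * d by ring,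
        ec_add c (-(i * x))]
      ring
    simp only [e1, ← Finset.mul_sum]
    congr 1
    rw [← sum_affine hcne (isPer_quad hcne (q * n₁ * d) (-x) 0) (h2c.mul_left hco) 0]
    refine Finset.sum_congr rfl fun s _ => ec_congr hcne ?_
    obtain ⟨k, hk⟩ := had
    refine ⟨k * (a * q * n₁ * s ^ 2), ?_⟩
    linear_combination (a * q * n₁ * s ^ 2) * hk
  have e2 : ∀ i : ℕ, ec c (-(i * x)) * kl m (q * n₁ * (i : ℤ) ^ 2) c =
      1 / c * ∑ a ∈ Finset.range c, ∑ d ∈ Finset.range c, if (c : ℤ) ∣ 4 * a * d - 1 then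
        ec c (-(i * x)) * (gs a c * ec c (m * a + q * n₁ * (i : ℤ) ^ 2 * d)) else 0 := by
    intro i
    rw [kl, mul_left_comm, Finset.mul_sum]
    simp only [Finset.mul_sum, mul_ite, mul_zero]
  simp only [e2]
  rw [← Finset.mul_sum, Finset.sum_comm]
  have e3 : ∀ a ∈ Finset.range c, ∑ i ∈ Finset.range c, ∑ d ∈ Finset.range c,
      (if (c : ℤ) ∣ 4 * a * d - 1 then
        ec c (-(i * x)) * (gs a c * ec c (m * a + q * n₁ * (i : ℤ) ^ 2 * d)) else 0) =
      (gs a c * ec c (m * a) * if (q : ℤ) ∣ x then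
        q * (gs (a * n₁) c₂ * ec c₂ (-(a * ν * (x / q) ^ 2))) else 0) *
        if IsCoprime (a : ℤ) (c : ℤ) then 1 else 0 := by
    intro a _
    rw [Finset.sum_comm, ← sum_if_dvd_sub_one hcodd, Finset.mul_sum]
    refine Finset.sum_congr rfl fun d _ => ?_
    split_ifs with h h' h'
    · rw [key a d h, if_pos h', mul_one]
    · rw [key a d h, if_neg h', mul_one]
    · simp
    · simp
  rw [Finset.sum_congr rfl e3]
  split_ifs with hx
  · rw [Finset.mul_sum, Finset.mul_sum]
    refine Finset.sum_congr rfl fun a _ => ?_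
    split_ifs with hco
    · have hco2 : IsCoprime (a : ℤ) (c₂ : ℤ) := by
        rw [hc] at hco; push_cast at hco; exact hco.of_mul_right_right
      have hn1 : IsCoprime n₁ (c₂ : ℤ) :=
        isCoprime_of_dvd_mul_sub_one (b := ν) (by rwa [mul_comm])
      rw [gs_eq_of_coprime hcodd hco, gs_eq_of_coprime hc₂ (hco2.mul_left hn1)]
      have hJ : jacobiSym a c * jacobiSym (a * n₁) c₂ = jacobiSym a q * jacobiSym n₁ c₂ := by
        rw [hc, jacobiSym.mul_right' _ hq0 hc0, jacobiSym.mul_left]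
        have : jacobiSym a c₂ * jacobiSym a c₂ = 1 := by
          have := jacobiSym.sq_one (Int.isCoprime_iff_gcd_eq_one.1 hco2)
          rwa [sq] at this
        linear_combination (jacobiSym a q * jacobiSym n₁ c₂) * this
      have hJC : (jacobiSym a c : ℂ) * jacobiSym (a * n₁) c₂ = jacobiSym a q * jacobiSym n₁ c₂ := by
        exact_mod_cast hJ
      have hE : ec c (m * a) * ec c₂ (-(a * ν * (x / q) ^ 2)) =
          ec c (a * (m - q * ν * (x / q) ^ 2)) := by
        rw [← ec_mul_mul hq0 c₂, ← hc, ← ec_add]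
        congr 1; ring
      have hS : (1 / c : ℂ) * ((√(c : ℝ) : ℝ) * (√(c₂ : ℝ) : ℝ) * q) = (√(q : ℝ) : ℝ) := by
        have h1 : √(c : ℝ) = √(q : ℝ) * √(c₂ : ℝ) := by
          rw [hc]; push_cast; rw [Real.sqrt_mul (by positivity)]
        have h2 : √(c₂ : ℝ) * √(c₂ : ℝ) = c₂ := Real.mul_self_sqrt (by positivity)
        have h2' : ((√(c₂ : ℝ) : ℝ) : ℂ) * (√(c₂ : ℝ) : ℝ) = c₂ := by
          rw [← ofReal_mul, h2]; simp
        rw [h1, hc]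
        have hqC : (q : ℂ) ≠ 0 := by exact_mod_cast hq0
        have hcC : (c₂ : ℂ) ≠ 0 := by exact_mod_cast hc0
        push_cast
        field_simp
        linear_combination ((√(q : ℝ) : ℝ) : ℂ) * h2'
      rw [← hE, ← hS]
      linear_combination (1 / c * epsFactor c * (√(c : ℝ) : ℝ) * ec c (m * a) * q * epsFactor c₂ *
        (√(c₂ : ℝ) : ℝ) * ec c₂ (-(a * ν * (x / q) ^ 2)) : ℂ) * hJC
    · simp
  · simp

lemma sum_divisors_coprime {c : ℕ} (hc : c ≠ 0) (F : ℕ → ℂ) :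
    ∑ l ∈ c.divisors, ∑ a ∈ Finset.range (c / l),
      (if IsCoprime (a : ℤ) ((c / l : ℕ) : ℤ) then F (l * a) else 0) =
    ∑ h ∈ Finset.range c, F h := by
  rw [← Finset.sum_fiberwise_of_maps_to (s := Finset.range c) (t := c.divisors)
    (g := fun h => Nat.gcd h c) (fun h _ => Nat.mem_divisors.2 ⟨Nat.gcd_dvd_right h c, hc⟩)]
  refine Finset.sum_congr rfl fun l hl => ?_
  obtain ⟨k, rfl⟩ := (Nat.mem_divisors.1 hl).1
  have hl0 : 0 < l := Nat.pos_of_ne_zero (left_ne_zero_of_mul hc)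
  have hk0 : 0 < k := Nat.pos_of_ne_zero (right_ne_zero_of_mul hc)
  rw [Nat.mul_div_cancel_left _ hl0, ← Finset.sum_filter]
  refine Finset.sum_nbij (fun a => l * a) ?_ ?_ ?_ (fun _ _ => rfl)
  · intro a ha
    simp only [Finset.mem_filter, Finset.mem_range, Nat.isCoprime_iff_coprime] at ha ⊢
    refine ⟨Nat.mul_lt_mul_of_pos_left ha.1 hl0, ?_⟩
    rw [Nat.gcd_mul_left, ha.2.gcd_eq_one, mul_one]
  · intro a _ b _ h
    exact Nat.eq_of_mul_eq_mul_left hl0 h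
  · intro h hh
    simp only [Finset.coe_filter, Finset.mem_range, Set.mem_ofPred_eq] at hh
    have : l ∣ h := hh.2 ▸ Nat.gcd_dvd_left h (l * k)
    obtain ⟨a, rfl⟩ := this
    refine ⟨a, ?_, rfl⟩
    simp only [Finset.coe_filter, Finset.mem_range, Set.mem_ofPred_eq, Nat.isCoprime_iff_coprime]
    refine ⟨Nat.lt_of_mul_lt_mul_left hh.1, ?_⟩
    have h2 := hh.2
    rw [Nat.gcd_mul_left] at h2
    exact Nat.eq_of_mul_eq_mul_left hl0 (by rw [h2, mul_one])

lemma sum_jacobi_ec_mul {q c₂ : ℕ} (hq : Odd q) (hsq : Squarefree q) (hc₂ : c₂ ≠ 0) (Y : ℤ) :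
    ∑ h ∈ Finset.range (q * c₂), (jacobiSym h q : ℂ) * ec (q * c₂) (h * Y) =
      if (c₂ : ℤ) ∣ Y then c₂ * (jacobiSym (Y / c₂) q * gs 1 q) else 0 := by
  have hq0 : q ≠ 0 := hq.pos.ne'
  rw [sum_range_mul_eq q c₂ (fun h => (jacobiSym h q : ℂ) * ec (q * c₂) (h * Y))]
  have h1 : ∀ a b : ℕ, (jacobiSym ((a : ℤ) + q * b) q : ℂ) * ec (q * c₂) (((a : ℤ) + q * b) * Y) =
      (jacobiSym a q : ℂ) * ec (q * c₂) (a * Y) * ec c₂ (Y * b) := by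
    intro a b
    rw [jacobiSym_congr (b := (a : ℤ)) (by simp), ← ec_mul_mul hq0 c₂ (Y * b), mul_assoc, ← ec_add]
    congr 2; ring
  simp only [h1, ← Finset.mul_sum, sum_ec hc₂]
  split_ifs with h
  · obtain ⟨y, rfl⟩ := h
    rw [Int.mul_ediv_cancel_left _ (by exact_mod_cast hc₂), ← sum_jacobi_ec q hq hsq, Finset.mul_sum]
    refine Finset.sum_congr rfl fun a _ => ?_
    rw [mul_comm q c₂, mul_left_comm (a : ℤ), ec_mul_mul hc₂]
    ring
  · simp

lemma fourier_inversion {c : ℕ} (hc : c ≠ 0) {F : ℤ → ℂ} (hF : IsPer c F) (j : ℤ) :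
    ∑ x ∈ Finset.range c, ec c (j * x) * ∑ i ∈ Finset.range c, ec c (-(i * x)) * F i = c * F j := by
  have h1 : ∀ i : ℕ, ∑ x ∈ Finset.range c, ec c (j * x) * (ec c (-(i * x)) * F i) =
      F i * if (c : ℤ) ∣ j - i then (c : ℂ) else 0 := by
    intro i
    rw [← sum_ec hc, Finset.mul_sum]
    refine Finset.sum_congr rfl fun x _ => ?_
    rw [← mul_assoc, ← ec_add, mul_comm]
    congr 2; ring
  simp only [Finset.mul_sum]
  rw [Finset.sum_comm]
  simp only [h1]
  have hcZ : (0 : ℤ) < c := by exact_mod_cast Nat.pos_of_ne_zero hc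
  have hcast : (((j % c).toNat : ℕ) : ℤ) = j % c := Int.toNat_of_nonneg (Int.emod_nonneg _ hcZ.ne')
  rw [Finset.sum_eq_single (j % c).toNat]
  · rw [hcast, if_pos (Int.dvd_self_sub_emod), hF _ j, mul_comm]
    rw [← dvd_neg, neg_sub]; exact Int.dvd_self_sub_emod
  · intro b hb hne
    rw [if_neg, mul_zero]
    intro h
    apply hne
    have hb' := Finset.mem_range.1 hb
    have h2 : j % c = (b : ℤ) % c := Int.emod_eq_emod_iff_emod_sub_eq_zero.2 (Int.emod_eq_zero_of_dvd h)
    rw [h2, Int.emod_eq_of_lt (by omega) (by omega)]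
    simp
  · intro h
    exfalso; apply h
    rw [Finset.mem_range]
    have := Int.emod_lt_of_pos j hcZ
    omega

lemma neg_one_jacobi {l : ℕ} (hl : Odd l) : jacobiSym (-1) l = if l % 4 = 1 then 1 else -1 := by
  rw [jacobiSym.at_neg_one hl]
  split_ifs with h
  · exact ZMod.χ₄_nat_one_mod_four h
  · apply ZMod.χ₄_nat_three_mod_four
    obtain ⟨k, hk⟩ := hl
    omega

lemma eps_reciprocity {q l c : ℕ} (hq : Odd q) (hl : Odd l) (hc : Odd c) :
    (jacobiSym (-1) l : ℂ) * jacobiSym q l * (epsFactor (q * c) * epsFactor c) =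
      jacobiSym l q * (epsFactor (q * (l * c)) * epsFactor (l * c)) := by
  have hI : (I : ℂ) * I = -1 := I_mul_I
  have h3 : ∀ n : ℕ, Odd n → n % 4 = 1 ∨ n % 4 = 3 := by rintro n ⟨k, rfl⟩; omega
  have hqc := Nat.mul_mod q c 4
  have hlc := Nat.mul_mod l c 4
  have hqlc := Nat.mul_mod q (l * c) 4
  rw [hlc] at hqlc
  have hR := jacobiSym.quadratic_reciprocity_if (Nat.odd_iff.1 hq) (Nat.odd_iff.1 hl)
  rw [neg_one_jacobi hl, ← hR]
  rcases h3 q hq with h | h <;> rcases h3 l hl with h' | h' <;> rcases h3 c hc with h'' | h'' <;>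
    simp only [h, h', h''] at hqc hlc hqlc <;> norm_num at hqc hlc hqlc <;>
    simp [epsFactor, hqc, hlc, hqlc, h, h', h'']

lemma eps_mul_eps {q c : ℕ} (hq : Odd q) (hc : Odd c) :
    epsFactor (q * c) * epsFactor c * epsFactor q =
      jacobiSym (-1) q * ((if q % 4 = 1 then jacobiSym (-1) (q * c) else 1 : ℤ) : ℂ) := by
  have h3 : ∀ n : ℕ, Odd n → n % 4 = 1 ∨ n % 4 = 3 := by rintro n ⟨k, rfl⟩; omega
  have hqc := Nat.mul_mod q c 4
  rw [neg_one_jacobi hq, neg_one_jacobi (hq.mul hc)]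
  rcases h3 q hq with h | h <;> rcases h3 c hc with h'' | h'' <;>
    simp only [h, h''] at hqc <;> norm_num at hqc <;>
    simp [epsFactor, hqc, h, h'']

/-- The multiplier is independent of the divisor `l`, up to `(l / q)`. -/
lemma multiplier_mul {q l c₃ : ℕ} (hq : Odd q) (hl : Odd l) (hc : Odd c₃) {n₁ : ℤ}
    (hn : IsCoprime n₁ (l : ℤ)) :
    (jacobiSym (-(q * n₁)) l : ℂ) * (epsFactor (q * c₃) * epsFactor c₃ * jacobiSym n₁ c₃) =
      jacobiSym l q * (epsFactor (q * (l * c₃)) * epsFactor (l * c₃) * jacobiSym n₁ (l * c₃)) := by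
  have h1 := eps_reciprocity hq hl hc
  have h2 : jacobiSym (-(q * n₁)) l = jacobiSym (-1) l * jacobiSym q l * jacobiSym n₁ l := by
    rw [← jacobiSym.mul_left, ← jacobiSym.mul_left]; congr 1; ring
  have h3 : (jacobiSym n₁ l : ℂ) * jacobiSym n₁ l = 1 := by
    have := jacobiSym.sq_one (Int.isCoprime_iff_gcd_eq_one.1 hn)
    rw [sq] at this
    exact_mod_cast this
  rw [h2, jacobiSym.mul_right' _ hl.pos.ne' hc.pos.ne']
  push_cast
  linear_combination (jacobiSym n₁ l * jacobiSym n₁ c₃ : ℂ) * h1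

/-- The divisor sum of normalised Kloosterman sums attached to `n₀ j²`. -/
def klDiv (m : ℤ) (n₀ c : ℕ) (j : ℤ) : ℂ :=
  ∑ l ∈ c.divisors, if (l : ℤ) ∣ j then
    (jacobiSym (-n₀) l : ℂ) * kl m (n₀ * (j / l) ^ 2) (c / l) else 0

lemma kl_congr (m n₀ : ℤ) {c : ℕ} (hc : c ≠ 0) {i j : ℤ} (h : (c : ℤ) ∣ i - j) :
    kl m (n₀ * i ^ 2) c = kl m (n₀ * j ^ 2) c := by
  rw [kl, kl]
  congr 1
  refine Finset.sum_congr rfl fun a _ => Finset.sum_congr rfl fun d _ => ?_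
  split_ifs
  · congr 1
    obtain ⟨k, hk⟩ := h
    apply ec_congr hc
    exact ⟨n₀ * (i + j) * k * d, by linear_combination n₀ * (i + j) * d * hk⟩
  · rfl

lemma isPer_klDiv (m : ℤ) (n₀ : ℕ) {c : ℕ} (hc : c ≠ 0) : IsPer c (klDiv m n₀ c) := by
  intro i j h
  rw [klDiv, klDiv]
  refine Finset.sum_congr rfl fun l hl => ?_
  obtain ⟨k, rfl⟩ := (Nat.mem_divisors.1 hl).1
  have hl0 : l ≠ 0 := left_ne_zero_of_mul hc
  have hlZ : (l : ℤ) ≠ 0 := by exact_mod_cast hl0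
  have hk0 : k ≠ 0 := right_ne_zero_of_mul hc
  obtain ⟨t, ht⟩ := h
  push_cast at ht
  by_cases hj : (l : ℤ) ∣ j
  · obtain ⟨b, rfl⟩ := hj
    have hi : i = l * (b + k * t) := by linear_combination ht
    subst hi
    simp only [dvd_mul_right, if_true, Int.mul_ediv_cancel_left _ hlZ,
      Nat.mul_div_cancel_left _ (Nat.pos_of_ne_zero hl0)]
    rw [kl_congr m n₀ hk0 (i := b + k * t) (j := b) ⟨t, by ring⟩]
  · rw [if_neg hj, if_neg]
    rintro ⟨b, rfl⟩
    exact hj ⟨b - k * t, by linear_combination -ht⟩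

lemma sum_ec_mul_klDiv (m : ℤ) (n₀ : ℕ) {c : ℕ} (hc : c ≠ 0) (x : ℤ) :
    ∑ j ∈ Finset.range c, ec c (-(j * x)) * klDiv m n₀ c j =
      ∑ l ∈ c.divisors, (jacobiSym (-n₀) l : ℂ) * ∑ i ∈ Finset.range (c / l),
        ec (c / l) (-(i * x)) * kl m (n₀ * (i : ℤ) ^ 2) (c / l) := by
  simp only [klDiv, Finset.mul_sum]
  rw [Finset.sum_comm]
  refine Finset.sum_congr rfl fun l hl => ?_
  obtain ⟨k, rfl⟩ := (Nat.mem_divisors.1 hl).1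
  have hl0 : l ≠ 0 := left_ne_zero_of_mul hc
  have hlZ : (l : ℤ) ≠ 0 := by exact_mod_cast hl0
  rw [Nat.mul_div_cancel_left _ (Nat.pos_of_ne_zero hl0)]
  rw [sum_range_mul_eq l k (fun j => ec (l * k) (-(j * x)) *
    if (l : ℤ) ∣ j then (jacobiSym (-n₀) l : ℂ) * kl m (n₀ * (j / l) ^ 2) k else 0)]
  rw [Finset.sum_eq_single 0]
  · refine Finset.sum_congr rfl fun i _ => ?_
    rw [Nat.cast_zero, zero_add, if_pos (dvd_mul_right _ _), Int.mul_ediv_cancel_left _ hlZ,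
      show (-((l : ℤ) * i * x)) = l * (-(i * x)) by ring, ec_mul_mul hl0]
    ring
  · intro a ha ha0
    refine Finset.sum_eq_zero fun b _ => ?_
    rw [if_neg, mul_zero]
    intro h
    have h2 : (l : ℤ) ∣ a := (Int.dvd_add_left (dvd_mul_right _ _)).1 h
    have := Int.le_of_dvd (by omega) h2
    have := Finset.mem_range.1 ha
    omega
  · intro h; simp at h; omega

/-- The genus-type weight of a solution of `x² ≡ D (mod c)`, as a function of `y = (x² - D)/c`. -/
def wt (n₀ c : ℕ) (y : ℤ) : ℤ :=
  jacobiSym ((n₀ / n₀.gcd c : ℕ) : ℤ) c * jacobiSym y (n₀.gcd c) *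
    if n₀.gcd c % 4 = 1 then jacobiSym (-1) c else 1

lemma sum_ec_mul_klDiv_eq (m : ℤ) {n₀ c : ℕ} (hn : Squarefree n₀) (hc : Odd c) (x : ℤ) :
    ∑ j ∈ Finset.range c, ec c (-(j * x)) * klDiv m n₀ c j =
      if (c : ℤ) ∣ x ^ 2 - m * n₀ then (c : ℂ) * wt n₀ c ((x ^ 2 - m * n₀) / c) else 0 := by
  have hc0 : c ≠ 0 := hc.pos.ne'
  have hn0 : n₀ ≠ 0 := hn.ne_zero
  rw [sum_ec_mul_klDiv m n₀ hc0, wt]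
  obtain ⟨n₁, hn₁⟩ := Nat.gcd_dvd_left n₀ c
  obtain ⟨c₂, hc₂⟩ := Nat.gcd_dvd_right n₀ c
  set q := n₀.gcd c with hqdef
  have hqn : q ∣ n₀ := ⟨n₁, hn₁⟩
  have hqsq : Squarefree q := hn.squarefree_of_dvd hqn
  have hq0 : q ≠ 0 := hqsq.ne_zero
  have hqodd : Odd q := by rw [hc₂] at hc; exact (Nat.odd_mul.1 hc).1
  have hc2odd : Odd c₂ := by rw [hc₂] at hc; exact (Nat.odd_mul.1 hc).2
  have hc20 : c₂ ≠ 0 := hc2odd.pos.ne'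
  have hqZ : (q : ℤ) ≠ 0 := by exact_mod_cast hq0
  have hc2Z : (c₂ : ℤ) ≠ 0 := by exact_mod_cast hc20
  have hn1c2 : Nat.Coprime n₁ c₂ := by
    have h : q * Nat.gcd n₁ c₂ = q := by
      rw [← Nat.gcd_mul_left, ← hn₁, ← hc₂]
    exact Nat.eq_of_mul_eq_mul_left (Nat.pos_of_ne_zero hq0) (by rw [h, mul_one])
  have hn1q : Nat.Coprime n₁ q := by
    rw [hn₁, Nat.squarefree_mul_iff] at hn
    exact hn.1.symm
  obtain ⟨ν, k, hνk⟩ := Nat.isCoprime_iff_coprime.2 hn1c2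
  have hν : (c₂ : ℤ) ∣ ν * n₁ - 1 := ⟨-k, by linarith⟩
  have hdiv : n₀ / q = n₁ := by rw [hn₁]; exact Nat.mul_div_cancel_left _ (Nat.pos_of_ne_zero hq0)
  rw [hdiv]
  set K : ℂ := epsFactor (q * c₂) * epsFactor c₂ * jacobiSym n₁ c₂ with hK
  set Y : ℤ := m - q * ν * (x / q) ^ 2 with hY
  have hterm : ∀ l ∈ c.divisors, (jacobiSym (-n₀) l : ℂ) * ∑ i ∈ Finset.range (c / l),
        ec (c / l) (-(i * x)) * kl m (n₀ * (i : ℤ) ^ 2) (c / l) =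
      if (q : ℤ) ∣ x then ((√(q : ℝ) : ℝ) : ℂ) * K * ∑ a ∈ Finset.range (c / l),
        (if IsCoprime (a : ℤ) ((c / l : ℕ) : ℤ) then
          (jacobiSym ((l * a : ℕ) : ℤ) q : ℂ) * ec c ((l * a : ℕ) * Y) else 0) else 0 := by
    intro l hl
    have hlc := (Nat.mem_divisors.1 hl).1
    have hl0 : l ≠ 0 := by rintro rfl; exact hc0 (zero_dvd_iff.1 hlc)
    have hJl : ∀ a : ℕ, jacobiSym ((l * a : ℕ) : ℤ) q = jacobiSym l q * jacobiSym a q := by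
      intro a; push_cast; rw [jacobiSym.mul_left]
    by_cases hcop : Nat.Coprime l n₀
    · have hlq : Nat.Coprime l q := hcop.coprime_dvd_right hqn
      have hlc2 : l ∣ c₂ := hlq.dvd_of_dvd_mul_left (hc₂ ▸ hlc)
      obtain ⟨c₃, hc₃⟩ := hlc2
      have hlodd : Odd l := by rw [hc₃] at hc2odd; exact (Nat.odd_mul.1 hc2odd).1
      have hc3odd : Odd c₃ := by rw [hc₃] at hc2odd; exact (Nat.odd_mul.1 hc2odd).2
      have hcl : c / l = q * c₃ := by
        rw [hc₂, hc₃, mul_left_comm]; exact Nat.mul_div_cancel_left _ (Nat.pos_of_ne_zero hl0)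
      have hcl' : c = l * (q * c₃) := by rw [hc₂, hc₃, mul_left_comm]
      have hν3 : (c₃ : ℤ) ∣ ν * n₁ - 1 := by
        refine dvd_trans ?_ hν
        rw [hc₃]; push_cast; exact dvd_mul_left _ _
      have hmul := multiplier_mul hqodd hlodd hc3odd (n₁ := n₁) (Nat.isCoprime_iff_coprime.2
        (hcop.coprime_dvd_right ⟨q, by rw [hn₁, mul_comm]⟩).symm)
      rw [← hc₃, ← hK] at hmul
      have hn₁Z : (n₀ : ℤ) = q * n₁ := by exact_mod_cast hn₁
      rw [hcl, hn₁Z, sum_ec_mul_kl hqodd hc3odd hν3 m x]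
      split_ifs with hx
      · rw [← hY]
        have : ∀ a : ℕ, ec c ((l * a : ℕ) * Y) = ec (q * c₃) (a * Y) := by
          intro a
          rw [← ec_mul_mul hl0 (q * c₃) (a * Y), ← hcl']
          congr 1; push_cast; ring
        simp only [this, hJl]
        have hsum : ∑ a ∈ Finset.range (q * c₃), (if IsCoprime (a : ℤ) ((q * c₃ : ℕ) : ℤ) then
            ((jacobiSym l q * jacobiSym a q : ℤ) : ℂ) * ec (q * c₃) (a * Y) else 0) =
            jacobiSym l q * ∑ a ∈ Finset.range (q * c₃),
              (if IsCoprime (a : ℤ) ((q * c₃ : ℕ) : ℤ) then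
                (jacobiSym a q : ℂ) * ec (q * c₃) (a * Y) else 0) := by
          rw [Finset.mul_sum]
          refine Finset.sum_congr rfl fun a _ => ?_
          split_ifs
          · push_cast; ring
          · ring
        rw [hsum]
        generalize (∑ a ∈ Finset.range (q * c₃), (if IsCoprime (a : ℤ) ((q * c₃ : ℕ) : ℤ) then
                (jacobiSym a q : ℂ) * ec (q * c₃) (a * Y) else 0)) = S
        linear_combination ((√(q : ℝ) : ℝ) * S : ℂ) * hmul
      · ring
    · have h1 : jacobiSym (-(n₀ : ℤ)) l = 0 := by
        rw [jacobiSym.eq_zero_iff]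
        refine ⟨hl0, ?_⟩
        rw [Int.neg_gcd, Int.gcd_natCast_natCast]
        intro h; exact hcop (Nat.coprime_comm.1 h)
      have h2 : jacobiSym (l : ℤ) q = 0 := by
        rw [jacobiSym.eq_zero_iff]
        refine ⟨hq0, ?_⟩
        rw [Int.gcd_natCast_natCast]
        intro h; apply hcop
        have : Nat.gcd l n₀ ∣ Nat.gcd l q :=
          Nat.dvd_gcd (Nat.gcd_dvd_left _ _) (Nat.dvd_gcd (Nat.gcd_dvd_right _ _)
            ((Nat.gcd_dvd_left _ _).trans hlc))
        rw [h] at this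
        exact Nat.dvd_one.1 this
      simp only [h1, hJl, h2]
      simp
  rw [Finset.sum_congr rfl hterm]
  have hiff : (c : ℤ) ∣ x ^ 2 - m * n₀ → (q : ℤ) ∣ x := by
    intro h
    have h1 : (q : ℤ) ∣ x ^ 2 := by
      have h2 : (q : ℤ) ∣ x ^ 2 - m * n₀ := dvd_trans ⟨c₂, by exact_mod_cast hc₂⟩ h
      have h3 : (q : ℤ) ∣ m * n₀ := Dvd.dvd.mul_left (by exact_mod_cast hqn) _
      simpa using dvd_add h2 h3
    have hs : Squarefree (q : ℤ) := Int.squarefree_natCast.2 hqsq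
    exact (hs.dvd_pow_iff_dvd two_ne_zero).1 h1
  by_cases hx : (q : ℤ) ∣ x
  swap
  · rw [if_neg (fun h => hx (hiff h))]
    simp [hx]
  simp only [hx, if_true]
  rw [← Finset.mul_sum, sum_divisors_coprime hc0 (fun h => (jacobiSym (h : ℤ) q : ℂ) * ec c (h * Y))]
  have hfull := sum_jacobi_ec_mul hqodd hqsq hc20 Y
  rw [← hc₂] at hfull
  rw [hfull]
  obtain ⟨x₁, hx₁⟩ := hx
  have hxq : x / q = x₁ := by rw [hx₁]; exact Int.mul_ediv_cancel_left _ hqZ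
  rw [hxq] at hY
  have hcZ : (c : ℤ) = q * c₂ := by exact_mod_cast hc₂
  have hnZ : (n₀ : ℤ) = q * n₁ := by exact_mod_cast hn₁
  have hform : x ^ 2 - m * n₀ = q * -(n₁ * Y - q * c₂ * k * x₁ ^ 2) := by
    rw [hx₁, hnZ, hY]; linear_combination (-(q : ℤ) ^ 2 * x₁ ^ 2) * hνk
  have hdvd : (c : ℤ) ∣ x ^ 2 - m * n₀ ↔ (c₂ : ℤ) ∣ Y := by
    rw [hform, hcZ, mul_dvd_mul_iff_left hqZ, dvd_neg]
    have h1 : (c₂ : ℤ) ∣ q * c₂ * k * x₁ ^ 2 := ⟨q * k * x₁ ^ 2, by ring⟩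
    rw [dvd_sub_left h1]
    constructor
    · intro h
      exact (Nat.isCoprime_iff_coprime.2 hn1c2).symm.dvd_of_dvd_mul_left h
    · intro h; exact h.mul_left _
  simp only [hdvd]
  by_cases hYd : (c₂ : ℤ) ∣ Y
  · rw [if_pos hYd, if_pos hYd]
    obtain ⟨y₁, hy₁⟩ := hYd
    rw [hy₁, Int.mul_ediv_cancel_left _ hc2Z]
    have hy : (x ^ 2 - m * n₀) / c = -1 * n₁ * y₁ + q * (k * x₁ ^ 2) := by
      rw [hform, hcZ, hy₁]
      apply Int.ediv_eq_of_eq_mul_right (mul_ne_zero hqZ hc2Z)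
      ring
    have hJy : jacobiSym (-1 * n₁ * y₁ + q * (k * x₁ ^ 2)) q =
        jacobiSym (-1) q * jacobiSym n₁ q * jacobiSym y₁ q := by
      rw [jacobiSym_congr (b := -1 * n₁ * y₁) (by simp), jacobiSym.mul_left, jacobiSym.mul_left]
    rw [hy, hJy, gs_one hqodd]
    have e1 := eps_mul_eps hqodd hc2odd
    rw [← hc₂] at e1
    have e2 : (jacobiSym n₁ q : ℂ) * jacobiSym n₁ q = 1 := by
      have := jacobiSym.sq_one (Int.isCoprime_iff_gcd_eq_one.1 (Nat.isCoprime_iff_coprime.2 hn1q))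
      rw [sq] at this
      exact_mod_cast this
    have e3 : (jacobiSym n₁ c : ℂ) = jacobiSym n₁ q * jacobiSym n₁ c₂ := by
      have : jacobiSym n₁ c = jacobiSym n₁ q * jacobiSym n₁ c₂ := by
        rw [hc₂, jacobiSym.mul_right' _ hq0 hc20]
      exact_mod_cast this
    have e4 : ((√(q : ℝ) : ℝ) : ℂ) * (√(q : ℝ) : ℝ) = q := by
      rw [← ofReal_mul, Real.mul_self_sqrt (by positivity)]; simp
    have e5 : (c : ℂ) = q * c₂ := by exact_mod_cast hc₂
    rw [← hc₂] at hK
    generalize ((if q % 4 = 1 then jacobiSym (-1) c else 1 : ℤ)) = sg at e1 ⊢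
    rw [hK]
    push_cast
    rw [e3, e5]
    linear_combination (((√(q : ℝ) : ℝ) : ℂ) ^ 2 * c₂ * jacobiSym y₁ q * jacobiSym n₁ c₂) * e1
      + (c₂ * jacobiSym y₁ q * jacobiSym n₁ c₂ * jacobiSym (-1) q * sg : ℂ) * e4
      - (q * c₂ * jacobiSym y₁ q * jacobiSym n₁ c₂ * jacobiSym (-1) q * sg : ℂ) * e2
  · rw [if_neg hYd, if_neg hYd]
    simp

lemma klDiv_eq (m : ℤ) {n₀ c : ℕ} (hn : Squarefree n₀) (hc : Odd c) (j : ℤ) :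
    klDiv m n₀ c j = ∑ x ∈ Finset.range c, if (c : ℤ) ∣ (x : ℤ) ^ 2 - m * n₀ then
      (wt n₀ c (((x : ℤ) ^ 2 - m * n₀) / c) : ℂ) * ec c (j * x) else 0 := by
  have hc0 : c ≠ 0 := hc.pos.ne'
  have hcC : (c : ℂ) ≠ 0 := by exact_mod_cast hc0
  have h := fourier_inversion hc0 (isPer_klDiv m n₀ hc0) j
  simp only [sum_ec_mul_klDiv_eq m hn hc] at h
  apply mul_left_cancel₀ hcC
  rw [← h, Finset.mul_sum]
  refine Finset.sum_congr rfl fun x _ => ?_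
  split_ifs
  · ring
  · simp

lemma jacobiSym_congr_right (a : ℤ) {b b' : ℕ} (hb : Odd b) (hb' : Odd b')
    (h : 4 * (a.natAbs : ℤ) ∣ (b : ℤ) - b') : jacobiSym a b = jacobiSym a b' := by
  have h' : b ≡ b' [MOD 4 * a.natAbs] := by
    have : (b' : ℤ) ≡ b [ZMOD ((4 * a.natAbs : ℕ) : ℤ)] := by
      rw [Int.modEq_iff_dvd]; push_cast; simpa using h
    exact ((Int.natCast_modEq_iff).1 this).symm
  rw [jacobiSym.mod_right a hb, h', ← jacobiSym.mod_right a hb']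

lemma jacobiSym_neg_four_mul_sub_one {n : ℕ} (hn : 1 ≤ n) : jacobiSym (-n) (4 * n - 1) = -1 := by
  have hodd : Odd (4 * n - 1) := ⟨2 * n - 1, by omega⟩
  have h1 : jacobiSym (4 * n) (4 * n - 1) = 1 := by
    rw [jacobiSym_congr (b := 1) ⟨1, by push_cast [Nat.cast_sub (show 1 ≤ 4 * n by omega)]; ring⟩,
      jacobiSym.one_left]
  have h4 : jacobiSym 4 (4 * n - 1) = 1 := by
    have := jacobiSym.sq_one' (a := 2) (b := 4 * n - 1) (by
      rw [← Int.isCoprime_iff_gcd_eq_one]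
      exact ⟨2 * n, -1, by push_cast [Nat.cast_sub (show 1 ≤ 4 * n by omega)]; ring⟩)
    simpa using this
  rw [jacobiSym.mul_left, h4, one_mul] at h1
  rw [jacobiSym.neg _ hodd, h1, ← jacobiSym.at_neg_one hodd, neg_one_jacobi hodd, if_neg (by omega)]
  norm_num

/-- The sign of `k` times `(-n₀ / |k|)`. -/
def chi (n₀ : ℕ) (k : ℤ) : ℤ := k.sign * jacobiSym (-n₀) k.natAbs

lemma chi_neg (n₀ : ℕ) (k : ℤ) : chi n₀ (-k) = -chi n₀ k := by
  simp [chi]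

lemma chi_mul (n₀ : ℕ) (k l : ℤ) : chi n₀ (k * l) = chi n₀ k * chi n₀ l := by
  rcases eq_or_ne k 0 with rfl | hk
  · simp [chi]
  rcases eq_or_ne l 0 with rfl | hl
  · simp [chi]
  rw [chi, chi, chi, Int.sign_mul, Int.natAbs_mul,
    jacobiSym.mul_right' _ (Int.natAbs_ne_zero.2 hk) (Int.natAbs_ne_zero.2 hl)]
  ring

lemma chi_eq_one {n₀ : ℕ} (hn : 1 ≤ n₀) {r s t : ℤ} (hr : r = s ^ 2 - 4 * n₀ * t)
    (hcop : IsCoprime r (2 * n₀)) : chi n₀ r = 1 := by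
  have hs : IsCoprime s (2 * n₀) := by
    have h1 : IsCoprime (s ^ 2) (2 * n₀) := by
      have : s ^ 2 = r + (2 * n₀) * (2 * t) := by rw [hr]; ring
      rw [this]
      exact IsCoprime.add_mul_left_left hcop _
    exact (IsCoprime.pow_left_iff two_pos).1 h1
  have odd_of : ∀ k : ℤ, IsCoprime k (2 * n₀) → Odd k.natAbs := by
    intro k hk
    rw [Int.natAbs_odd]
    have : IsCoprime k 2 := hk.of_mul_right_left
    exact Int.isCoprime_two_right.1 this
  have hsodd := odd_of s hs
  have hrodd := odd_of r hcop
  have hsq : jacobiSym (-n₀) (s.natAbs ^ 2) = 1 := by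
    rw [jacobiSym.pow_right]
    apply jacobiSym.sq_one
    rw [← Int.isCoprime_iff_gcd_eq_one]
    have : IsCoprime s (n₀ : ℤ) := hs.of_mul_right_right
    rcases Int.natAbs_eq s with h | h
    · rw [← h]; exact this.symm.neg_left
    · rw [h] at this
      exact (IsCoprime.neg_left_iff _ _).1 this |>.symm.neg_left
  have hsz : ((s.natAbs : ℕ) : ℤ) ^ 2 = s ^ 2 := Int.natAbs_sq s
  rcases lt_trichotomy r 0 with h | h | h
  · have hJ : jacobiSym (-n₀) r.natAbs = jacobiSym (-n₀) ((4 * n₀ - 1) * s.natAbs ^ 2) := by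
      refine jacobiSym_congr_right _ hrodd (Odd.mul ⟨2 * n₀ - 1, by omega⟩ hsodd.pow) ?_
      refine ⟨t - s ^ 2, ?_⟩
      push_cast [Nat.cast_sub (show 1 ≤ 4 * n₀ by omega)]
      rw [← Int.natCast_natAbs s, hsz, abs_of_neg h, hr]
      simp
      ring
    rw [chi, Int.sign_eq_neg_one_of_neg h, hJ,
      jacobiSym.mul_right' _ (by omega) (pow_ne_zero _ hsodd.pos.ne'), hsq,
      jacobiSym_neg_four_mul_sub_one hn]
    norm_num
  · rw [h] at hrodd; simp at hrodd
  · have hJ : jacobiSym (-n₀) r.natAbs = jacobiSym (-n₀) (s.natAbs ^ 2) := by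
      refine jacobiSym_congr_right _ hrodd hsodd.pow ⟨-t, ?_⟩
      push_cast
      rw [← Int.natCast_natAbs s, hsz, abs_of_pos h, hr]
      simp
    rw [chi, Int.sign_eq_one_of_pos h, hJ, hsq, one_mul]

/-- A value of the form at a vector with even first coordinate, coprime to `2 n₀`. -/
def QForm.Good (n₀ : ℕ) (Q : QForm) (v : ℤ × ℤ) : Prop :=
  2 ∣ v.1 ∧ IsCoprime (Q.val v) (2 * n₀)

open Classical in
/-- The genus character attached to `n₀`. -/
def genus (n₀ : ℕ) (Q : QForm) : ℤ :=
  if h : (n₀ : ℤ) ∣ Q.disc ∧ ∃ v, Q.Good n₀ v then chi n₀ (Q.val h.2.choose) else 0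

lemma chi_val_eq {n₀ : ℕ} (hn : 1 ≤ n₀) {Q : QForm} (hQ : (n₀ : ℤ) ∣ Q.disc) {v w : ℤ × ℤ}
    (hv : Q.Good n₀ v) (hw : Q.Good n₀ w) : chi n₀ (Q.val v) = chi n₀ (Q.val w) := by
  have key : ∀ a b : ℤ × ℤ, Q.Good n₀ a → Q.Good n₀ b →
      chi n₀ (Q.val a) * chi n₀ (Q.val b) = 1 := by
    rintro ⟨a1, a2⟩ ⟨b1, b2⟩ ⟨ha, ha'⟩ ⟨hb, hb'⟩
    rw [← chi_mul]
    obtain ⟨a3, h3⟩ := ha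
    obtain ⟨b3, h4⟩ := hb
    obtain ⟨d, hd⟩ := hQ
    simp only at h3 h4
    subst h3 h4
    refine chi_eq_one hn (s := Q.y * (2 * a3) * (2 * b3) + Q.x * (2 * a3 * b2 + a2 * (2 * b3))
      + Q.A * a2 * b2) (t := d * (a3 * b2 - b3 * a2) ^ 2) ?_ (ha'.mul_left hb')
    simp only [QForm.val, qf]
    simp only [QForm.disc] at hd
    linear_combination (-4 * (a3 * b2 - b3 * a2) ^ 2) * hd
  have h1 := key v v hv hv
  have h2 := key v w hv hw
  have : chi n₀ (Q.val v) ≠ 0 := by intro h; rw [h] at h1; simp at h1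
  exact mul_left_cancel₀ this (h1.trans h2.symm)

lemma genus_eq {n₀ : ℕ} (hn : 1 ≤ n₀) {Q : QForm} (hQ : (n₀ : ℤ) ∣ Q.disc) {v : ℤ × ℤ}
    (hv : Q.Good n₀ v) : genus n₀ Q = chi n₀ (Q.val v) := by
  have h : (n₀ : ℤ) ∣ Q.disc ∧ ∃ v, Q.Good n₀ v := ⟨hQ, v, hv⟩
  rw [genus, dif_pos h]
  exact chi_val_eq hn hQ h.2.choose_spec hv

lemma genus_smul {n₀ : ℕ} (hn : 1 ≤ n₀) {M : Matrix.SpecialLinearGroup (Fin 2) ℤ}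
    (hM : M ∈ CongruenceSubgroup.Gamma0 2) (Q : QForm) : genus n₀ (M • Q) = genus n₀ Q := by
  have good : ∀ M ∈ CongruenceSubgroup.Gamma0 2, ∀ (Q : QForm) (v : ℤ × ℤ),
      (M • Q).Good n₀ v → Q.Good n₀ (rowMul v M) := by
    rintro M hM Q v ⟨h1, h2⟩
    rw [mem_Gamma0_two] at hM
    refine ⟨?_, by rwa [val_smul] at h2⟩
    exact dvd_add (h1.mul_right _) (Dvd.dvd.mul_left (Int.dvd_of_emod_eq_zero hM) _)
  by_cases hQ : (n₀ : ℤ) ∣ Q.disc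
  · by_cases h : ∃ v, (M • Q).Good n₀ v
    · obtain ⟨v, hv⟩ := h
      rw [genus_eq hn (by rwa [QForm.disc_smul]) hv, genus_eq hn hQ (good M hM Q v hv), val_smul]
    · have h' : ¬ ∃ v, Q.Good n₀ v := by
        rintro ⟨v, hv⟩
        refine h ⟨_, good M⁻¹ (inv_mem hM) (M • Q) v ?_⟩
        rwa [inv_smul_smul]
      rw [genus, genus, dif_neg (fun hh => h hh.2), dif_neg (fun hh => h' hh.2)]
  · rw [genus, genus, dif_neg (fun hh => hQ (by simpa [QForm.disc_smul] using hh.1)),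
      dif_neg (fun hh => hQ hh.1)]

lemma genus_neg {n₀ : ℕ} (hn : 1 ≤ n₀) (Q : QForm) :
    genus n₀ ⟨-Q.A, Q.x, -Q.y⟩ = -genus n₀ Q := by
  have hval : ∀ (Q : QForm) (v : ℤ × ℤ),
      (⟨-Q.A, Q.x, -Q.y⟩ : QForm).val v = -Q.val (v.1, -v.2) := by
    intro Q v
    simp only [QForm.val, qf]
    ring
  have hdisc : (⟨-Q.A, Q.x, -Q.y⟩ : QForm).disc = Q.disc := by
    simp only [QForm.disc]; ring
  have good : ∀ v, (⟨-Q.A, Q.x, -Q.y⟩ : QForm).Good n₀ v ↔ Q.Good n₀ (v.1, -v.2) := by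
    intro v
    rw [QForm.Good, QForm.Good, hval, IsCoprime.neg_left_iff]
  by_cases hQ : (n₀ : ℤ) ∣ Q.disc
  · by_cases h : ∃ v, Q.Good n₀ v
    · obtain ⟨v, hv⟩ := h
      have hv' : (⟨-Q.A, Q.x, -Q.y⟩ : QForm).Good n₀ (v.1, -v.2) := by
        rw [good]; simpa using hv
      rw [genus_eq hn (by rwa [hdisc]) hv', genus_eq hn hQ hv, hval, chi_neg]
      simp
    · rw [genus, genus, dif_neg, dif_neg (fun hh => h hh.2), neg_zero]
      rintro ⟨-, v, hv⟩
      exact h ⟨_, (good v).1 hv⟩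
  · rw [genus, genus, dif_neg (fun hh => hQ (hdisc ▸ hh.1)), dif_neg (fun hh => hQ hh.1), neg_zero]

lemma genus_eq_wt {n₀ c : ℕ} (hn : Squarefree n₀) (hc : Odd c) {x y : ℤ}
    (hQ : (n₀ : ℤ) ∣ x ^ 2 - c * y) : genus n₀ ⟨c, x, y⟩ = wt n₀ c y := by
  have hn0 : 1 ≤ n₀ := Nat.pos_of_ne_zero hn.ne_zero
  have hc0 : c ≠ 0 := hc.pos.ne'
  have hdisc : (n₀ : ℤ) ∣ (⟨c, x, y⟩ : QForm).disc := hQ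
  rw [wt]
  obtain ⟨n₁, hn₁⟩ := Nat.gcd_dvd_left n₀ c
  obtain ⟨c₂, hc₂⟩ := Nat.gcd_dvd_right n₀ c
  have hgcd : n₀.gcd c = n₀.gcd c := rfl
  set q := n₀.gcd c with hqdef
  have hqsq : Squarefree q := hn.squarefree_of_dvd ⟨n₁, hn₁⟩
  have hq0 : q ≠ 0 := hqsq.ne_zero
  have hqodd : Odd q := by rw [hc₂] at hc; exact (Nat.odd_mul.1 hc).1
  have hn1c2 : Nat.Coprime n₁ c₂ := by
    have h : q * Nat.gcd n₁ c₂ = q := by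
      rw [← Nat.gcd_mul_left, ← hn₁, ← hc₂]
    exact Nat.eq_of_mul_eq_mul_left (Nat.pos_of_ne_zero hq0) (by rw [h, mul_one])
  have hn1q : Nat.Coprime n₁ q := by
    rw [hn₁, Nat.squarefree_mul_iff] at hn
    exact hn.1.symm
  have hn1c : Nat.Coprime n₁ c := by rw [hc₂]; exact hn1q.mul_right hn1c2
  have hdiv : n₀ / q = n₁ := by rw [hn₁]; exact Nat.mul_div_cancel_left _ (Nat.pos_of_ne_zero hq0)
  rw [hdiv]
  have hn1 : 1 ≤ n₁ := by
    rcases Nat.eq_zero_or_pos n₁ with h | h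
    · rw [h, mul_zero] at hn₁; omega
    · exact h
  have hcZ : (c : ℤ) = q * c₂ := by exact_mod_cast hc₂
  have hnZ : (n₀ : ℤ) = q * n₁ := by exact_mod_cast hn₁
  by_cases hy : IsCoprime y (q : ℤ)
  swap
  · have h0 : jacobiSym y q = 0 := by
      rw [jacobiSym.eq_zero_iff]
      exact ⟨hq0, fun h => hy (Int.isCoprime_iff_gcd_eq_one.2 h)⟩
    rw [h0, mul_zero, zero_mul, genus, dif_neg]
    rintro ⟨-, v, -, hv⟩
    apply hy
    have hqx : (q : ℤ) ∣ x := by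
      have h1 : (q : ℤ) ∣ x ^ 2 := by
        have h2 : (q : ℤ) ∣ x ^ 2 - c * y := dvd_trans ⟨n₁, hnZ⟩ hQ
        have h3 : (q : ℤ) ∣ c * y := ⟨c₂ * y, by rw [hcZ]; ring⟩
        simpa using dvd_add h2 h3
      exact ((Int.squarefree_natCast.2 hqsq).dvd_pow_iff_dvd two_ne_zero).1 h1
    obtain ⟨x₁, hx₁⟩ := hqx
    have h1 : IsCoprime ((⟨c, x, y⟩ : QForm).val v) q := by
      rw [hnZ] at hv
      exact hv.of_mul_right_right.of_mul_right_left
    have h2 : (⟨c, x, y⟩ : QForm).val v = y * v.1 ^ 2 +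
        q * (2 * x₁ * v.1 * v.2 + c₂ * v.2 ^ 2) := by
      simp only [QForm.val, qf, hx₁, hcZ]; ring
    rw [h2] at h1
    exact (IsCoprime.of_add_mul_left_left h1).of_mul_left_left
  set W : ℤ := |4 * x * n₁ * q| + |4 * y * n₁ ^ 2| with hW
  have hW0 : 0 ≤ W := by positivity
  set w : ℤ := 1 + 2 * n₁ * W with hw
  have hn1Z : (1 : ℤ) ≤ n₁ := by exact_mod_cast hn1
  have hwW : W + 1 ≤ w := by rw [hw]; nlinarith
  set k : ℤ := (⟨c, x, y⟩ : QForm).val (2 * n₁, q * w) with hk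
  have hkeq : k = 4 * y * n₁ ^ 2 + 4 * x * n₁ * q * w + c * (q * w) ^ 2 := by
    rw [hk]; simp only [QForm.val, qf]; ring
  have hkpos : 0 < k := by
    have h1 : w ^ 2 ≤ c * (q * w) ^ 2 := by
      have : (1 : ℤ) ≤ c * q ^ 2 := by
        have : 0 < (c : ℤ) * q ^ 2 := by
          have := Nat.pos_of_ne_zero hc0
          have := Nat.pos_of_ne_zero hq0
          positivity
        linarith
      nlinarith [sq_nonneg w]
    have h2 : -|4 * x * n₁ * q| * w ≤ 4 * x * n₁ * q * w :=
      mul_le_mul_of_nonneg_right (neg_abs_le _) (by linarith)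
    have h3 : -|4 * y * n₁ ^ 2| ≤ 4 * y * n₁ ^ 2 := neg_abs_le _
    have h4 : 0 ≤ |4 * y * (n₁ : ℤ) ^ 2| := abs_nonneg _
    have h5 : 0 ≤ |4 * x * n₁ * (q : ℤ)| := abs_nonneg _
    rw [hkeq]
    nlinarith
  have hw2 : IsCoprime w (2 * n₁) := ⟨1, -W, by rw [hw]; ring⟩
  have hqZ2 : IsCoprime (q : ℤ) 2 := by
    exact_mod_cast Nat.isCoprime_iff_coprime.2 (Nat.coprime_two_right.2 hqodd)
  have hcZ2 : IsCoprime (c : ℤ) 2 := by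
    exact_mod_cast Nat.isCoprime_iff_coprime.2 (Nat.coprime_two_right.2 hc)
  have hq2n : IsCoprime (q : ℤ) (2 * n₁) := hqZ2.mul_right (Nat.isCoprime_iff_coprime.2 hn1q.symm)
  have hc2n : IsCoprime (c : ℤ) (2 * n₁) := hcZ2.mul_right (Nat.isCoprime_iff_coprime.2 hn1c.symm)
  have hkn : IsCoprime k (2 * n₁) := by
    have : k = c * (q * w) ^ 2 + 2 * n₁ * (2 * y * n₁ + 2 * x * q * w) := by rw [hkeq]; ring
    rw [this]
    exact IsCoprime.add_mul_left_left (hc2n.mul_left (hq2n.mul_left hw2).pow_left) _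
  have hkq : IsCoprime k q := by
    have : k = y * (2 * n₁) ^ 2 + q * (4 * x * n₁ * w + c * q * w ^ 2) := by rw [hkeq]; ring
    rw [this]
    exact IsCoprime.add_mul_left_left (hy.mul_left hq2n.symm.pow_left) _
  have hgood : (⟨c, x, y⟩ : QForm).Good n₀ (2 * n₁, q * w) := by
    refine ⟨dvd_mul_right _ _, ?_⟩
    rw [hnZ, mul_left_comm]
    exact hkq.mul_right hkn
  rw [genus_eq hn0 hdisc hgood, ← hk, chi, Int.sign_eq_one_of_pos hkpos, one_mul]
  set K := k.natAbs with hK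
  have hKk : (K : ℤ) = k := by rw [hK, Int.natCast_natAbs, abs_of_pos hkpos]
  have hKodd : Odd K := by
    rw [hK, Int.natAbs_odd]
    exact Int.isCoprime_two_right.1 hkn.of_mul_right_left
  have hqw : ((q * w).natAbs : ℤ) ^ 2 = (q * w) ^ 2 := Int.natAbs_sq _
  have hqwodd : Odd (q * w).natAbs := by
    rw [Int.natAbs_odd]
    exact Int.isCoprime_two_right.1 (hq2n.mul_left hw2).of_mul_right_left
  have hJ1 : jacobiSym (-n₁) K = jacobiSym (-n₁) c := by
    have h1 : jacobiSym (-n₁) K = jacobiSym (-n₁) (c * (q * w).natAbs ^ 2) := by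
      refine jacobiSym_congr_right _ hKodd (hc.mul hqwodd.pow) ⟨y * n₁ + x * q * w, ?_⟩
      push_cast
      rw [← Int.natCast_natAbs (q * w), hqw, hKk, hkeq]
      simp
      ring
    rw [h1, jacobiSym.mul_right' _ hc0 (pow_ne_zero _ hqwodd.pos.ne'), jacobiSym.pow_right,
      jacobiSym.sq_one, mul_one]
    rw [← Int.isCoprime_iff_gcd_eq_one]
    have : IsCoprime (q * w) (n₁ : ℤ) := (hq2n.mul_left hw2).of_mul_right_right
    rcases Int.natAbs_eq (q * w) with h | h
    · rw [← h]; exact this.symm.neg_left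
    · rw [h] at this
      exact (IsCoprime.neg_left_iff _ _).1 this |>.symm.neg_left
  have hJ2 : jacobiSym K q = jacobiSym y q := by
    have h1 : jacobiSym K q = jacobiSym (y * (2 * n₁) ^ 2) q := by
      refine jacobiSym_congr ⟨4 * x * n₁ * w + c * q * w ^ 2, ?_⟩
      rw [hKk, hkeq]; ring
    rw [h1, jacobiSym.mul_left, jacobiSym.pow_left, jacobiSym.sq_one, mul_one]
    exact Int.isCoprime_iff_gcd_eq_one.1 hq2n.symm
  have hK4 : K % 4 = c % 4 := by
    have hodd2 : (q * w) % 2 = 1 := by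
      rw [← Int.odd_iff]; exact Int.natAbs_odd.1 hqwodd
    obtain ⟨d, hd⟩ : ∃ d, q * w = 2 * d + 1 := ⟨q * w / 2, by omega⟩
    have : (K : ℤ) = c + 4 * (y * n₁ ^ 2 + x * n₁ * (2 * d + 1) + c * (d ^ 2 + d)) := by
      rw [hKk, hkeq, show 4 * x * n₁ * q * w = 4 * x * n₁ * (q * w) by ring, hd]; ring
    omega
  have hrec := jacobiSym.quadratic_reciprocity_if (Nat.odd_iff.1 hqodd) (Nat.odd_iff.1 hKodd)
  rw [hJ2, hK4] at hrec
  have hsplit : jacobiSym (-n₀) K = jacobiSym (-n₁) K * jacobiSym q K := by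
    rw [← jacobiSym.mul_left]; congr 1; rw [hnZ]; ring
  have hneg : jacobiSym (-n₁) c = jacobiSym (-1) c * jacobiSym n₁ c := by
    rw [← jacobiSym.mul_left]; congr 1; ring
  rw [hsplit, hJ1, ← hrec, hneg, neg_one_jacobi hc]
  have h3 : ∀ n : ℕ, Odd n → n % 4 = 1 ∨ n % 4 = 3 := by rintro n ⟨k, rfl⟩; omega
  rcases h3 q hqodd with h | h <;> rcases h3 c hc with h' | h' <;> simp [h, h']

lemma wt_congr {n₀ c : ℕ} (hn : Squarefree n₀) (hc : c ≠ 0) {m x x' : ℤ}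
    (hx : (c : ℤ) ∣ x ^ 2 - m * n₀)
    (hx' : (c : ℤ) ∣ x' ^ 2 - m * n₀) (h : (c : ℤ) ∣ x' - x ∨ (c : ℤ) ∣ x' + x) :
    wt n₀ c ((x' ^ 2 - m * n₀) / c) = wt n₀ c ((x ^ 2 - m * n₀) / c) := by
  have hq : ∀ x : ℤ, (c : ℤ) ∣ x ^ 2 - m * n₀ → ((n₀.gcd c : ℕ) : ℤ) ∣ x := by
    intro x hx
    have h1 : ((n₀.gcd c : ℕ) : ℤ) ∣ x ^ 2 := by
      have h2 := (Int.natCast_dvd_natCast.2 (Nat.gcd_dvd_right n₀ c)).trans hx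
      have h3 : ((n₀.gcd c : ℕ) : ℤ) ∣ m * n₀ :=
        Dvd.dvd.mul_left (Int.natCast_dvd_natCast.2 (Nat.gcd_dvd_left n₀ c)) _
      simpa using dvd_add h2 h3
    have hs : Squarefree (n₀.gcd c) := hn.squarefree_of_dvd (Nat.gcd_dvd_left _ _)
    exact ((Int.squarefree_natCast.2 hs).dvd_pow_iff_dvd two_ne_zero).1 h1
  have hcZ : (c : ℤ) ≠ 0 := by exact_mod_cast hc
  have hJ : jacobiSym ((x' ^ 2 - m * n₀) / c) (n₀.gcd c) =
      jacobiSym ((x ^ 2 - m * n₀) / c) (n₀.gcd c) := by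
    apply jacobiSym_congr
    have h1 := hq x hx
    have h2 := hq x' hx'
    obtain ⟨y, hy⟩ := hx
    obtain ⟨y', hy'⟩ := hx'
    rw [hy, hy', Int.mul_ediv_cancel_left _ hcZ, Int.mul_ediv_cancel_left _ hcZ]
    rcases h with ⟨k, hk⟩ | ⟨k, hk⟩
    · have : y' - y = k * (x' + x) := by
        apply mul_left_cancel₀ hcZ
        linear_combination hy - hy' + (x' + x) * hk
      rw [this]
      exact (dvd_add h2 h1).mul_left _
    · have : y' - y = k * (x' - x) := by
        apply mul_left_cancel₀ hcZ
        linear_combination hy - hy' + (x' - x) * hk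
      rw [this]
      exact (dvd_sub h2 h1).mul_left _
  rw [wt, wt, hJ]

lemma ec_add_ec_neg (c : ℕ) (n : ℤ) : ec c n + ec c (-n) = 2 * (Real.cos (2 * π * n / c) : ℝ) := by
  rw [ec, ec, ee, ee, ofReal_cos, Complex.two_cos]
  push_cast
  congr 2 <;> ring

lemma klDiv_eq_sum_cos (m : ℤ) {n₀ c : ℕ} (hn : Squarefree n₀) (hc : Odd c) (j : ℕ) :
    klDiv m n₀ c j = ((∑ x ∈ Finset.range c, if (c : ℤ) ∣ (x : ℤ) ^ 2 - m * n₀ then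
      (genus n₀ ⟨c, x, ((x : ℤ) ^ 2 - m * n₀) / c⟩ : ℝ) * Real.cos (2 * π * j * x / c)
        else 0 : ℝ) : ℂ) := by
  have hc0 : c ≠ 0 := hc.pos.ne'
  rw [klDiv_eq m hn hc]
  set G : ℤ → ℂ := fun x => if (c : ℤ) ∣ x ^ 2 - m * n₀ then
      (wt n₀ c ((x ^ 2 - m * n₀) / c) : ℂ) * ec c (j * x) else 0 with hG
  have hGper : IsPer c G := by
    intro a b hab
    have hd : (c : ℤ) ∣ a ^ 2 - m * n₀ ↔ (c : ℤ) ∣ b ^ 2 - m * n₀ := by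
      have : a ^ 2 - m * n₀ = (b ^ 2 - m * n₀) + (a - b) * (a + b) := by ring
      rw [this]
      exact dvd_add_left (hab.mul_right _)
    by_cases hb : (c : ℤ) ∣ b ^ 2 - m * n₀
    · have ha := hd.2 hb
      simp only [hG]
      rw [if_pos ha, if_pos hb, wt_congr hn hc0 hb ha (Or.inl hab),
        ec_congr hc0 (m := j * a) (n := j * b) (by rw [← mul_sub]; exact hab.mul_left _)]
    · simp only [hG]
      rw [if_neg hb, if_neg (fun h => hb (hd.1 h))]
  have hneg := sum_affine hc0 hGper (u := -1) isCoprime_one_left.neg_left 0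
  have h2 : (2 : ℂ) * ∑ x ∈ Finset.range c, G x =
      ∑ x ∈ Finset.range c, (G x + G (-1 * x + 0)) := by
    rw [Finset.sum_add_distrib, hneg, two_mul]
  apply mul_left_cancel₀ (two_ne_zero (α := ℂ))
  refine h2.trans ?_
  push_cast
  rw [Finset.mul_sum]
  refine Finset.sum_congr rfl fun x _ => ?_
  simp only [hG]
  have hx2 : (-1 * (x : ℤ) + 0) ^ 2 = (x : ℤ) ^ 2 := by ring
  rw [hx2]
  by_cases hx : (c : ℤ) ∣ (x : ℤ) ^ 2 - m * n₀
  · rw [if_pos hx, if_pos hx, if_pos hx, ← mul_add]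
    have e1 : (j : ℤ) * (-1 * x + 0) = -(j * x) := by ring
    rw [e1, ec_add_ec_neg, genus_eq_wt hn hc]
    · push_cast
      have : (2 * π * (j * x) / c : ℂ) = 2 * π * j * x / c := by ring
      rw [this]
      ring
    · rw [Int.mul_ediv_cancel' hx]
      exact ⟨m, by ring⟩
  · rw [if_neg hx, if_neg hx, if_neg hx]; simp

lemma tendsto_sum_klDiv {m n₀ j : ℕ} (hm : 1 ≤ m) (hn : Squarefree n₀) (hj : 1 ≤ j) :
    Tendsto (fun N : ℕ => ∑ c ∈ Finset.range (N + 1), if Odd c then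
      klDiv m n₀ c j * ((Real.sin (2 * π * j * √((m * n₀ : ℕ) : ℝ) / c) : ℝ) : ℂ) else 0)
      atTop (𝓝 0) := by
  have hn0 : 1 ≤ n₀ := Nat.pos_of_ne_zero hn.ne_zero
  have hD : (0 : ℤ) < m * n₀ := by positivity
  have h := tendsto_twisted_sum hD hj (fun Q => (genus n₀ Q : ℝ))
    (fun M hM Q _ _ => by simp only [genus_smul hn0 hM])
    (fun Q => by simp only [genus_neg hn0]; push_cast; rfl)
  have h' := (continuous_ofReal.tendsto (0 : ℝ)).comp h
  rw [ofReal_zero] at h'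
  refine h'.congr fun N => ?_
  simp only [Function.comp]
  rw [ofReal_sum]
  refine Finset.sum_congr rfl fun c _ => ?_
  by_cases hc : Odd c
  · rw [if_pos hc, if_pos hc, klDiv_eq_sum_cos _ hn hc, ofReal_mul]
    congr 4
  · rw [if_neg hc, if_neg hc, ofReal_zero]

lemma sum_range_ite_dvd {l : ℕ} (hl : 0 < l) (F : ℕ → ℂ) (N : ℕ) :
    ∑ c ∈ Finset.range (N + 1), (if l ∣ c then F c else 0) =
      ∑ c ∈ Finset.range (N / l + 1), F (l * c) := by
  rw [← Finset.sum_filter]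
  refine Finset.sum_nbij' (fun c => c / l) (fun c => l * c) ?_ ?_ ?_ ?_ ?_
  · intro c hc
    rw [Finset.mem_filter, Finset.mem_range] at hc
    rw [Finset.mem_range, Nat.lt_succ_iff]
    exact Nat.div_le_div_right (by omega)
  · intro c hc
    rw [Finset.mem_range, Nat.lt_succ_iff, Nat.le_div_iff_mul_le hl] at hc
    rw [Finset.mem_filter, Finset.mem_range]
    exact ⟨by rw [mul_comm]; omega, dvd_mul_right _ _⟩
  · intro c hc
    exact Nat.mul_div_cancel' (Finset.mem_filter.1 hc).2
  · intro c _
    exact Nat.mul_div_cancel_left _ hl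
  · intro c hc
    rw [Nat.mul_div_cancel' (Finset.mem_filter.1 hc).2]

/-- Partial sums of the series attached to the pair `(m, n₀ j²)`. -/
def klPartial (m n₀ j N : ℕ) : ℂ := ∑ c ∈ Finset.range (N + 1), if Odd c then
  kl m (n₀ * (j : ℤ) ^ 2) c * ((Real.sin (2 * π * j * √((m * n₀ : ℕ) : ℝ) / c) : ℝ) : ℂ) else 0

lemma sum_klDiv_eq (m n₀ : ℕ) {j : ℕ} (hj : 1 ≤ j) (N : ℕ) :
    (∑ c ∈ Finset.range (N + 1), if Odd c then
      klDiv m n₀ c j * ((Real.sin (2 * π * j * √((m * n₀ : ℕ) : ℝ) / c) : ℝ) : ℂ) else 0) =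
    ∑ l ∈ j.divisors, (if Odd l then (jacobiSym (-n₀) l : ℂ) else 0) *
      klPartial m n₀ (j / l) (N / l) := by
  set s : ℕ → ℂ := fun c => ((Real.sin (2 * π * j * √((m * n₀ : ℕ) : ℝ) / c) : ℝ) : ℂ) with hs
  have hterm : ∀ c ∈ Finset.range (N + 1), (if Odd c then klDiv m n₀ c j * s c else 0) =
      ∑ l ∈ j.divisors, if l ∣ c then (if Odd c then (jacobiSym (-n₀) l : ℂ) *
        kl m (n₀ * ((j / l : ℕ) : ℤ) ^ 2) (c / l) * s c else 0) else 0 := by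
    intro c _
    by_cases hc : Odd c
    · have hc0 : c ≠ 0 := hc.pos.ne'
      simp only [if_pos hc]
      rw [klDiv, Finset.sum_mul]
      have e1 : ∀ l ∈ c.divisors, (if (l : ℤ) ∣ (j : ℤ) then
          (jacobiSym (-n₀) l : ℂ) * kl m (n₀ * ((j : ℤ) / l) ^ 2) (c / l) else 0) * s c =
          if l ∣ j then (jacobiSym (-n₀) l : ℂ) *
            kl m (n₀ * ((j / l : ℕ) : ℤ) ^ 2) (c / l) * s c else 0 := by
        intro l _
        simp only [Int.natCast_dvd_natCast, Int.natCast_div, ite_mul, zero_mul]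
      rw [Finset.sum_congr rfl e1, ← Finset.sum_filter, ← Finset.sum_filter]
      refine Finset.sum_congr ?_ fun _ _ => rfl
      ext l
      simp only [Finset.mem_filter, Nat.mem_divisors]
      constructor
      · rintro ⟨⟨h1, -⟩, h2⟩; exact ⟨⟨h2, by omega⟩, h1⟩
      · rintro ⟨⟨h1, -⟩, h2⟩; exact ⟨⟨h2, hc0⟩, h1⟩
    · simp [hc]
  rw [Finset.sum_congr rfl hterm, Finset.sum_comm]
  refine Finset.sum_congr rfl fun l hl => ?_
  have hlj := (Nat.mem_divisors.1 hl).1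
  have hl0 : 0 < l := Nat.pos_of_dvd_of_pos hlj hj
  rw [sum_range_ite_dvd hl0 (fun c => if Odd c then (jacobiSym (-n₀) l : ℂ) *
        kl m (n₀ * ((j / l : ℕ) : ℤ) ^ 2) (c / l) * s c else 0), klPartial, Finset.mul_sum]
  refine Finset.sum_congr rfl fun c _ => ?_
  by_cases hlo : Odd l
  swap
  · rw [if_neg hlo, zero_mul, if_neg (fun h => hlo (Nat.odd_mul.1 h).1)]
  by_cases hc : Odd c
  swap
  · rw [if_neg hc, mul_zero, if_neg (fun h => hc (Nat.odd_mul.1 h).2)]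
  rw [if_pos hlo, if_pos hc, if_pos (hlo.mul hc), Nat.mul_div_cancel_left _ hl0, mul_assoc]
  congr 2
  simp only [hs]
  congr 2
  obtain ⟨k, rfl⟩ := hlj
  rw [Nat.mul_div_cancel_left _ hl0]
  have hlR : (l : ℝ) ≠ 0 := by exact_mod_cast hl0.ne'
  have hcR : (c : ℝ) ≠ 0 := by exact_mod_cast hc.pos.ne'
  push_cast
  field_simp

lemma tendsto_klPartial {m n₀ : ℕ} (hm : 1 ≤ m) (hn : Squarefree n₀) (j : ℕ) (hj : 1 ≤ j) :
    Tendsto (klPartial m n₀ j) atTop (𝓝 0) := by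
  induction j using Nat.strong_induction_on with
  | _ j ih =>
    have h1 := tendsto_sum_klDiv hm hn hj
    simp only [sum_klDiv_eq m n₀ hj] at h1
    have h1mem : 1 ∈ j.divisors := Nat.mem_divisors.2 ⟨one_dvd _, by omega⟩
    have h2 : Tendsto (fun N : ℕ => ∑ l ∈ j.divisors.erase 1,
        (if Odd l then (jacobiSym (-n₀) l : ℂ) else 0) * klPartial m n₀ (j / l) (N / l))
        atTop (𝓝 0) := by
      have hterm : ∀ l ∈ j.divisors.erase 1, Tendsto (fun N : ℕ =>
          (if Odd l then (jacobiSym (-n₀) l : ℂ) else 0) * klPartial m n₀ (j / l) (N / l))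
          atTop (𝓝 0) := by
        intro l hl
        rw [Finset.mem_erase, Nat.mem_divisors] at hl
        have hl0 : 0 < l := Nat.pos_of_dvd_of_pos hl.2.1 hj
        have hlt : j / l < j := Nat.div_lt_self hj (by omega)
        have h := (ih (j / l) hlt (Nat.div_pos (Nat.le_of_dvd hj hl.2.1) hl0)).comp
          (Nat.tendsto_div_const_atTop hl0.ne')
        simpa only [mul_zero, Function.comp_def] using
          h.const_mul (if Odd l then (jacobiSym (-n₀) l : ℂ) else 0)
      have h := tendsto_finsetSum (j.divisors.erase 1) hterm
      rwa [Finset.sum_const_zero] at h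
    have h3 := h1.sub h2
    rw [sub_zero] at h3
    refine h3.congr fun N => ?_
    rw [← Finset.add_sum_erase _ _ h1mem, add_sub_cancel_right, if_pos odd_one,
      jacobiSym.one_right, Int.cast_one, one_mul, Nat.div_one, Nat.div_one]

/-- **Vanishing identity for weight-3/2 Kloosterman sums at odd moduli**: for integers
`m, n ≥ 1`, the series `Σ_{odd c>0} (S(m,n,c,ν_Θ³)/√c)·sin(2π√(mn)/c)` converges (as the
limit of its partial sums over odd `c ≤ N`), and its value is `0`. -/
theorem kloosterman_vanishing_odd (m n : ℕ) (hm : 1 ≤ m) (hn : 1 ≤ n) :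
    Filter.Tendsto
      (fun N : ℕ => ∑ c ∈ Finset.range (N + 1),
        if Odd c then
          SKo m n c 3 / ((Real.sqrt c : ℝ) : ℂ) *
            ((Real.sin (2 * π * Real.sqrt ((m : ℝ) * n) / c) : ℝ) : ℂ)
        else 0)
      Filter.atTop (nhds 0) := by
  obtain ⟨n₀, f, hf, hsq⟩ := Nat.sq_mul_squarefree n
  have hf1 : 1 ≤ f := by
    rcases Nat.eq_zero_or_pos f with h | h
    · rw [h] at hf; simp at hf; omega
    · exact h
  have h := (tendsto_klPartial hm hsq f hf1).const_mul (ee (3 / 8))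
  rw [mul_zero] at h
  refine h.congr fun N => ?_
  rw [klPartial, Finset.mul_sum]
  refine Finset.sum_congr rfl fun c _ => ?_
  by_cases hc : Odd c
  swap
  · rw [if_neg hc, if_neg hc, mul_zero]
  have hs : √((m : ℝ) * n) = f * √((m * n₀ : ℕ) : ℝ) := by
    rw [← hf]
    push_cast
    rw [show (m : ℝ) * (f ^ 2 * n₀) = f ^ 2 * (m * n₀) by ring, Real.sqrt_mul (by positivity),
      Real.sqrt_sq (by positivity)]
  have hnf : (n₀ : ℤ) * (f : ℤ) ^ 2 = n := by rw [← hf]; push_cast; ring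
  rw [if_pos hc, if_pos hc, SKo_eq_kl hc, hs, hnf, ← mul_assoc (2 * π), mul_assoc (ee _)]

end
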